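/- Let A = (A₁,…,A_N) be an irreducible tuple of finite subsets of ℤ^N and let B = (B₁,…,B_N) be any tuple of finite subsets of ℤ^N each of which equals one of the sets A₁,…,A_N (repetitions allowed). Then MV(B₁,…,B_N) ≤ MV(A₁,…,A_N)^{2^N}. -/

import Mathlib

open Pointwise MeasureTheory

namespace Esterov

/-- The standard embedding of the lattice `ℤⁿ` into `ℝⁿ`. -/
def toR {n : ℕ} (a : Fin n → ℤ) : Fin n → ℝ := fun j => (a j : ℝ)

/-- The lattice mixed volume of finite sets `A₁, …, Aₙ ⊆ ℤⁿ`: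
`MV(A₁,…,Aₙ) = ∑_{∅ ≠ S ⊆ {1,…,n}} (−1)^{n−|S|} vol (conv (∑_{i ∈ S} Aᵢ))`. -/
noncomputable def MV {n : ℕ} (A : Fin n → Finset (Fin n → ℤ)) : ℝ :=
  ∑ S ∈ Finset.univ.powerset.filter (fun S : Finset (Fin n) => S.Nonempty),
    (-1 : ℝ) ^ (n - S.card) *
      (volume (convexHull ℝ (∑ i ∈ S, toR '' (A i : Set (Fin n → ℤ))))).toReal

/-- The complex torus `(ℂ∖0)ⁿ`. -/
abbrev Torus (n : ℕ) := Fin n → ℂˣ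

/-- The index type of the coefficients of a tuple of supports. -/
abbrev CIdx {n : ℕ} (A : Fin n → Finset (Fin n → ℤ)) := Σ i : Fin n, {a : Fin n → ℤ // a ∈ A i}

/-- The space `ℂ^A = ℂ^{A₁} ⊕ ⋯ ⊕ ℂ^{Aₙ}` of systems of Laurent polynomials supported at `A`,
encoded by their coefficients. -/
abbrev Coeff {n : ℕ} (A : Fin n → Finset (Fin n → ℤ)) := CIdx A → ℂ

/-- The value of the Laurent monomial `x^a` at a point `x` of the torus. -/
noncomputable def mono {n : ℕ} (a : Fin n → ℤ) (x : Torus n) : ℂ :=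
  ∏ j, ((x j : ℂ) ^ (a j))

/-- The value of the `i`-th polynomial of the system `c ∈ ℂ^A` at `x`. -/
noncomputable def evalAt {n : ℕ} (A : Fin n → Finset (Fin n → ℤ)) (c : Coeff A) (i : Fin n)
    (x : Torus n) : ℂ :=
  ∑ a ∈ (A i).attach, c ⟨i, a⟩ * mono a.1 x

/-- `x` is a common root of the system `c ∈ ℂ^A`. -/
def IsRoot {n : ℕ} (A : Fin n → Finset (Fin n → ℤ)) (c : Coeff A) (x : Torus n) : Prop :=
  ∀ i, evalAt A c i x = 0

/-- The Jacobian matrix `(∂fᵢ/∂xⱼ (x))` of the system `c ∈ ℂ^A` at `x`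
(note `∂(x^a)/∂xⱼ = aⱼ x^a / xⱼ`). -/
noncomputable def jacobian {n : ℕ} (A : Fin n → Finset (Fin n → ℤ)) (c : Coeff A)
    (x : Torus n) : Matrix (Fin n) (Fin n) ℂ :=
  Matrix.of fun i j => (∑ a ∈ (A i).attach, c ⟨i, a⟩ * (a.1 j : ℂ) * mono a.1 x) * (x j : ℂ)⁻¹

/-- `x` is a singular root of the system `c`: a common root at which the Jacobian matrix
is degenerate. -/
def IsSingularRoot {n : ℕ} (A : Fin n → Finset (Fin n → ℤ)) (c : Coeff A) (x : Torus n) :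
    Prop :=
  IsRoot A c x ∧ (jacobian A c x).det = 0

/-- A subset of `ℂ^ι` is algebraic if it is the common zero locus of a family of polynomials. -/
def IsAlgebraicSet {ι : Type*} (Z : Set (ι → ℂ)) : Prop :=
  ∃ S : Set (MvPolynomial ι ℂ), Z = {c | ∀ p ∈ S, MvPolynomial.eval c p = 0}

/-- The Zariski closure of a subset of `ℂ^ι`. -/
def zclosure {ι : Type*} (Z : Set (ι → ℂ)) : Set (ι → ℂ) :=
  ⋂₀ {W | IsAlgebraicSet W ∧ Z ⊆ W}

/-- The ideal of polynomials vanishing on a subset of `ℂ^ι`. -/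
noncomputable def vanishingIdeal {ι : Type*} (Z : Set (ι → ℂ)) : Ideal (MvPolynomial ι ℂ) where
  carrier := {p | ∀ c ∈ Z, MvPolynomial.eval c p = 0}
  add_mem' := by
    intro p q hp hq c hc
    simp [hp c hc, hq c hc]
  zero_mem' := by
    intro c hc
    simp
  smul_mem' := by
    intro p q hq c hc
    simp [smul_eq_mul, hq c hc]

/-- The (complex) dimension of a subset of `ℂ^ι`, as the Krull dimension of the coordinate
ring of its Zariski closure. -/
noncomputable def adim {ι : Type*} (Z : Set (ι → ℂ)) : WithBot ℕ∞ :=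
  ringKrullDim (MvPolynomial ι ℂ ⧸ vanishingIdeal Z)

/-- The discriminant `D_A`: the Zariski closure of the set of systems having a singular root. -/
noncomputable def discSet {n : ℕ} (A : Fin n → Finset (Fin n → ℤ)) : Set (Coeff A) :=
  zclosure {c | ∃ x, IsSingularRoot A c x}

/-- The tuple `A` is dual effective: `D_A` is a hypersurface, i.e. has complex dimension
`dim ℂ^A − 1`. -/
def DualEffective {n : ℕ} (A : Fin n → Finset (Fin n → ℤ)) : Prop :=
  adim (discSet A) = ((Fintype.card (CIdx A) - 1 : ℕ) : WithBot ℕ∞)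

/-- The finite set `s` can be translated into the subgroup `L` of `ℤⁿ`. -/
def TranslatesInto {n : ℕ} (s : Finset (Fin n → ℤ)) (L : Submodule ℤ (Fin n → ℤ)) : Prop :=
  ∃ v : Fin n → ℤ, ∀ a ∈ s, a - v ∈ L

/-- A tuple of finite sets in `ℤⁿ` is reduced if the sets cannot all be translated into one
common proper subgroup of `ℤⁿ`. -/
def IsReducedTuple {n : ℕ} (A : Fin n → Finset (Fin n → ℤ)) : Prop :=
  ¬ ∃ L : Submodule ℤ (Fin n → ℤ), L ≠ ⊤ ∧ ∀ i, TranslatesInto (A i) L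

/-- A tuple of `n` finite sets in `ℤⁿ` is irreducible if for no `m` with `0 < m < n` can some
`n − m` of the sets be translated into one common subgroup of rank at most `n − m`. -/
def IsIrreducibleTuple {n : ℕ} (A : Fin n → Finset (Fin n → ℤ)) : Prop :=
  ¬ ∃ (I : Finset (Fin n)) (L : Submodule ℤ (Fin n → ℤ)),
      0 < I.card ∧ I.card < n ∧ Module.finrank ℤ L ≤ I.card ∧
      ∀ i ∈ I, TranslatesInto (A i) L

/-- The incidence variety `E = {(x, f) : f(x) = 0} ⊆ (ℂ∖0)ⁿ × ℂ^A`. -/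
def incidence {n : ℕ} (A : Fin n → Finset (Fin n → ℤ)) : Set (Torus n × Coeff A) :=
  {p | IsRoot A p.2 p.1}

/-- The projection `π : E → ℂ^A`. -/
def proj {n : ℕ} (A : Fin n → Finset (Fin n → ℤ)) : incidence A → Coeff A :=
  fun p => p.1.2

/-- The set of roots of the system `c`. -/
def RootSet {n : ℕ} (A : Fin n → Finset (Fin n → ℤ)) (c : Coeff A) :=
  {x : Torus n // IsRoot A c x}

/-- `γ` is a loop in `ℂ^A ∖ B` based at `f`. -/
def IsLoop {n : ℕ} (A : Fin n → Finset (Fin n → ℤ)) (B : Set (Coeff A)) (f : Coeff A)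
    (γ : unitInterval → Coeff A) : Prop :=
  Continuous γ ∧ (∀ t, γ t ∉ B) ∧ γ 0 = f ∧ γ 1 = f

/-- The loop `γ` based at `f` induces the permutation `σ` of the root set of `f` by path
lifting: for every root `x` the lift of `γ` starting at `x` ends at `σ x`. -/
def Induces {n : ℕ} (A : Fin n → Finset (Fin n → ℤ)) (γ : unitInterval → Coeff A)
    (f : Coeff A) (σ : RootSet A f → RootSet A f) : Prop :=
  ∀ x : RootSet A f, ∃ δ : unitInterval → Torus n,
    Continuous δ ∧ δ 0 = x.1 ∧ (∀ t, IsRoot A (γ t) (δ t)) ∧ δ 1 = (σ x).1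

end Esterov

open scoped Matrix
set_option linter.all false
namespace Esterov

section PhiAlg
variable {ι : Type*} [Fintype ι] [DecidableEq ι]

/-- The multilinear form with coefficients `c`, on a list of vectors. -/
noncomputable def Phi : (List ι → ℝ) → List (ι → ℝ) → ℝ
  | c, [] => c []
  | c, (x :: L) => ∑ u, x u * Phi (fun l => c (u :: l)) L

/-- Unit vector. -/
def ev (u : ι) : ι → ℝ := Pi.single u 1

lemma Phi_nil (c : List ι → ℝ) : Phi c [] = c [] := rfl
lemma Phi_cons (c : List ι → ℝ) (x : ι → ℝ) (L) :
    Phi c (x :: L) = ∑ u, x u * Phi (fun l => c (u :: l)) L := rfl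

lemma Phi_congr_len {c c' : List ι → ℝ} (L : List (ι → ℝ))
    (h : ∀ l, l.length = L.length → c l = c' l) : Phi c L = Phi c' L := by
  induction L generalizing c c' with
  | nil => exact h [] rfl
  | cons x L ih =>
    simp only [Phi_cons]
    refine Finset.sum_congr rfl fun u _ => ?_
    rw [ih]
    intro l hl
    exact h _ (by simp [hl])

lemma Phi_zero_coef (L : List (ι → ℝ)) : Phi (fun _ => (0:ℝ)) L = 0 := by
  induction L with
  | nil => rfl
  | cons x L ih => simp [Phi_cons, ih]

lemma Phi_add_coef (c c' : List ι → ℝ) (L : List (ι → ℝ)) :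
    Phi (fun l => c l + c' l) L = Phi c L + Phi c' L := by
  induction L generalizing c c' with
  | nil => rfl
  | cons x L ih => simp [Phi_cons, ih, mul_add, Finset.sum_add_distrib]

lemma Phi_smul_coef (a : ℝ) (c : List ι → ℝ) (L : List (ι → ℝ)) :
    Phi (fun l => a * c l) L = a * Phi c L := by
  induction L generalizing c with
  | nil => rfl
  | cons x L ih =>
    simp only [Phi_cons, ih, Finset.mul_sum]
    refine Finset.sum_congr rfl fun u _ => by ring

lemma Phi_sum_coef {κ : Type*} (s : Finset κ) (c : κ → List ι → ℝ) (L : List (ι → ℝ)) :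
    Phi (fun l => ∑ k ∈ s, c k l) L = ∑ k ∈ s, Phi (c k) L := by
  classical
  induction s using Finset.induction_on with
  | empty => simpa using Phi_zero_coef L
  | insert a s ha ih =>
    simp only [Finset.sum_insert ha, Phi_add_coef, ih]

lemma Phi_add (c : List ι → ℝ) (x y : ι → ℝ) (L) :
    Phi c ((x + y) :: L) = Phi c (x :: L) + Phi c (y :: L) := by
  simp [Phi_cons, add_mul, Finset.sum_add_distrib]

lemma Phi_smul (c : List ι → ℝ) (a : ℝ) (x : ι → ℝ) (L) :
    Phi c ((a • x) :: L) = a * Phi c (x :: L) := by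
  simp [Phi_cons, mul_assoc, Finset.mul_sum]

lemma Phi_zero (c : List ι → ℝ) (L) : Phi c ((0 : ι → ℝ) :: L) = 0 := by
  simp [Phi_cons]

lemma Phi_neg (c : List ι → ℝ) (x : ι → ℝ) (L) : Phi c ((-x) :: L) = - Phi c (x :: L) := by
  simp [Phi_cons]

lemma Phi_sub (c : List ι → ℝ) (x y : ι → ℝ) (L) :
    Phi c ((x - y) :: L) = Phi c (x :: L) - Phi c (y :: L) := by
  rw [sub_eq_add_neg, Phi_add, Phi_neg, sub_eq_add_neg]

lemma Phi_ev (c : List ι → ℝ) (u : ι) (L) :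
    Phi c (ev u :: L) = Phi (fun l => c (u :: l)) L := by
  rw [Phi_cons, Finset.sum_eq_single u]
  · simp [ev]
  · intro b _ hb; simp [ev, hb]
  · simp

lemma Phi_cons_ev (c : List ι → ℝ) (x : ι → ℝ) (L) :
    Phi c (x :: L) = ∑ u, x u * Phi c (ev u :: L) := by
  simp only [Phi_ev]; rfl

/-- perm invariance -/
def PermInv (c : List ι → ℝ) : Prop := ∀ l l', l.Perm l' → c l = c l'

lemma PermInv.cons {c : List ι → ℝ} (hc : PermInv c) (u : ι) : PermInv (fun l => c (u :: l)) :=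
  fun _ _ h => hc _ _ (h.cons u)

lemma Phi_perm {L L' : List (ι → ℝ)} (h : L.Perm L') {c : List ι → ℝ} (hc : PermInv c) :
    Phi c L = Phi c L' := by
  induction h generalizing c with
  | nil => rfl
  | cons x _ ih =>
    simp only [Phi_cons]
    exact Finset.sum_congr rfl fun u _ => by rw [ih (hc.cons u)]
  | swap x y l =>
    simp only [Phi_cons, Finset.mul_sum]
    rw [Finset.sum_comm]
    refine Finset.sum_congr rfl fun u _ => Finset.sum_congr rfl fun w _ => ?_
    have : (fun l => c (w :: u :: l)) = fun l => c (u :: w :: l) := by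
      funext l; exact hc _ _ (List.Perm.swap _ _ _)
    rw [this]; ring
  | trans _ _ ih1 ih2 => rw [ih1 hc, ih2 hc]

lemma Phi_swap {c : List ι → ℝ} (hc : PermInv c) (x y : ι → ℝ) (L) :
    Phi c (x :: y :: L) = Phi c (y :: x :: L) := Phi_perm (List.Perm.swap _ _ _) hc

lemma Phi_middle {c : List ι → ℝ} (hc : PermInv c) (x : ι → ℝ) (L L') :
    Phi c (L ++ x :: L') = Phi c (x :: (L ++ L')) := Phi_perm List.perm_middle hc

/-- Continuity of `Phi` in a family of lists. -/
lemma Phi_continuous {X : Type*} [TopologicalSpace X] (c : List ι → ℝ) {κ : Type*}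
    (K : List κ) (f : κ → X → (ι → ℝ)) (hf : ∀ k ∈ K, Continuous (f k)) :
    Continuous (fun t => Phi c (K.map (fun k => f k t))) := by
  induction K generalizing c with
  | nil => simp only [List.map_nil, Phi_nil]; fun_prop
  | cons k K ih =>
    simp only [List.map_cons, Phi_cons]
    refine continuous_finsetSum _ fun u _ => Continuous.mul ?_ ?_
    · exact (continuous_apply u).comp (hf k (by simp))
    · exact ih _ (fun k hk => hf k (by simp [hk]))

lemma Phi_map_smul (c : List ι → ℝ) (a : ℝ) (L : List (ι → ℝ)) :
    Phi c (L.map (fun x => a • x)) = a ^ L.length * Phi c L := by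
  induction L generalizing c with
  | nil => simp
  | cons x L ih =>
    simp only [List.map_cons, Phi_smul, List.length_cons]
    simp only [Phi_cons, ih, Finset.mul_sum]
    refine Finset.sum_congr rfl fun u _ => by ring

/-- iterated differences -/
def dd (F : (ι → ℝ) → ℝ) : List (ι → ℝ) → (ι → ℝ) → ℝ
  | [], h => F h
  | (x :: L), h => dd F L (h + x) - dd F L h

lemma dd_nil (F : (ι → ℝ) → ℝ) (h) : dd F [] h = F h := rfl
lemma dd_cons (F : (ι → ℝ) → ℝ) (x L h) : dd F (x :: L) h = dd F L (h + x) - dd F L h := rfl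

lemma dd_perm (F : (ι → ℝ) → ℝ) {L L' : List (ι → ℝ)} (hp : L.Perm L') (h : ι → ℝ) :
    dd F L h = dd F L' h := by
  induction hp generalizing h with
  | nil => rfl
  | cons x _ ih => simp only [dd_cons, ih]
  | swap x y l => simp only [dd_cons]; rw [add_right_comm h y x]; ring
  | trans _ _ ih1 ih2 => rw [ih1, ih2]

lemma dd_add_fun (F G : (ι → ℝ) → ℝ) (L h) : dd (fun k => F k + G k) L h = dd F L h + dd G L h := by
  induction L generalizing h with
  | nil => rfl
  | cons x L ih => simp only [dd_cons, ih]; ring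

lemma dd_smul_fun (a : ℝ) (F : (ι → ℝ) → ℝ) (L h) : dd (fun k => a * F k) L h = a * dd F L h := by
  induction L generalizing h with
  | nil => rfl
  | cons x L ih => simp only [dd_cons, ih]; ring

lemma dd_sum_fun {κ : Type*} (s : Finset κ) (F : κ → (ι → ℝ) → ℝ) (L h) :
    dd (fun k => ∑ j ∈ s, F j k) L h = ∑ j ∈ s, dd (F j) L h := by
  induction L generalizing h with
  | nil => rfl
  | cons x L ih => simp only [dd_cons, ih, Finset.sum_sub_distrib]

lemma dd_snoc (F : (ι → ℝ) → ℝ) (L x h) :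
    dd F (L ++ [x]) h = dd (fun k => F (k + x) - F k) L h := by
  induction L generalizing h with
  | nil => rfl
  | cons y L ih => simp only [List.cons_append, dd_cons, ih]

/-- link with inclusion-exclusion -/
lemma dd_eq_sum {κ : Type*} [DecidableEq κ] (F : (ι → ℝ) → ℝ) (x : κ → ι → ℝ) (l : List κ)
    (hl : l.Nodup) (h : ι → ℝ) :
    dd F (l.map x) h =
      ∑ S ∈ l.toFinset.powerset, (-1 : ℝ) ^ (l.length - S.card) * F (h + ∑ i ∈ S, x i) := by
  induction l generalizing h with
  | nil => simp [dd_nil]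
  | cons a l ih =>
    rw [List.nodup_cons] at hl
    have ha : a ∉ l.toFinset := by simpa using hl.1
    simp only [List.map_cons, dd_cons, ih hl.2, List.toFinset_cons]
    rw [Finset.sum_powerset_insert ha]
    rw [sub_eq_add_neg, add_comm, ← Finset.sum_neg_distrib]
    congr 1
    · refine Finset.sum_congr rfl fun S hS => ?_
      have : S.card ≤ l.length :=
        (Finset.card_le_card (Finset.mem_powerset.1 hS)).trans l.toFinset_card_le
      rw [List.length_cons, Nat.succ_sub this, pow_succ]; ring
    · refine Finset.sum_congr rfl fun S hS => ?_
      have : a ∉ S := fun h => ha (Finset.mem_powerset.1 hS h)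
      rw [Finset.card_insert_of_notMem this, Finset.sum_insert this, List.length_cons,
        Nat.add_sub_add_right, add_assoc]

/-- binomial expansion of `Phi` on powers plus difference -/
lemma Phi_pow_add {c : List ι → ℝ} (hc : PermInv c) (h x : ι → ℝ) (j : ℕ) (L) :
    ∀ M, Phi c (List.replicate j (h + x) ++ M ++ L)
      = ∑ k ∈ Finset.range (j + 1), (j.choose k : ℝ) *
        Phi c (List.replicate k h ++ List.replicate (j - k) x ++ M ++ L) := by
  induction j with
  | zero => intro M; simp
  | succ j ih =>
    intro M
    have e1 : Phi c (List.replicate (j+1) (h + x) ++ M ++ L) =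
        Phi c (List.replicate j (h + x) ++ (h :: M) ++ L) +
        Phi c (List.replicate j (h + x) ++ (x :: M) ++ L) := by
      have t : ∀ z : ι → ℝ, Phi c (List.replicate j (h + x) ++ (z :: M) ++ L)
          = Phi c (z :: (List.replicate j (h + x) ++ M ++ L)) := by
        intro z
        rw [List.append_assoc, List.cons_append, Phi_middle hc, List.append_assoc]
      rw [t, t, ← Phi_add]; simp [List.replicate_succ]
    rw [e1, ih, ih]
    have a1 : ∀ k, Phi c (List.replicate k h ++ List.replicate (j - k) x ++ (h :: M) ++ L)
        = Phi c (List.replicate (k+1) h ++ List.replicate (j + 1 - (k + 1)) x ++ M ++ L) := by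
      intro k
      refine Phi_perm ?_ hc
      rw [Nat.add_sub_add_right, List.replicate_succ]
      simp only [List.append_assoc, List.cons_append]
      rw [← List.append_assoc, ← List.append_assoc (List.replicate k h)]
      exact List.perm_middle
    have a2 : ∀ k ∈ Finset.range (j+1), (j.choose k : ℝ) *
        Phi c (List.replicate k h ++ List.replicate (j - k) x ++ (x :: M) ++ L)
        = (j.choose k : ℝ) *
          Phi c (List.replicate k h ++ List.replicate (j + 1 - k) x ++ M ++ L) := by
      intro k hk
      congr 1
      refine Phi_perm ?_ hc
      rw [Finset.mem_range] at hk
      rw [show j + 1 - k = (j - k) + 1 by omega, List.replicate_succ]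
      simp only [List.append_assoc, List.cons_append]
      exact (List.perm_middle).append_left _
    simp only [a1]
    rw [Finset.sum_congr rfl a2]
    rw [Finset.sum_range_succ' (fun k => ((j+1).choose k : ℝ) * _) (j+1)]
    rw [Finset.sum_range_succ' (fun k => (j.choose k : ℝ) *
      Phi c (List.replicate k h ++ List.replicate (j + 1 - k) x ++ M ++ L)) j]
    simp only [Nat.choose_succ_succ, Nat.cast_add, add_mul, Finset.sum_add_distrib]
    rw [Finset.sum_range_succ (fun k => (j.choose (k+1) : ℝ) * _) j]
    simp
    ring

lemma dd_Phi_pow {c : List ι → ℝ} (hc : PermInv c) (xs : List (ι → ℝ)) :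
    ∀ (j : ℕ) (L : List (ι → ℝ)) (h : ι → ℝ), j ≤ xs.length →
    dd (fun h => Phi c (List.replicate j h ++ L)) xs h
      = if j = xs.length then (j.factorial : ℝ) * Phi c (xs ++ L) else 0 := by
  induction xs using List.reverseRecOn with
  | nil =>
    intro j L h hj
    have : j = 0 := by simpa using hj
    subst this; simp [dd_nil]
  | append_singleton xs x ih =>
    intro j L h hj
    rw [dd_snoc]
    have e : (fun k => Phi c (List.replicate j (k + x) ++ L) - Phi c (List.replicate j k ++ L))
        = fun k => ∑ i ∈ Finset.range j, (j.choose i : ℝ) *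
          Phi c (List.replicate i k ++ (List.replicate (j - i) x ++ L)) := by
      funext k
      have := Phi_pow_add hc k x j L []
      simp only [List.append_nil] at this
      rw [this, Finset.sum_range_succ]
      simp
    rw [e, dd_sum_fun]
    simp only [dd_smul_fun]
    simp only [List.length_append, List.length_singleton] at hj ⊢
    have key : ∀ i ∈ Finset.range j, (j.choose i : ℝ) * dd (fun k => Phi c (List.replicate i k ++
        (List.replicate (j - i) x ++ L))) xs h
        = if i = xs.length then (j.choose i : ℝ) *
          ((i.factorial : ℝ) * Phi c (xs ++ (List.replicate (j - i) x ++ L))) else 0 := by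
      intro i hi
      rw [Finset.mem_range] at hi
      rw [ih i _ h (by omega)]
      split_ifs <;> simp
    rw [Finset.sum_congr rfl key]
    split_ifs with hjj
    · subst hjj
      rw [Finset.sum_eq_single xs.length]
      · simp [Nat.factorial_succ, mul_assoc]
      · intro b _ hb; simp [hb]
      · simp
    · refine Finset.sum_eq_zero fun i hi => ?_
      rw [Finset.mem_range] at hi
      rw [if_neg (by omega)]

end PhiAlg
end Esterov

open scoped Matrix
set_option linter.all false
namespace Esterov

/-- Simplicial fan data. -/
structure Fan (N : ℕ) (ι : Type) [Fintype ι] [DecidableEq ι] where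
  vec : ι → Fin N → ℝ
  B : Finset (Finset ι)
  v : Finset ι → (ι → ℝ) →ₗ[ℝ] (Fin N → ℝ)
  card_eq : ∀ I ∈ B, I.card = N
  hv : ∀ I ∈ B, ∀ i ∈ I, ∀ h, vec i ⬝ᵥ v I h = h i
  uniq : ∀ I ∈ B, ∀ x, (∀ i ∈ I, vec i ⬝ᵥ x = 0) → x = 0
  h0 : ι → ℝ
  hh0 : ∀ I ∈ B, ∀ j, j ∉ I → vec j ⬝ᵥ v I h0 < h0 j
  cover : ∀ ξ : Fin N → ℝ, ∃ I ∈ B, ∀ i ∈ I, 0 ≤ ξ ⬝ᵥ v I (ev i)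

namespace Fan
variable {N : ℕ} {ι : Type} [Fintype ι] [DecidableEq ι] (Φ : Fan N ι)

/-- open chamber -/
def T : Set (ι → ℝ) := {h | ∀ I ∈ Φ.B, ∀ j, j ∉ I → Φ.vec j ⬝ᵥ Φ.v I h < h j}
/-- closed chamber -/
def Tb : Set (ι → ℝ) := {h | ∀ I ∈ Φ.B, ∀ j, Φ.vec j ⬝ᵥ Φ.v I h ≤ h j}
/-- linear functions -/
def ell (x : Fin N → ℝ) : ι → ℝ := fun u => Φ.vec u ⬝ᵥ x
/-- coefficient of `ξ` -/
def co (I : Finset ι) (ξ : Fin N → ℝ) (i : ι) : ℝ := ξ ⬝ᵥ Φ.v I (ev i)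
/-- gap -/
def gap (h : ι → ℝ) (I : Finset ι) (j : ι) : ℝ := h j - Φ.vec j ⬝ᵥ Φ.v I h
/-- faces -/
def Face (τ : Finset ι) : Prop := ∃ I ∈ Φ.B, τ ⊆ I

variable {Φ}

lemma h0T : Φ.h0 ∈ Φ.T := Φ.hh0

lemma T_sub_Tb {h : ι → ℝ} (hh : h ∈ Φ.T) : h ∈ Φ.Tb := by
  intro I hI j
  by_cases hj : j ∈ I
  · exact (Φ.hv I hI j hj h).le
  · exact (hh I hI j hj).le

lemma gap_zero {I : Finset ι} (hI : I ∈ Φ.B) {i : ι} (hi : i ∈ I) (h : ι → ℝ) :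
    Φ.gap h I i = 0 := by
  simp [gap, Φ.hv I hI i hi]

lemma gap_nonneg {h : ι → ℝ} (hh : h ∈ Φ.Tb) {I : Finset ι} (hI : I ∈ Φ.B) (j : ι) :
    0 ≤ Φ.gap h I j := sub_nonneg.2 (hh I hI j)

lemma gap_pos {h : ι → ℝ} (hh : h ∈ Φ.T) {I : Finset ι} (hI : I ∈ Φ.B) {j : ι} (hj : j ∉ I) :
    0 < Φ.gap h I j := sub_pos.2 (hh I hI j hj)

lemma gap_add (h k : ι → ℝ) (I j) : Φ.gap (h + k) I j = Φ.gap h I j + Φ.gap k I j := by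
  simp [gap, map_add, dotProduct_add]; ring

lemma gap_smul (a : ℝ) (h : ι → ℝ) (I j) : Φ.gap (a • h) I j = a * Φ.gap h I j := by
  simp [gap, map_smul, dotProduct_smul]; ring

lemma mem_T_iff {h : ι → ℝ} : h ∈ Φ.T ↔ ∀ I ∈ Φ.B, ∀ j, j ∉ I → 0 < Φ.gap h I j := by
  simp [T, gap]

lemma mem_Tb_iff {h : ι → ℝ} : h ∈ Φ.Tb ↔ ∀ I ∈ Φ.B, ∀ j, 0 ≤ Φ.gap h I j := by
  simp [Tb, gap]

lemma Tb_add_T {h k : ι → ℝ} (hh : h ∈ Φ.Tb) (hk : k ∈ Φ.T) : h + k ∈ Φ.T := by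
  rw [mem_T_iff]; intro I hI j hj
  rw [gap_add]
  have := gap_nonneg hh hI j
  have := gap_pos hk hI hj
  linarith

lemma T_smul {h : ι → ℝ} (hh : h ∈ Φ.T) {a : ℝ} (ha : 0 < a) : a • h ∈ Φ.T := by
  rw [mem_T_iff]; intro I hI j hj
  rw [gap_smul]
  exact mul_pos ha (gap_pos hh hI hj)

lemma Tb_add {h k : ι → ℝ} (hh : h ∈ Φ.Tb) (hk : k ∈ Φ.Tb) : h + k ∈ Φ.Tb := by
  rw [mem_Tb_iff]; intro I hI j
  rw [gap_add]
  exact add_nonneg (gap_nonneg hh hI j) (gap_nonneg hk hI j)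

lemma Tb_zero : (0 : ι → ℝ) ∈ Φ.Tb := by
  rw [mem_Tb_iff]; intro I hI j; simp [gap]

lemma Tb_sum {κ : Type*} (s : Finset κ) (f : κ → ι → ℝ) (hf : ∀ k ∈ s, f k ∈ Φ.Tb) :
    ∑ k ∈ s, f k ∈ Φ.Tb := by
  classical
  induction s using Finset.induction_on with
  | empty => simpa using Tb_zero
  | insert a s ha ih =>
    rw [Finset.sum_insert ha]
    exact Tb_add (hf a (by simp)) (ih fun k hk => hf k (by simp [hk]))

lemma uniq' {I : Finset ι} (hI : I ∈ Φ.B) {x y : Fin N → ℝ}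
    (h : ∀ i ∈ I, Φ.vec i ⬝ᵥ x = Φ.vec i ⬝ᵥ y) : x = y := by
  rw [← sub_eq_zero]
  apply Φ.uniq I hI
  intro i hi
  rw [dotProduct_sub, h i hi, sub_self]

lemma v_ell {I : Finset ι} (hI : I ∈ Φ.B) (x : Fin N → ℝ) : Φ.v I (Φ.ell x) = x :=
  uniq' hI fun i hi => by rw [Φ.hv I hI i hi]; rfl

lemma gap_ell {I : Finset ι} (hI : I ∈ Φ.B) (x : Fin N → ℝ) (j) : Φ.gap (Φ.ell x) I j = 0 := by
  rw [gap, v_ell hI]; simp [ell]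

lemma ell_Tb (x : Fin N → ℝ) : Φ.ell x ∈ Φ.Tb := by
  rw [mem_Tb_iff]; intro I hI j; rw [gap_ell hI]

lemma x_expand {I : Finset ι} (hI : I ∈ Φ.B) (x : Fin N → ℝ) :
    x = ∑ i ∈ I, (Φ.vec i ⬝ᵥ x) • Φ.v I (ev i) := by
  apply uniq' hI
  intro i hi
  rw [dotProduct_sum, Finset.sum_eq_single i]
  · rw [dotProduct_smul, Φ.hv I hI i hi]; simp [ev]
  · intro j hj hji
    rw [dotProduct_smul, Φ.hv I hI i hi]; simp [ev, hji.symm]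
  · intro h; exact absurd hi h

lemma dot_expand {I : Finset ι} (hI : I ∈ Φ.B) (ξ x : Fin N → ℝ) :
    ξ ⬝ᵥ x = ∑ i ∈ I, Φ.co I ξ i * (Φ.vec i ⬝ᵥ x) := by
  conv_lhs => rw [x_expand hI x]
  rw [dotProduct_sum]
  refine Finset.sum_congr rfl fun i _ => ?_
  rw [dotProduct_smul, co, smul_eq_mul, mul_comm]

lemma expand {I : Finset ι} (hI : I ∈ Φ.B) (ξ : Fin N → ℝ) :
    ξ = ∑ i ∈ I, Φ.co I ξ i • Φ.vec i := by
  rw [← sub_eq_zero, ← dotProduct_eq_zero_iff]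
  intro x
  rw [sub_dotProduct, dot_expand hI ξ x, sum_dotProduct]
  simp [smul_dotProduct]

lemma co_vec {I : Finset ι} (hI : I ∈ Φ.B) {i j : ι} (hi : i ∈ I) :
    Φ.co I (Φ.vec i) j = if i = j then 1 else 0 := by
  rw [co, Φ.hv I hI i hi]; simp [ev, Pi.single_apply]

lemma co_add (I : Finset ι) (ξ η : Fin N → ℝ) (i) : Φ.co I (ξ + η) i = Φ.co I ξ i + Φ.co I η i := by
  simp [co, add_dotProduct]
lemma co_smul (I : Finset ι) (a : ℝ) (η : Fin N → ℝ) (i) : Φ.co I (a • η) i = a * Φ.co I η i := by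
  simp [co, smul_dotProduct]
lemma co_neg (I : Finset ι) (η : Fin N → ℝ) (i) : Φ.co I (-η) i = - Φ.co I η i := by
  simp [co]
lemma co_sum {κ : Type*} (s : Finset κ) (I : Finset ι) (η : κ → Fin N → ℝ) (i) :
    Φ.co I (∑ k ∈ s, η k) i = ∑ k ∈ s, Φ.co I (η k) i := by
  simp [co, sum_dotProduct]

/-- comparison identity -/
lemma comp_id {I I' : Finset ι} (hI : I ∈ Φ.B) (hI' : I' ∈ Φ.B) (ξ : Fin N → ℝ) (h : ι → ℝ) :
    ξ ⬝ᵥ Φ.v I h - ξ ⬝ᵥ Φ.v I' h = ∑ i ∈ I, Φ.co I ξ i * Φ.gap h I' i := by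
  rw [dot_expand hI ξ (Φ.v I h), dot_expand hI ξ (Φ.v I' h), ← Finset.sum_sub_distrib]
  refine Finset.sum_congr rfl fun i hi => ?_
  rw [Φ.hv I hI i hi, gap]; ring

lemma exists_B : ∃ I, I ∈ Φ.B := by
  obtain ⟨I, hI, _⟩ := Φ.cover 0
  exact ⟨I, hI⟩

lemma face_empty : Φ.Face ∅ := by
  obtain ⟨I, hI⟩ := exists_B (Φ := Φ)
  exact ⟨I, hI, by simp⟩

lemma Face.mono {τ σ : Finset ι} (h : Φ.Face σ) (hs : τ ⊆ σ) : Φ.Face τ := by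
  obtain ⟨I, hI, h⟩ := h
  exact ⟨I, hI, hs.trans h⟩

/-- cover relative to a face -/
lemma LC {τ : Finset ι} (hτ : Φ.Face τ) (ξ : Fin N → ℝ) :
    ∃ I ∈ Φ.B, τ ⊆ I ∧ ∀ i ∈ I, i ∉ τ → 0 ≤ Φ.co I ξ i := by
  obtain ⟨I0, hI0, hτ0⟩ := hτ
  set q : Finset ι → ι → ℝ := fun I t => |ξ ⬝ᵥ Φ.v I0 Φ.h0 - ξ ⬝ᵥ Φ.v I Φ.h0| / Φ.gap Φ.h0 I t with hq
  have hq0 : ∀ I ∈ Φ.B, ∀ t, 0 ≤ q I t := fun I hI t =>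
    div_nonneg (abs_nonneg _) (gap_nonneg (T_sub_Tb h0T) hI t)
  set n : ℝ := 1 + ∑ I ∈ Φ.B, ∑ t, q I t with hn
  have hn1 : ∀ I ∈ Φ.B, ∀ t, q I t < n := by
    intro I hI t
    have h1 : q I t ≤ ∑ t, q I t := Finset.single_le_sum (fun t _ => hq0 I hI t) (Finset.mem_univ t)
    have h2 : ∑ t, q I t ≤ ∑ I ∈ Φ.B, ∑ t, q I t :=
      Finset.single_le_sum (f := fun I => ∑ t, q I t) (fun I hI => Finset.sum_nonneg fun t _ => hq0 I hI t) hI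
    rw [hn]; linarith
  have hn0 : 0 ≤ n := by
    rw [hn]
    have := Finset.sum_nonneg fun I hI => Finset.sum_nonneg fun t (_ : t ∈ Finset.univ) => hq0 I hI t
    linarith
  obtain ⟨I, hI, hpos⟩ := Φ.cover (ξ + n • ∑ t ∈ τ, Φ.vec t)
  change ∀ i ∈ I, 0 ≤ Φ.co I _ i at hpos
  have hτI : τ ⊆ I := by
    intro t ht
    by_contra htI
    have h1 : 0 ≤ (ξ + n • ∑ t ∈ τ, Φ.vec t) ⬝ᵥ Φ.v I Φ.h0 - (ξ + n • ∑ t ∈ τ, Φ.vec t) ⬝ᵥ Φ.v I0 Φ.h0 := by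
      rw [comp_id hI hI0]
      exact Finset.sum_nonneg fun i hi => mul_nonneg (hpos i hi) (gap_nonneg (T_sub_Tb h0T) hI0 i)
    have h2 : n * Φ.gap Φ.h0 I t ≤ n * ∑ t ∈ τ, Φ.gap Φ.h0 I t :=
      mul_le_mul_of_nonneg_left (Finset.single_le_sum (f := fun t => Φ.gap Φ.h0 I t)
        (fun t _ => gap_nonneg (T_sub_Tb h0T) hI t) ht) hn0
    have h3 : ∑ t ∈ τ, Φ.gap Φ.h0 I t = (∑ t ∈ τ, Φ.vec t) ⬝ᵥ Φ.v I0 Φ.h0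
        - (∑ t ∈ τ, Φ.vec t) ⬝ᵥ Φ.v I Φ.h0 := by
      rw [sum_dotProduct, sum_dotProduct, ← Finset.sum_sub_distrib]
      refine Finset.sum_congr rfl fun i hi => ?_
      rw [gap, Φ.hv I0 hI0 i (hτ0 hi)]
    have h4 := hn1 I hI t
    have h5 := gap_pos h0T hI htI
    rw [hq, div_lt_iff₀ h5] at h4
    have h6 := neg_abs_le (ξ ⬝ᵥ Φ.v I0 Φ.h0 - ξ ⬝ᵥ Φ.v I Φ.h0)
    simp only [add_dotProduct, smul_dotProduct, smul_eq_mul] at h1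
    rw [h3] at h2
    linarith
  refine ⟨I, hI, hτI, fun i hi hit => ?_⟩
  have := hpos i hi
  rw [co_add, co_smul, co_sum, Finset.sum_eq_zero] at this
  · simpa using this
  · intro t ht
    rw [co_vec hI (hτI ht), if_neg]
    rintro rfl; exact hit ht

/-- uniqueness of cone representation -/
lemma P4 {τ I I' : Finset ι} (hI : I ∈ Φ.B) (hI' : I' ∈ Φ.B) (hτ : τ ⊆ I) (hτ' : τ ⊆ I')
    (ξ : Fin N → ℝ) (h1 : ∀ i ∈ I, i ∉ τ → 0 ≤ Φ.co I ξ i)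
    (h2 : ∀ i ∈ I', i ∉ τ → 0 ≤ Φ.co I' ξ i) : ∀ i ∈ I, i ∉ I' → Φ.co I ξ i = 0 := by
  have key : ∀ J J', J ∈ Φ.B → J' ∈ Φ.B → τ ⊆ J' → (∀ i ∈ J, i ∉ τ → 0 ≤ Φ.co J ξ i) →
      ∀ i ∈ J, 0 ≤ Φ.co J ξ i * Φ.gap Φ.h0 J' i := by
    intro J J' hJ hJ' hs hp i hi
    by_cases hit : i ∈ τ
    · rw [gap_zero hJ' (hs hit), mul_zero]
    · exact mul_nonneg (hp i hi hit) (gap_nonneg (T_sub_Tb h0T) hJ' i)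
  have a1 := comp_id hI hI' ξ Φ.h0
  have a2 := comp_id hI' hI ξ Φ.h0
  have b1 := key I I' hI hI' hτ' h1
  have b2 := Finset.sum_nonneg (key I' I hI' hI hτ h2)
  have b3 : ∑ i ∈ I, Φ.co I ξ i * Φ.gap Φ.h0 I' i = 0 :=
    le_antisymm (by linarith) (Finset.sum_nonneg b1)
  rw [Finset.sum_eq_zero_iff_of_nonneg b1] at b3
  intro i hi hi'
  have := b3 i hi
  rcases mul_eq_zero.1 this with h | h
  · exact h
  · exact absurd h (gap_pos h0T hI' hi').ne'

/-- two link rays on the same side modulo `τ` coincide -/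
lemma ray_unique {τ : Finset ι} {u w : ι} (hu : Φ.Face (insert u τ)) (hw : Φ.Face (insert w τ))
    (huτ : u ∉ τ) (hwτ : w ∉ τ) {α : ℝ} (hα : 0 < α) (κ : ι → ℝ)
    (h : Φ.vec w = α • Φ.vec u + ∑ t ∈ τ, κ t • Φ.vec t) : w = u := by
  obtain ⟨I, hI, hs⟩ := hu
  obtain ⟨I', hI', hs'⟩ := hw
  have hsI : τ ⊆ I := (Finset.subset_insert _ _).trans hs
  have hsI' : τ ⊆ I' := (Finset.subset_insert _ _).trans hs'
  have huI : u ∈ I := hs (Finset.mem_insert_self _ _)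
  have hwI : w ∈ I' := hs' (Finset.mem_insert_self _ _)
  have hco : ∀ i, i ∉ τ → Φ.co I (Φ.vec w) i = if u = i then α else 0 := by
    intro i hi
    rw [h, co_add, co_smul, co_vec hI huI, co_sum, Finset.sum_eq_zero]
    · split_ifs <;> simp
    · intro t ht
      rw [co_smul, co_vec hI (hsI ht), if_neg, mul_zero]
      rintro rfl; exact hi ht
  have hco' : ∀ i, i ∉ τ → Φ.co I' (Φ.vec w) i = if w = i then 1 else 0 := by
    intro i _; exact co_vec hI' hwI
  have p1 := P4 hI' hI hsI' hsI (Φ.vec w)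
    (fun i _ hi => by rw [hco' i hi]; split_ifs <;> norm_num)
    (fun i _ hi => by rw [hco i hi]; split_ifs; exacts [hα.le, le_rfl]) w hwI
  have hwI2 : w ∈ I := by
    by_contra hcon
    have := p1 hcon
    rw [hco' w hwτ, if_pos rfl] at this
    norm_num at this
  have q : Φ.co I (Φ.vec w) w = 1 := by rw [co_vec hI hwI2, if_pos rfl]
  rw [hco w hwτ] at q
  by_contra hne
  rw [if_neg (fun h => hne h.symm)] at q
  norm_num at q

/-- every link ray is avoided -/
lemma avoid {τ : Finset ι} (hτ : Φ.Face τ) {u : ι} (huτ : u ∉ τ) :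
    ∃ I ∈ Φ.B, τ ⊆ I ∧ u ∉ I := by
  obtain ⟨I, hI, hs, hp⟩ := LC hτ (-Φ.vec u)
  refine ⟨I, hI, hs, fun hu => ?_⟩
  have := hp u hu huτ
  rw [co_neg, co_vec hI hu, if_pos rfl] at this
  norm_num at this

lemma exists_ext {τ I : Finset ι} (hI : I ∈ Φ.B) (hs : τ ⊆ I) (hc : τ.card < N) :
    ∃ w, w ∉ I ∧ Φ.Face (insert w τ) := by
  have : τ ⊂ I := by
    refine hs.ssubset_of_ne ?_
    rintro rfl
    have := Φ.card_eq _ hI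
    omega
  obtain ⟨u, huI, huτ⟩ := Finset.exists_of_ssubset this
  obtain ⟨I', hI', hs', hu'⟩ := avoid ⟨I, hI, hs⟩ huτ
  have : ¬ I' ⊆ I := by
    intro hsub
    have := Finset.eq_of_subset_of_card_le hsub (by rw [Φ.card_eq _ hI, Φ.card_eq _ hI'])
    rw [this] at hu'; exact hu' huI
  obtain ⟨w, hw, hwI⟩ := Finset.not_subset.1 this
  refine ⟨w, hwI, I', hI', ?_⟩
  exact Finset.insert_subset hw hs'

lemma co_continuous (I : Finset ι) (i : ι) : Continuous (fun ξ => Φ.co I ξ i) := by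
  unfold co; fun_prop

lemma link_conn {τ : Finset ι} (hτ : Φ.Face τ) (hc : τ.card + 2 ≤ N) (C : Set ι)
    {u w : ι} (huτ : u ∉ τ) (hwτ : w ∉ τ) (hu : Φ.Face (insert u τ)) (hw : Φ.Face (insert w τ))
    (huC : u ∈ C) (hwC : w ∉ C) :
    ∃ a b, a ∈ C ∧ b ∉ C ∧ a ∉ τ ∧ b ∉ τ ∧ Φ.Face (insert a (insert b τ)) := by
  classical
  by_contra hcon
  push Not at hcon
  have hno : ∀ I ∈ Φ.B, τ ⊆ I → ∀ a ∈ I, ∀ b ∈ I, a ∉ τ → b ∉ τ → a ∈ C → b ∈ C := by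
    intro I hI hs a ha b hb haτ hbτ haC
    by_contra hbC
    refine hcon a b haC hbC haτ hbτ ⟨I, hI, ?_⟩
    exact Finset.insert_subset ha (Finset.insert_subset hb hs)
  let A : Set ι → Set (Fin N → ℝ) := fun D =>
    ⋃ I ∈ Φ.B.filter (fun I => τ ⊆ I ∧ ∀ i ∈ I, i ∉ τ → i ∈ D),
      ⋂ i ∈ I.filter (· ∉ τ), {ξ | 0 ≤ Φ.co I ξ i}
  have hAmem : ∀ D ξ, ξ ∈ A D ↔ ∃ I ∈ Φ.B, τ ⊆ I ∧ (∀ i ∈ I, i ∉ τ → i ∈ D) ∧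
      ∀ i ∈ I, i ∉ τ → 0 ≤ Φ.co I ξ i := by
    intro D ξ
    simp only [A, Finset.mem_filter, Set.mem_iUnion, Set.mem_iInter, Set.mem_setOf_eq, exists_prop,
      and_imp, and_assoc]
  have hAcl : ∀ D, IsClosed (A D) := by
    intro D
    refine isClosed_biUnion_finset fun I _ => ?_
    refine isClosed_biInter fun i _ => ?_
    exact isClosed_le continuous_const (co_continuous I i)
  let E : Submodule ℝ (Fin N → ℝ) := Submodule.span ℝ (τ.image Φ.vec : Set (Fin N → ℝ))
  have hE : 1 < Module.rank ℝ ((Fin N → ℝ) ⧸ E) := by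
    have h1 : Module.finrank ℝ E ≤ τ.card :=
      (finrank_span_finset_le_card _).trans Finset.card_image_le
    have h2 := Submodule.finrank_quotient_add_finrank E
    rw [Module.finrank_fin_fun] at h2
    have h3 : 2 ≤ Module.finrank ℝ ((Fin N → ℝ) ⧸ E) := by omega
    rw [← Module.finrank_eq_rank]
    exact_mod_cast h3
  have hconn := (isConnected_compl_of_one_lt_codim hE).isPreconnected
  have hcov : ((E : Set (Fin N → ℝ))ᶜ) ⊆ A C ∪ A Cᶜ := by
    intro ξ _
    obtain ⟨I, hI, hs, hp⟩ := LC hτ ξ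
    by_cases hex : ∃ a ∈ I, a ∉ τ ∧ a ∈ C
    · obtain ⟨a, ha, haτ, haC⟩ := hex
      left; rw [hAmem]
      exact ⟨I, hI, hs, fun i hi hiτ => hno I hI hs a ha i hi haτ hiτ haC, hp⟩
    · push Not at hex
      right; rw [hAmem]
      exact ⟨I, hI, hs, fun i hi hiτ => hex i hi hiτ, hp⟩
  have hne : ∀ D : Set ι, (D = C ∨ D = Cᶜ) → ∀ a, a ∉ τ → Φ.Face (insert a τ) → a ∈ D →
      ((E : Set (Fin N → ℝ))ᶜ ∩ A D).Nonempty := by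
    intro D hD a haτ haF haD
    obtain ⟨I, hI, hs⟩ := haF
    have hsI : τ ⊆ I := (Finset.subset_insert _ _).trans hs
    have haI : a ∈ I := hs (Finset.mem_insert_self _ _)
    refine ⟨Φ.vec a, ?_, ?_⟩
    · intro hmem
      have : ∀ ξ ∈ E, Φ.co I ξ a = 0 := by
        intro ξ hξ
        induction hξ using Submodule.span_induction with
        | mem x hx =>
          simp only [Finset.coe_image, Set.mem_image, Finset.mem_coe] at hx
          obtain ⟨t, ht, rfl⟩ := hx
          rw [co_vec hI (hsI ht), if_neg]
          rintro rfl; exact haτ ht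
        | zero => simp [co]
        | add x y _ _ hx hy => rw [co_add, hx, hy, add_zero]
        | smul r x _ hx => rw [co_smul, hx, mul_zero]
      have h2 := this _ hmem
      rw [co_vec hI haI, if_pos rfl] at h2
      norm_num at h2
    · rw [hAmem]
      refine ⟨I, hI, hsI, fun i hi hiτ => ?_, fun i hi hiτ => ?_⟩
      · rcases hD with rfl | rfl
        · exact hno I hI hsI a haI i hi haτ hiτ haD
        · intro hiC
          exact haD (hno I hI hsI i hi a haI hiτ haτ hiC)
      · rw [co_vec hI haI]; split_ifs <;> norm_num
  obtain ⟨ξ, hξE, hξ1, hξ2⟩ := isPreconnected_closed_iff.1 hconn (A C) (A Cᶜ) (hAcl _) (hAcl _) hcov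
    (hne C (Or.inl rfl) u huτ hu huC) (hne Cᶜ (Or.inr rfl) w hwτ hw hwC)
  rw [hAmem] at hξ1 hξ2
  obtain ⟨I, hI, hs, hIC, hp⟩ := hξ1
  obtain ⟨I', hI', hs', hIC', hp'⟩ := hξ2
  have hz := P4 hI hI' hs hs' ξ hp hp'
  apply hξE
  rw [expand hI ξ]
  refine Submodule.sum_mem _ fun i hi => ?_
  by_cases hiτ : i ∈ τ
  · exact Submodule.smul_mem _ _ (Submodule.subset_span (by simpa using ⟨i, hiτ, rfl⟩))
  · rw [hz i hi (fun hi' => hIC' i hi' hiτ (hIC i hi hiτ)), zero_smul]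
    exact Submodule.zero_mem _

end Fan
end Esterov

open scoped Matrix
set_option linter.all false
namespace Esterov

/-- Perron-Frobenius type lemma giving the Lorentzian signature. -/
lemma PF_lemma {κ : Type*} [Fintype κ] [DecidableEq κ] (M : Matrix κ κ ℝ) (hM : M.IsSymm)
    (v d : κ → ℝ) (hv : ∀ u, 0 < v u) (hd : ∀ u, 0 < d u) (hMv : ∀ u, ∑ w, M u w * v w = d u)
    (hoff : ∀ u w, u ≠ w → 0 ≤ M u w)
    (hconn : ∀ C : Set κ, ∀ u w, u ∈ C → w ∉ C → ∃ a b, a ∈ C ∧ b ∉ C ∧ 0 < M a b)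
    (hineq : ∀ x : κ → ℝ, ∑ u, ∑ w, M u w * x u * x w ≤ ∑ u, v u * (∑ w, M u w * x w) ^ 2 / d u)
    (x : κ → ℝ) (hx : ∑ u, x u * d u = 0) : ∑ u, ∑ w, M u w * x u * x w ≤ 0 := by
  have hsym : ∀ u w, M u w = M w u := fun u w => hM.apply w u
  -- upper bound identity
  have hup : ∀ x : κ → ℝ, ∑ u, d u / v u * x u ^ 2 - ∑ u, ∑ w, M u w * x u * x w
      = 1 / 2 * ∑ u, ∑ w, M u w * v u * v w * (x u / v u - x w / v w) ^ 2 := by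
    intro x
    have e1 : ∑ u, ∑ w, M u w * v u * v w * (x u / v u) ^ 2 = ∑ u, d u / v u * x u ^ 2 := by
      refine Finset.sum_congr rfl fun u _ => ?_
      rw [← hMv u, Finset.sum_div, Finset.sum_mul]
      refine Finset.sum_congr rfl fun w _ => ?_
      have := (hv u).ne'
      field_simp
    have e2 : ∑ u, ∑ w, M u w * v u * v w * (x w / v w) ^ 2 = ∑ u, d u / v u * x u ^ 2 := by
      rw [← e1, Finset.sum_comm]
      refine Finset.sum_congr rfl fun u _ => Finset.sum_congr rfl fun w _ => ?_
      rw [hsym w u]; ring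
    have e3 : ∑ u, ∑ w, M u w * v u * v w * (x u / v u * (x w / v w)) =
        ∑ u, ∑ w, M u w * x u * x w := by
      refine Finset.sum_congr rfl fun u _ => Finset.sum_congr rfl fun w _ => ?_
      have := (hv u).ne'
      have := (hv w).ne'
      field_simp
    have e4 : ∑ u, ∑ w, M u w * v u * v w * (x u / v u - x w / v w) ^ 2
        = ∑ u, ∑ w, M u w * v u * v w * (x u / v u) ^ 2
        + ∑ u, ∑ w, M u w * v u * v w * (x w / v w) ^ 2
        - 2 * ∑ u, ∑ w, M u w * v u * v w * (x u / v u * (x w / v w)) := by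
      simp only [Finset.mul_sum, ← Finset.sum_add_distrib, ← Finset.sum_sub_distrib]
      refine Finset.sum_congr rfl fun u _ => Finset.sum_congr rfl fun w _ => ?_
      ring
    rw [e4, e1, e2, e3]; ring
  have hterm : ∀ (x : κ → ℝ) u w, 0 ≤ M u w * v u * v w * (x u / v u - x w / v w) ^ 2 := by
    intro x u w
    by_cases h : u = w
    · subst h; simp
    · exact mul_nonneg (mul_nonneg (mul_nonneg (hoff u w h) (hv u).le) (hv w).le) (sq_nonneg _)
  have hle : ∀ x : κ → ℝ, ∑ u, ∑ w, M u w * x u * x w ≤ ∑ u, d u / v u * x u ^ 2 := by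
    intro x
    have := hup x
    have h2 : 0 ≤ ∑ u, ∑ w, M u w * v u * v w * (x u / v u - x w / v w) ^ 2 :=
      Finset.sum_nonneg fun u _ => Finset.sum_nonneg fun w _ => hterm x u w
    linarith
  have heq : ∀ x : κ → ℝ, ∑ u, ∑ w, M u w * x u * x w = ∑ u, d u / v u * x u ^ 2 →
      ∃ r, ∀ u, x u = r * v u := by
    intro x hxe
    have h1 := hup x
    rw [hxe, sub_self] at h1
    have h2 : ∀ u w, M u w * v u * v w * (x u / v u - x w / v w) ^ 2 = 0 := by
      have h3 : ∑ u, ∑ w, M u w * v u * v w * (x u / v u - x w / v w) ^ 2 = 0 := by linarith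
      rw [Finset.sum_eq_zero_iff_of_nonneg
        (fun u _ => Finset.sum_nonneg fun w _ => hterm x u w)] at h3
      intro u w
      have h4 := h3 u (Finset.mem_univ u)
      rw [Finset.sum_eq_zero_iff_of_nonneg (fun w _ => hterm x u w)] at h4
      exact h4 w (Finset.mem_univ w)
    rcases isEmpty_or_nonempty κ with he | ⟨⟨u0⟩⟩
    · exact ⟨0, fun u => (he.false u).elim⟩
    · refine ⟨x u0 / v u0, fun u => ?_⟩
      by_contra hne
      have hn : x u / v u ≠ x u0 / v u0 := by
        intro h; apply hne
        rw [← h, div_mul_cancel₀ _ (hv u).ne']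
      obtain ⟨a, b, ha, hb, hab⟩ := hconn {w | x w / v w = x u0 / v u0} u0 u rfl hn
      have h5 := h2 a b
      have hpos : 0 < M a b * v a * v b := mul_pos (mul_pos hab (hv a)) (hv b)
      rcases mul_eq_zero.1 h5 with h | h
      · exact hpos.ne' h
      · have h6 := pow_eq_zero_iff (two_ne_zero) |>.1 h
        apply hb
        have ha' : x a / v a = x u0 / v u0 := ha
        change x b / v b = x u0 / v u0
        rw [← ha']; linarith
  -- the symmetrized matrix
  set s : κ → ℝ := fun u => Real.sqrt (v u / d u) with hs
  have hspos : ∀ u, 0 < s u := fun u => Real.sqrt_pos.2 (div_pos (hv u) (hd u))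
  have hs2 : ∀ u, s u ^ 2 = v u / d u := fun u => Real.sq_sqrt (div_pos (hv u) (hd u)).le
  set N : Matrix κ κ ℝ := Matrix.of fun u w => s u * M u w * s w with hN
  have hNH : N.IsHermitian := by
    ext u w
    simp only [Matrix.conjTranspose_apply, hN, Matrix.of_apply, star_trivial]
    rw [hsym w u]; ring
  have hquad : ∀ y : κ → ℝ, y ⬝ᵥ (N *ᵥ y) = ∑ u, ∑ w, M u w * (s u * y u) * (s w * y w) := by
    intro y
    simp only [dotProduct, Matrix.mulVec, Finset.mul_sum, hN, Matrix.of_apply]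
    refine Finset.sum_congr rfl fun u _ => Finset.sum_congr rfl fun w _ => ?_
    ring
  have hsq : ∀ y : κ → ℝ, (N *ᵥ y) ⬝ᵥ (N *ᵥ y) =
      ∑ u, v u * (∑ w, M u w * (s w * y w)) ^ 2 / d u := by
    intro y
    simp only [dotProduct]
    refine Finset.sum_congr rfl fun u _ => ?_
    have : (N *ᵥ y) u = s u * ∑ w, M u w * (s w * y w) := by
      simp only [Matrix.mulVec, dotProduct, Finset.mul_sum, hN, Matrix.of_apply]
      refine Finset.sum_congr rfl fun w _ => ?_
      ring
    rw [this]
    have h2 := hs2 u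
    calc _ = s u ^ 2 * (∑ w, M u w * (s w * y w)) ^ 2 := by ring
      _ = _ := by rw [h2]; ring
  have hyy : ∀ y : κ → ℝ, ∑ u, d u / v u * (s u * y u) ^ 2 = y ⬝ᵥ y := by
    intro y
    simp only [dotProduct]
    refine Finset.sum_congr rfl fun u _ => ?_
    rw [mul_pow, hs2]
    have := (hv u).ne'
    have := (hd u).ne'
    field_simp
  -- spectral decomposition
  let b := hNH.eigenvectorBasis
  have hb : ∀ j, N *ᵥ (b j).ofLp = hNH.eigenvalues j • (b j).ofLp := fun j =>
    hNH.mulVec_eigenvectorBasis j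
  have hbn : ∀ j, (b j).ofLp ⬝ᵥ (b j).ofLp = 1 := by
    intro j
    have h1 := b.orthonormal.1 j
    have h2 : inner ℝ (b j) (b j) = (1:ℝ) := by rw [real_inner_self_eq_norm_sq, h1]; norm_num
    rw [← h2, PiLp.inner_apply]
    simp [dotProduct, sq]
  set y : κ → ℝ := fun u => x u / s u with hy
  have hsy : ∀ u, s u * y u = x u := fun u => mul_div_cancel₀ _ (hspos u).ne'
  have hxe : ∑ u, ∑ w, M u w * x u * x w = y ⬝ᵥ (N *ᵥ y) := by
    rw [hquad]; simp only [hsy]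
  have hin : ∀ (z w : EuclideanSpace ℝ κ), inner ℝ z w = z.ofLp ⬝ᵥ w.ofLp := by
    intro z w
    rw [PiLp.inner_apply]
    simp [dotProduct, mul_comm]
  have hspec : y ⬝ᵥ (N *ᵥ y) = ∑ j, hNH.eigenvalues j * ((b j).ofLp ⬝ᵥ y) ^ 2 := by
    have h1 := b.sum_inner_mul_inner (WithLp.toLp 2 y) (WithLp.toLp 2 (N *ᵥ y))
    rw [hin] at h1
    rw [← h1]
    refine Finset.sum_congr rfl fun j _ => ?_
    rw [hin, hin]
    have h2 : (b j).ofLp ⬝ᵥ (N *ᵥ y) = hNH.eigenvalues j * ((b j).ofLp ⬝ᵥ y) := by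
      rw [Matrix.dotProduct_mulVec, ← Matrix.mulVec_transpose]
      have : Nᵀ = N := by
        have := hNH.eq
        rwa [Matrix.conjTranspose_eq_transpose_of_trivial] at this
      rw [this, hb, smul_dotProduct, smul_eq_mul]
    simp only [h2]
    rw [dotProduct_comm y]; ring
  rw [hxe, hspec]
  refine Finset.sum_nonpos fun j _ => ?_
  by_cases hlam : hNH.eigenvalues j ≤ 0
  · exact mul_nonpos_of_nonpos_of_nonneg hlam (sq_nonneg _)
  push Not at hlam
  have hq1 : (b j).ofLp ⬝ᵥ (N *ᵥ (b j).ofLp) = hNH.eigenvalues j := by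
    rw [hb, dotProduct_smul, hbn]; simp
  have hq2 : (N *ᵥ (b j).ofLp) ⬝ᵥ (N *ᵥ (b j).ofLp) = hNH.eigenvalues j ^ 2 := by
    rw [hb, dotProduct_smul, smul_dotProduct, hbn]; simp [sq]
  have h1 := hineq (fun u => s u * (b j).ofLp u)
  rw [← hquad, ← hsq, hq1, hq2] at h1
  have h2 := hle (fun u => s u * (b j).ofLp u)
  rw [← hquad, hyy, hbn, hq1] at h2
  have h3 : hNH.eigenvalues j = 1 := by nlinarith
  obtain ⟨r, hr⟩ := heq (fun u => s u * (b j).ofLp u) (by rw [← hquad, hyy, hbn, hq1, h3])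
  have h4 : (b j).ofLp ⬝ᵥ y = 0 := by
    have : (b j).ofLp ⬝ᵥ y = r * ∑ u, x u * d u := by
      rw [Finset.mul_sum]
      simp only [dotProduct]
      refine Finset.sum_congr rfl fun u _ => ?_
      have e1 : (b j).ofLp u = r * v u / s u := by
        rw [eq_div_iff (hspos u).ne', mul_comm]; exact hr u
      have e2 := hs2 u
      rw [e1, hy]
      have := (hv u).ne'
      have := (hd u).ne'
      have := (hspos u).ne'
      have e3 : s u ^ 2 * d u = v u := by rw [e2]; field_simp
      field_simp
      rw [← e3]; ring
    rw [this, hx, mul_zero]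
  rw [h4]; simp

end Esterov

open scoped Matrix
set_option linter.all false
namespace Esterov

/-- coefficients of the volume polynomial of a fan -/
structure Coef {N : ℕ} {ι : Type} [Fintype ι] [DecidableEq ι] (Φ : Fan N ι) where
  c : List ι → ℝ
  perm : PermInv c
  len : ∀ l, l.length ≠ N → c l = 0
  face : ∀ l, ¬ Φ.Face l.toFinset → c l = 0
  pos : ∀ l, l.Nodup → l.toFinset ∈ Φ.B → 0 < c l
  ker : ∀ x l, ∑ u, (Φ.vec u ⬝ᵥ x) * c (u :: l) = 0

namespace Coef
open Fan
variable {N : ℕ} {ι : Type} [Fintype ι] [DecidableEq ι] {Φ : Fan N ι} (C : Coef Φ)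

/-- mixed form localized at `τ` -/
noncomputable def Psi (τ : Finset ι) (L : List (ι → ℝ)) : ℝ := Phi C.c (τ.toList.map ev ++ L)

variable {C}

lemma Phi_map_ev (c : List ι → ℝ) (us : List ι) (L : List (ι → ℝ)) :
    Phi c (us.map ev ++ L) = Phi (fun l => c (us ++ l)) L := by
  induction us generalizing c with
  | nil => rfl
  | cons u us ih => simp only [List.map_cons, List.cons_append, Phi_ev, ih]

lemma Psi_eq (τ : Finset ι) (L : List (ι → ℝ)) : C.Psi τ L = Phi (fun l => C.c (τ.toList ++ l)) L :=
  Phi_map_ev _ _ _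

lemma permT (C : Coef Φ) (τ : Finset ι) : PermInv (fun l => C.c (τ.toList ++ l)) :=
  fun _ _ h => C.perm _ _ (h.append_left _)

lemma Psi_empty (L : List (ι → ℝ)) : C.Psi ∅ L = Phi C.c L := by simp [Psi]

lemma Psi_perm {τ : Finset ι} {L L' : List (ι → ℝ)} (h : L.Perm L') : C.Psi τ L = C.Psi τ L' := by
  rw [Psi_eq, Psi_eq]; exact Phi_perm h (C.permT τ)

lemma Psi_add (τ : Finset ι) (x y : ι → ℝ) (L) :
    C.Psi τ ((x + y) :: L) = C.Psi τ (x :: L) + C.Psi τ (y :: L) := by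
  simp only [Psi_eq, Phi_add]
lemma Psi_sub (τ : Finset ι) (x y : ι → ℝ) (L) :
    C.Psi τ ((x - y) :: L) = C.Psi τ (x :: L) - C.Psi τ (y :: L) := by
  simp only [Psi_eq, Phi_sub]
lemma Psi_smul (τ : Finset ι) (a : ℝ) (x : ι → ℝ) (L) :
    C.Psi τ ((a • x) :: L) = a * C.Psi τ (x :: L) := by
  simp only [Psi_eq, Phi_smul]
lemma Psi_zero (τ : Finset ι) (L) : C.Psi τ ((0 : ι → ℝ) :: L) = 0 := by
  simp only [Psi_eq, Phi_zero]
lemma Psi_cons_ev (τ : Finset ι) (x : ι → ℝ) (L) :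
    C.Psi τ (x :: L) = ∑ u, x u * C.Psi τ (ev u :: L) := by
  simp only [Psi_eq]; rw [Phi_cons_ev]
lemma Psi_swap (τ : Finset ι) (x y : ι → ℝ) (L) :
    C.Psi τ (x :: y :: L) = C.Psi τ (y :: x :: L) := Psi_perm (List.Perm.swap _ _ _)

lemma Psi_insert {τ : Finset ι} {u : ι} (hu : u ∉ τ) (L) :
    C.Psi τ (ev u :: L) = C.Psi (insert u τ) L := by
  unfold Psi
  refine Phi_perm ?_ C.perm
  refine List.perm_middle.trans ?_
  have := ((Finset.toList_insert hu).map (ev : ι → ι → ℝ)).append_right L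
  exact this.symm

lemma Psi_nonface {τ : Finset ι} (hτ : ¬ Φ.Face τ) (L) : C.Psi τ L = 0 := by
  rw [Psi_eq]
  have : (fun l => C.c (τ.toList ++ l)) = fun _ => (0:ℝ) := by
    funext l
    refine C.face _ fun hf => hτ (hf.mono ?_)
    intro t ht; simp [ht]
  rw [this, Phi_zero_coef]

lemma Psi_len {τ : Finset ι} {L : List (ι → ℝ)} (h : τ.card + L.length ≠ N) : C.Psi τ L = 0 := by
  rw [Psi_eq, Phi_congr_len (c' := fun _ => (0:ℝ)), Phi_zero_coef]
  intro l hl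
  apply C.len
  simpa [hl] using h

lemma Psi_ker (τ : Finset ι) (x : Fin N → ℝ) (L) : C.Psi τ (Φ.ell x :: L) = 0 := by
  rw [Psi_eq, Phi_cons]
  have : ∀ u, Φ.ell x u * Phi (fun l => C.c (τ.toList ++ u :: l)) L
      = Phi (fun l => Φ.ell x u * C.c (u :: (τ.toList ++ l))) L := by
    intro u
    rw [Phi_smul_coef]
    congr 2
    funext l
    exact C.perm _ _ List.perm_middle
  simp only [this]
  rw [← Phi_sum_coef]
  have : (fun l => ∑ u, Φ.ell x u * C.c (u :: (τ.toList ++ l))) = fun _ => (0:ℝ) := by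
    funext l; exact C.ker x _
  rw [this, Phi_zero_coef]

lemma Psi_top {I : Finset ι} (hI : I ∈ Φ.B) : 0 < C.Psi I [] := by
  rw [Psi_eq, Phi_nil, List.append_nil]
  exact C.pos _ I.nodup_toList (by simpa using hI)

/-- reduction at a face -/
lemma RED (τ : Finset ι) (x : ι → ℝ) (y : Fin N → ℝ) (hy : ∀ t ∈ τ, x t = Φ.vec t ⬝ᵥ y) (L) :
    C.Psi τ (x :: L) = ∑ u ∈ Finset.univ.filter (· ∉ τ), (x u - Φ.vec u ⬝ᵥ y) * C.Psi (insert u τ) L := by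
  have h1 : C.Psi τ (x :: L) = C.Psi τ ((x - Φ.ell y) :: L) := by
    rw [Psi_sub, Psi_ker, sub_zero]
  rw [h1, Psi_cons_ev, Finset.sum_filter]
  refine Finset.sum_congr rfl fun u _ => ?_
  split_ifs with h
  · have : (x - Φ.ell y) u = 0 := by simp [hy u h, ell]
    rw [this, zero_mul]
  · rw [Psi_insert h]; rfl

lemma Psi_nonneg {L : List (ι → ℝ)} (hL : ∀ x ∈ L, x ∈ Φ.Tb) (τ : Finset ι) : 0 ≤ C.Psi τ L := by
  induction L generalizing τ with
  | nil =>
    by_cases hτ : Φ.Face τ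
    · by_cases hc : τ.card = N
      · obtain ⟨I, hI, hs⟩ := hτ
        have := Finset.eq_of_subset_of_card_le hs (by rw [Φ.card_eq I hI, hc])
        rw [this]; exact (Psi_top hI).le
      · rw [Psi_len (by simpa using hc)]
    · rw [Psi_nonface hτ]
  | cons x L ih =>
    by_cases hτ : Φ.Face τ
    · obtain ⟨I, hI, hs⟩ := hτ
      rw [RED τ x (Φ.v I x) (fun t ht => (Φ.hv I hI t (hs ht) x).symm)]
      refine Finset.sum_nonneg fun u _ => mul_nonneg ?_ (ih (fun z hz => hL z (by simp [hz])) _)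
      exact gap_nonneg (hL x (by simp)) hI u
    · rw [Psi_nonface hτ]

lemma Psi_pos {L : List (ι → ℝ)} (hL : ∀ x ∈ L, x ∈ Φ.T) {τ : Finset ι} (hτ : Φ.Face τ)
    (hc : τ.card + L.length = N) : 0 < C.Psi τ L := by
  induction L generalizing τ with
  | nil =>
    obtain ⟨I, hI, hs⟩ := hτ
    have := Finset.eq_of_subset_of_card_le hs (by rw [Φ.card_eq I hI]; simpa using hc.ge)
    rw [this]; exact Psi_top hI
  | cons x L ih =>
    obtain ⟨I, hI, hs⟩ := hτ
    have hL' : ∀ z ∈ L, z ∈ Φ.T := fun z hz => hL z (by simp [hz])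
    rw [RED τ x (Φ.v I x) (fun t ht => (Φ.hv I hI t (hs ht) x).symm)]
    simp only [List.length_cons] at hc
    obtain ⟨w, hw, hwF⟩ := exists_ext hI hs (by omega)
    have hwτ : w ∉ τ := fun h => hw (hs h)
    refine Finset.sum_pos' (fun u _ => mul_nonneg ?_ (Psi_nonneg (fun z hz => T_sub_Tb (hL' z hz)) _)) ⟨w, by simpa using hwτ, ?_⟩
    · exact gap_nonneg (T_sub_Tb (hL x (by simp))) hI u
    · refine mul_pos (gap_pos (hL x (by simp)) hI hw) (ih hL' hwF ?_)
      rw [Finset.card_insert_of_notMem hwτ]; omega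

/-- from a hyperplane on which the form is negative to the reversed Cauchy-Schwarz -/
lemma lorentz_of {τ : Finset ι} {L : List (ι → ℝ)} (lam : (ι → ℝ) →ₗ[ℝ] ℝ)
    (hl : ∀ x, lam x = 0 → C.Psi τ (x :: x :: L) ≤ 0) (v : ι → ℝ) (hv : 0 < C.Psi τ (v :: v :: L))
    (x : ι → ℝ) :
    C.Psi τ (x :: x :: L) * C.Psi τ (v :: v :: L) ≤ C.Psi τ (x :: v :: L) ^ 2 := by
  have hlv : lam v ≠ 0 := fun h => absurd (hl v h) (not_le.2 hv)
  set t := lam x / lam v with ht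
  have h1 := hl (x - t • v) (by simp [ht, hlv])
  have e : C.Psi τ ((x - t • v) :: (x - t • v) :: L) = C.Psi τ (x :: x :: L)
      - 2 * t * C.Psi τ (x :: v :: L) + t ^ 2 * C.Psi τ (v :: v :: L) := by
    have e1 : ∀ z, C.Psi τ (z :: (x - t • v) :: L) = C.Psi τ (z :: x :: L) - t * C.Psi τ (z :: v :: L) := by
      intro z
      rw [Psi_swap, Psi_sub, Psi_smul, Psi_swap, Psi_swap τ v z]
    rw [Psi_sub, Psi_smul, e1, e1, Psi_swap τ v x]; ring
  rw [e] at h1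
  nlinarith [sq_nonneg (C.Psi τ (x :: v :: L) - t * C.Psi τ (v :: v :: L))]

end Coef
end Esterov

open scoped Matrix
set_option linter.all false
namespace Esterov
namespace Coef
open Fan
variable {N : ℕ} {ι : Type} [Fintype ι] [DecidableEq ι] {Φ : Fan N ι} {C : Coef Φ}

lemma co_span {τ J : Finset ι} (hJ : J ∈ Φ.B) (hs : τ ⊆ J) (κ : ι → ℝ) {i : ι} (hi : i ∉ τ) :
    Φ.co J (∑ t ∈ τ, κ t • Φ.vec t) i = 0 := by
  rw [co_sum]
  refine Finset.sum_eq_zero fun t ht => ?_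
  rw [co_smul, co_vec hJ (hs ht), if_neg, mul_zero]
  rintro rfl; exact hi ht

lemma Psi_quad (τ : Finset ι) (z : ι → ℝ) (L) :
    C.Psi τ (z :: z :: L) = ∑ u, ∑ w, C.Psi τ (ev u :: ev w :: L) * z u * z w := by
  rw [Psi_cons_ev]
  refine Finset.sum_congr rfl fun u _ => ?_
  rw [Psi_swap, Psi_cons_ev, Finset.mul_sum]
  refine Finset.sum_congr rfl fun w _ => ?_
  rw [Psi_swap]; ring

lemma Psi_shift (τ : Finset ι) (x : ι → ℝ) (y : Fin N → ℝ) (L) :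
    C.Psi τ ((x - Φ.ell y) :: L) = C.Psi τ (x :: L) := by
  rw [Psi_sub, Psi_ker, sub_zero]

lemma Psi_shift2 (τ : Finset ι) (x : ι → ℝ) (y : Fin N → ℝ) (L) :
    C.Psi τ ((x - Φ.ell y) :: (x - Φ.ell y) :: L) = C.Psi τ (x :: x :: L) := by
  rw [Psi_shift, Psi_swap, Psi_shift]

lemma AF_base {τ : Finset ι} (hτ : Φ.Face τ) (hc : τ.card + 2 = N) :
    ∃ lam : (ι → ℝ) →ₗ[ℝ] ℝ, ∀ x, lam x = 0 → C.Psi τ [x, x] ≤ 0 := by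
  obtain ⟨I0, hI0, hs0⟩ := hτ
  have hcard : (I0 \ τ).card = 2 := by
    rw [Finset.card_sdiff_of_subset hs0, Φ.card_eq I0 hI0]; omega
  obtain ⟨a, b, hab, hIab⟩ := Finset.card_eq_two.1 hcard
  have ha : a ∈ I0 ∧ a ∉ τ := by rw [← Finset.mem_sdiff, hIab]; simp
  have hb : b ∈ I0 ∧ b ∉ τ := by rw [← Finset.mem_sdiff, hIab]; simp
  have hI0eq : ∀ i ∈ I0, i ∉ τ → i = a ∨ i = b := by
    intro i hi hiτ
    have : i ∈ I0 \ τ := Finset.mem_sdiff.2 ⟨hi, hiτ⟩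
    rw [hIab] at this; simpa using this
  obtain ⟨I, hI, hsI, hγ⟩ := LC ⟨I0, hI0, hs0⟩ (-Φ.vec a)
  set γ := Φ.co I (-Φ.vec a) with hγdef
  let lam : (ι → ℝ) →ₗ[ℝ] ℝ :=
    (LinearMap.proj a : (ι → ℝ) →ₗ[ℝ] ℝ) + ∑ m ∈ I, γ m • (LinearMap.proj m : (ι → ℝ) →ₗ[ℝ] ℝ)
  have hlam : ∀ x, lam x = x a + ∑ m ∈ I, γ m * x m := by
    intro x; simp [lam]
  refine ⟨lam, fun x hx => ?_⟩
  set z := x - Φ.ell (Φ.v I0 x) with hz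
  have hlell : ∀ y, lam (Φ.ell y) = 0 := by
    intro y
    rw [hlam]
    have := dot_expand hI (-Φ.vec a) y
    rw [neg_dotProduct] at this
    simp only [ell]
    rw [← hγdef] at this
    linarith
  have hlz : z a + ∑ m ∈ I, γ m * z m = 0 := by
    rw [← hlam, hz, map_sub, hx, hlell, sub_zero]
  have hz0 : ∀ i ∈ I0, z i = 0 := by
    intro i hi
    simp [hz, ell, Φ.hv I0 hI0 i hi]
  have hza := hz0 a ha.1
  rw [hza, zero_add] at hlz
  rw [← Psi_shift2 τ x (Φ.v I0 x), ← hz, Psi_quad]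
  set M : ι → ι → ℝ := fun u w => C.Psi τ [ev u, ev w] with hM
  set η := Φ.ell (Φ.v I0 (ev b)) with hη
  have hηI : ∀ i ∈ I0, η i = if i = b then 1 else 0 := by
    intro i hi
    simp only [hη, ell]
    rw [Φ.hv I0 hI0 i hi]; simp [ev, Pi.single_apply]
  have hητ : ∀ t ∈ τ, η t = 0 := by
    intro t ht
    rw [hηI t (hs0 ht), if_neg]
    rintro rfl; exact hb.2 ht
  have hηa : η a = 0 := by rw [hηI a ha.1, if_neg hab]
  have hker : ∀ u, ∑ w, M u w * η w = 0 := by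
    intro u
    have h1 : C.Psi τ [ev u, η] = 0 := by rw [Psi_swap]; exact Psi_ker _ _ _
    rw [Psi_swap, Psi_cons_ev] at h1
    rw [← h1]
    refine Finset.sum_congr rfl fun w _ => ?_
    rw [Psi_swap, mul_comm]
  have hMsym : ∀ u w, M u w = M w u := fun u w => Psi_swap _ _ _ _
  -- claim 1
  have claim1 : ∀ u, u ∉ τ → Φ.Face (insert u τ) → η u = 0 → z u = 0 := by
    intro u huτ hu hηu
    have hexp : Φ.vec u = Φ.co I0 (Φ.vec u) a • Φ.vec a + ∑ t ∈ τ, Φ.co I0 (Φ.vec u) t • Φ.vec t := by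
      conv_lhs => rw [expand hI0 (Φ.vec u)]
      rw [← Finset.sum_sdiff hs0, hIab, Finset.sum_pair hab]
      have : Φ.co I0 (Φ.vec u) b = 0 := hηu
      rw [this]; simp
    set p := Φ.co I0 (Φ.vec u) a with hp
    obtain ⟨J, hJ, hsJ⟩ := hu
    have hsJτ : τ ⊆ J := (Finset.subset_insert _ _).trans hsJ
    have huJ : u ∈ J := hsJ (Finset.mem_insert_self _ _)
    have hco : ∀ K ∈ Φ.B, τ ⊆ K → ∀ i, i ∉ τ → Φ.co K (Φ.vec u) i = p * Φ.co K (Φ.vec a) i := by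
      intro K hK hsK i hi
      conv_lhs => rw [hexp]
      rw [co_add, co_span hK hsK _ hi, co_smul, add_zero]
    rcases lt_trichotomy p 0 with hp0 | hp0 | hp0
    · have hcoJ : ∀ K ∈ Φ.B, τ ⊆ K → u ∈ K → ∀ i, i ∉ τ →
          Φ.co K (-Φ.vec a) i = if u = i then -(1 / p) else 0 := by
        intro K hK hsK huK i hi
        have h1 := hco K hK hsK i hi
        rw [co_vec hK huK] at h1
        rw [co_neg]
        split_ifs at h1 ⊢
        · have h5 : Φ.co K (Φ.vec a) i = 1 / p := by rw [eq_div_iff hp0.ne]; linarith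
          rw [h5]
        · rcases mul_eq_zero.1 h1.symm with h | h
          · exact absurd h hp0.ne
          · rw [h, neg_zero]
      have hpn : 0 < -(1 / p) := by
        have := div_neg_of_pos_of_neg one_pos hp0
        linarith
      have huI : u ∈ I := by
        by_contra huI
        have h1 := P4 hJ hI hsJτ hsI (-Φ.vec a) (fun i hi hiτ => by
          rw [hcoJ J hJ hsJτ huJ i hiτ]; split_ifs; exacts [hpn.le, le_rfl]) hγ u huJ huI
        rw [hcoJ J hJ hsJτ huJ u huτ, if_pos rfl] at h1
        exact hpn.ne' h1
      rw [Finset.sum_eq_single u] at hlz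
      · rw [hγdef, hcoJ I hI hsI huI u huτ, if_pos rfl] at hlz
        rcases mul_eq_zero.1 hlz with h | h
        · exact absurd h hpn.ne'
        · exact h
      · intro m hm hmu
        by_cases hmτ : m ∈ τ
        · rw [hz0 m (hs0 hmτ), mul_zero]
        · rw [hγdef, hcoJ I hI hsI huI m hmτ, if_neg (Ne.symm hmu), zero_mul]
      · intro h; exact absurd huI h
    · have h1 := hco J hJ hsJτ u huτ
      rw [co_vec hJ huJ, if_pos rfl, hp0, zero_mul] at h1
      norm_num at h1
    · have h1 := ray_unique (Φ := Φ) (τ := τ) (u := a) (w := u)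
        ⟨I0, hI0, Finset.insert_subset ha.1 hs0⟩ ⟨J, hJ, hsJ⟩ ha.2 huτ hp0 _ hexp
      rw [h1]; exact hza
  -- claim 2
  have claim2 : ∀ u w, u ≠ w → u ∉ τ → w ∉ τ → Φ.Face (insert u (insert w τ)) → η u * η w < 0 →
      z u * η w = z w * η u := by
    intro u w huw huτ hwτ hF hneg
    obtain ⟨J, hJ, hsJ⟩ := hF
    have huwτ : u ∉ insert w τ := by simp [huw, huτ]
    have hJeq : insert u (insert w τ) = J := Finset.eq_of_subset_of_card_le hsJ (by
      rw [Φ.card_eq J hJ, Finset.card_insert_of_notMem huwτ, Finset.card_insert_of_notMem hwτ]; omega)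
    have hsJτ : τ ⊆ J := by rw [← hJeq]; intro t ht; simp [ht]
    have huJ : u ∈ J := by rw [← hJeq]; simp
    have hwJ : w ∈ J := by rw [← hJeq]; simp
    have hJmem : ∀ i ∈ J, i ∉ τ → i = u ∨ i = w := by
      intro i hi hiτ
      rw [← hJeq] at hi
      simp only [Finset.mem_insert] at hi; tauto
    have hsumJ : ∀ g : ι → ℝ, (∀ t ∈ τ, g t = 0) → ∑ i ∈ J, g i = g u + g w := by
      intro g hg
      rw [← hJeq, Finset.sum_insert huwτ, Finset.sum_insert hwτ, Finset.sum_eq_zero hg, add_zero]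
    set p := Φ.co J (Φ.vec a) u with hp
    set q := Φ.co J (Φ.vec a) w with hq
    have hpq : p * η u + q * η w = 0 := by
      have h1 := dot_expand hJ (Φ.vec a) (Φ.v I0 (ev b))
      have h2 : Φ.vec a ⬝ᵥ Φ.v I0 (ev b) = 0 := hηa
      rw [h2, hsumJ] at h1
      · exact h1.symm
      · intro t ht
        have : Φ.vec t ⬝ᵥ Φ.v I0 (ev b) = 0 := hητ t ht
        rw [this, mul_zero]
    have hηu : η u ≠ 0 := fun h => by rw [h] at hneg; simp at hneg
    have hηw : η w ≠ 0 := fun h => by rw [h] at hneg; simp at hneg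
    have hp0 : p ≠ 0 := by
      intro h
      have hq0 : q = 0 := by
        rw [h, zero_mul, zero_add] at hpq
        exact (mul_eq_zero.1 hpq).resolve_right hηw
      have hexp : Φ.vec a = ∑ t ∈ τ, Φ.co J (Φ.vec a) t • Φ.vec t := by
        conv_lhs => rw [expand hJ (Φ.vec a)]
        rw [← hJeq, Finset.sum_insert huwτ, Finset.sum_insert hwτ, hJeq, ← hp, ← hq, h, hq0]
        simp
      have h1 : Φ.co I0 (Φ.vec a) a = 0 := by
        rw [hexp]; exact co_span hI0 hs0 _ ha.2
      rw [co_vec hI0 ha.1, if_pos rfl] at h1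
      norm_num at h1
    have hsame : 0 < p * q := by
      have h1 : p * q * (η w * η u) = -(p * η u) ^ 2 := by
        have : q * η w = -(p * η u) := by linarith
        calc p * q * (η w * η u) = (p * η u) * (q * η w) := by ring
          _ = _ := by rw [this]; ring
      have h2 : 0 < (p * η u) ^ 2 := by positivity
      by_contra hcon
      push Not at hcon
      have := mul_nonneg_of_nonpos_of_nonpos hcon (by rw [mul_comm]; exact hneg.le : η w * η u ≤ 0)
      linarith
    rcases lt_or_gt_of_ne hp0 with hpn | hpp
    · have hqn : q < 0 := by
        by_contra h; push Not at h
        have := mul_nonpos_of_nonpos_of_nonneg hpn.le h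
        linarith
      have hP := P4 hJ hI hsJτ hsI (-Φ.vec a) (fun i hi hiτ => by
        rw [co_neg]
        rcases hJmem i hi hiτ with rfl | rfl
        · rw [← hp]; linarith
        · rw [← hq]; linarith) hγ
      have huI : u ∈ I := by
        by_contra h
        have := hP u huJ h
        rw [co_neg, ← hp] at this; linarith
      have hwI : w ∈ I := by
        by_contra h
        have := hP w hwJ h
        rw [co_neg, ← hq] at this; linarith
      have hIJ : J = I := Finset.eq_of_subset_of_card_le (by
        rw [← hJeq]; exact Finset.insert_subset huI (Finset.insert_subset hwI hsI))
        (by rw [Φ.card_eq J hJ, Φ.card_eq I hI])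
      rw [← hIJ, hsumJ] at hlz
      · rw [hγdef, ← hIJ, co_neg, co_neg, ← hp, ← hq] at hlz
        have h3 : p * (z u * η w - z w * η u) = 0 := by
          have e1 : p * z u = - (q * z w) := by linarith
          have e2 : p * η u = - (q * η w) := by linarith
          calc p * (z u * η w - z w * η u) = (p * z u) * η w - z w * (p * η u) := by ring
            _ = 0 := by rw [e1, e2]; ring
        rcases mul_eq_zero.1 h3 with h | h
        · exact absurd h hp0
        · linarith
      · intro t ht; rw [hz0 t (hs0 ht), mul_zero]
    · exfalso
      have hqp : 0 < q := by
        by_contra h; push Not at h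
        have := mul_nonpos_of_nonneg_of_nonpos hpp.le h
        linarith
      have hP := P4 hJ hI0 hsJτ hs0 (Φ.vec a) (fun i hi hiτ => by
        rcases hJmem i hi hiτ with rfl | rfl
        · exact hpp.le
        · exact hqp.le) (fun i hi hiτ => by
          rw [co_vec hI0 ha.1]; split_ifs <;> norm_num)
      have huI : u ∈ I0 := by
        by_contra h
        exact hp0 (hP u huJ h)
      have hwI : w ∈ I0 := by
        by_contra h
        exact hqp.ne' (hP w hwJ h)
      rcases hI0eq u huI huτ with h1 | h1
      · rw [h1] at hηu; exact hηu hηa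
      · rcases hI0eq w hwI hwτ with h2 | h2
        · rw [h2] at hηw; exact hηw hηa
        · exact huw (h1.trans h2.symm)
  -- vanishing of M
  have hMz : ∀ u w, u ∉ τ → ¬ Φ.Face (insert u τ) → M u w = 0 := by
    intro u w hu hF
    simp only [hM]
    rw [Psi_insert hu, Psi_nonface hF]
  set r : ι → ℝ := fun u => z u / η u with hr
  have hzr : ∀ u w, M u w * z u * z w = M u w * η u * η w * (r u * r w) := by
    have hone : ∀ u, (∀ w, M u w = 0) ∨ z u = r u * η u := by
      intro u
      by_cases huτ : u ∈ τ
      · right; rw [hz0 u (hs0 huτ), hητ u huτ, mul_zero]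
      · by_cases hF : Φ.Face (insert u τ)
        · right
          by_cases h : η u = 0
          · rw [h, mul_zero]; exact claim1 u huτ hF h
          · rw [hr]; field_simp
        · left; exact fun w => hMz u w huτ hF
    intro u w
    rcases hone u with h | h
    · rw [h w]; ring
    · rcases hone w with h' | h'
      · rw [hMsym u w, h' u]; ring
      · rw [h, h']; ring
  have hterm : ∀ u w, 0 ≤ M u w * η u * η w * (r u - r w) ^ 2 := by
    intro u w
    by_cases huw : u = w
    · rw [huw]; simp
    by_cases huτ : u ∈ τ
    · rw [hητ u huτ]; simp
    by_cases hwτ : w ∈ τ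
    · rw [hητ w hwτ]; simp
    have hMe : M u w = C.Psi (insert w (insert u τ)) [] := by
      simp only [hM]
      rw [Psi_insert huτ, Psi_insert (by simp [Ne.symm huw, hwτ])]
    have hMn : 0 ≤ M u w := by rw [hMe]; exact Psi_nonneg (by simp) _
    by_cases hF : Φ.Face (insert u (insert w τ))
    · by_cases hneg : η u * η w < 0
      · have h1 := claim2 u w huw huτ hwτ hF hneg
        have hηu : η u ≠ 0 := fun h => by rw [h] at hneg; simp at hneg
        have hηw : η w ≠ 0 := fun h => by rw [h] at hneg; simp at hneg
        have : r u = r w := by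
          simp only [hr]
          rw [div_eq_div_iff hηu hηw]; exact h1
        rw [this]; simp
      · push Not at hneg
        rw [mul_assoc (M u w)]
        exact mul_nonneg (mul_nonneg hMn hneg) (sq_nonneg _)
    · rw [hMe, Finset.insert_comm, Psi_nonface hF]; simp
  have hzero : ∑ u, ∑ w, M u w * η u * η w * r u ^ 2 = 0 := by
    refine Finset.sum_eq_zero fun u _ => ?_
    have : ∑ w, M u w * η u * η w * r u ^ 2 = (∑ w, M u w * η w) * (η u * r u ^ 2) := by
      rw [Finset.sum_mul]; exact Finset.sum_congr rfl fun w _ => by ring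
    rw [this, hker, zero_mul]
  have hzero' : ∑ u, ∑ w, M u w * η u * η w * r w ^ 2 = 0 := by
    rw [← hzero, Finset.sum_comm]
    refine Finset.sum_congr rfl fun u _ => Finset.sum_congr rfl fun w _ => ?_
    rw [hMsym w u]; ring
  have hsum : ∑ u, ∑ w, M u w * η u * η w * (r u - r w) ^ 2
      = ∑ u, ∑ w, M u w * η u * η w * r u ^ 2 + ∑ u, ∑ w, M u w * η u * η w * r w ^ 2
        - 2 * ∑ u, ∑ w, M u w * z u * z w := by
    simp only [Finset.mul_sum, ← Finset.sum_add_distrib, ← Finset.sum_sub_distrib]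
    refine Finset.sum_congr rfl fun u _ => Finset.sum_congr rfl fun w _ => ?_
    rw [hzr]; ring
  have hnn : 0 ≤ ∑ u, ∑ w, M u w * η u * η w * (r u - r w) ^ 2 :=
    Finset.sum_nonneg fun u _ => Finset.sum_nonneg fun w _ => hterm u w
  rw [hsum, hzero, hzero'] at hnn
  change ∑ u, ∑ w, M u w * z u * z w ≤ 0
  linarith

lemma shift_pos {τ : Finset ι} (hτ : Φ.Face τ) {z : ι → ℝ} (hz : z ∈ Φ.T) :
    ∃ y : Fin N → ℝ, (∀ t ∈ τ, z t - Φ.vec t ⬝ᵥ y = 0) ∧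
      ∀ u, u ∉ τ → 0 < z u - Φ.vec u ⬝ᵥ y := by
  classical
  set S := Φ.B.filter (fun I => τ ⊆ I) with hS
  have hne : S.Nonempty := by
    obtain ⟨I, hI, hs⟩ := hτ
    exact ⟨I, by simp [hS, hI, hs]⟩
  have hn : (0:ℝ) < S.card := by exact_mod_cast hne.card_pos
  have key : ∀ u, z u - Φ.vec u ⬝ᵥ ((S.card : ℝ)⁻¹ • ∑ I ∈ S, Φ.v I z)
      = (S.card : ℝ)⁻¹ * ∑ I ∈ S, Φ.gap z I u := by
    intro u
    simp only [gap]
    rw [Finset.sum_sub_distrib, Finset.sum_const, nsmul_eq_mul, mul_sub, inv_mul_cancel_left₀ hn.ne',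
      dotProduct_smul, dotProduct_sum, smul_eq_mul]
  refine ⟨(S.card : ℝ)⁻¹ • ∑ I ∈ S, Φ.v I z, fun t ht => ?_, fun u hu => ?_⟩
  · rw [key, Finset.sum_eq_zero, mul_zero]
    intro I hI
    rw [hS, Finset.mem_filter] at hI
    exact gap_zero hI.1 (hI.2 ht) z
  · rw [key]
    refine mul_pos (inv_pos.2 hn) ?_
    obtain ⟨I, hI, hs, huI⟩ := avoid hτ hu
    refine Finset.sum_pos' (fun I hI => ?_) ⟨I, by simp [hS, hI, hs], gap_pos hz hI huI⟩
    rw [hS, Finset.mem_filter] at hI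
    exact gap_nonneg (T_sub_Tb hz) hI.1 u

/-- signature of the localized form -/
theorem AF_sig (L : List (ι → ℝ)) : (∀ x ∈ L, x ∈ Φ.T) → ∀ {τ : Finset ι}, Φ.Face τ →
    τ.card + L.length + 2 = N →
    ∃ lam : (ι → ℝ) →ₗ[ℝ] ℝ, ∀ x, lam x = 0 → C.Psi τ (x :: x :: L) ≤ 0 := by
  classical
  induction L with
  | nil => intro _ τ hτ hc; exact AF_base hτ (by simpa using hc)
  | cons z L ih =>
    intro hL τ hτ hc
    have hzT : z ∈ Φ.T := hL z (by simp)
    have hLT : ∀ x ∈ L, x ∈ Φ.T := fun x hx => hL x (by simp [hx])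
    simp only [List.length_cons] at hc
    obtain ⟨y0, hy0, hy1⟩ := shift_pos hτ hzT
    set z' := z - Φ.ell y0 with hz'
    let p : ι → Prop := fun u => u ∉ τ ∧ Φ.Face (insert u τ)
    let κ := {u : ι // p u}
    have hsub : ∀ f : ι → ℝ, (∀ u, ¬ p u → f u = 0) → ∑ u, f u = ∑ u : κ, f u.1 := by
      intro f hf
      rw [← Finset.sum_subtype (Finset.univ.filter p) (by simp) f, Finset.sum_filter]
      refine Finset.sum_congr rfl fun u _ => ?_
      split_ifs with h
      · rfl
      · exact hf u h
    have hvan : ∀ (x : ι → ℝ), (∀ t ∈ τ, x t = 0) → ∀ K, C.Psi τ (x :: K) =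
        ∑ u : κ, x u.1 * C.Psi τ (ev u.1 :: K) := by
      intro x hx K
      rw [Psi_cons_ev, hsub (fun u => x u * C.Psi τ (ev u :: K))]
      intro u hu
      by_cases huτ : u ∈ τ
      · simp [hx u huτ]
      · have : ¬ Φ.Face (insert u τ) := fun h => hu ⟨huτ, h⟩
        rw [Psi_insert huτ, Psi_nonface this, mul_zero]
    have hz'τ : ∀ t ∈ τ, z' t = 0 := hy0
    let M : Matrix κ κ ℝ := Matrix.of fun u w => C.Psi τ (ev u.1 :: ev w.1 :: z :: L)
    let lam : (ι → ℝ) →ₗ[ℝ] ℝ :=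
      { toFun := fun x => C.Psi τ (x :: z :: z :: L)
        map_add' := fun x y => Psi_add _ _ _ _
        map_smul' := fun a x => Psi_smul _ _ _ _ }
    have hIH : ∀ u : κ, ∀ Y : ι → ℝ, C.Psi τ (ev u.1 :: Y :: Y :: L) * C.Psi τ (ev u.1 :: z :: z :: L)
        ≤ C.Psi τ (ev u.1 :: Y :: z :: L) ^ 2 := by
      intro u Y
      simp only [Psi_insert u.2.1]
      obtain ⟨l, hl⟩ := ih hLT u.2.2 (by rw [Finset.card_insert_of_notMem u.2.1]; omega)
      refine lorentz_of l hl z (Psi_pos ?_ u.2.2 ?_) Y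
      · intro x hx
        simp only [List.mem_cons] at hx
        rcases hx with rfl | rfl | hx
        exacts [hzT, hzT, hLT x hx]
      · rw [Finset.card_insert_of_notMem u.2.1]; simp; omega
    have hd : ∀ u : κ, 0 < C.Psi τ (ev u.1 :: z :: z :: L) := by
      intro u
      rw [Psi_insert u.2.1]
      refine Psi_pos ?_ u.2.2 ?_
      · intro x hx
        simp only [List.mem_cons] at hx
        rcases hx with rfl | rfl | hx
        exacts [hzT, hzT, hLT x hx]
      · rw [Finset.card_insert_of_notMem u.2.1]; simp; omega
    refine ⟨lam, fun x hx => ?_⟩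
    obtain ⟨I, hI, hsI⟩ := id hτ
    set x' := x - Φ.ell (Φ.v I x) with hx'
    have hx'τ : ∀ t ∈ τ, x' t = 0 := by
      intro t ht
      simp [hx', ell, Φ.hv I hI t (hsI ht)]
    have hquad : ∀ Y : ι → ℝ, (∀ t ∈ τ, Y t = 0) → C.Psi τ (Y :: Y :: z :: L) =
        ∑ u : κ, ∑ w : κ, M u w * Y u.1 * Y w.1 := by
      intro Y hY
      rw [hvan Y hY]
      refine Finset.sum_congr rfl fun u _ => ?_
      rw [Psi_swap, hvan Y hY, Finset.mul_sum]
      refine Finset.sum_congr rfl fun w _ => ?_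
      rw [Psi_swap]; simp only [M, Matrix.of_apply]; ring
    rw [← Psi_shift2 τ x (Φ.v I x), ← hx', hquad x' hx'τ]
    refine PF_lemma M ?_ (fun u => z' u.1) (fun u => C.Psi τ (ev u.1 :: z :: z :: L))
      (fun u => hy1 u.1 u.2.1) hd ?_ ?_ ?_ ?_ (fun u => x' u.1) ?_
    · ext u w
      simp only [M, Matrix.transpose_apply, Matrix.of_apply]; exact Psi_swap _ _ _ _
    · intro u
      rw [Psi_swap, ← Psi_shift τ z y0, ← hz', hvan z' hz'τ]
      refine Finset.sum_congr rfl fun w _ => ?_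
      simp only [M, Matrix.of_apply]
      rw [Psi_swap, mul_comm]
    · intro u w huw
      simp only [M, Matrix.of_apply]
      have hne : w.1 ≠ u.1 := fun h => huw (Subtype.ext h.symm)
      rw [Psi_insert u.2.1, Psi_insert (by simp [hne, w.2.1])]
      exact Psi_nonneg (fun x hx => T_sub_Tb (hL x hx)) _
    · intro D u w hu hw
      obtain ⟨a, b, ha, hb, haτ, hbτ, hF⟩ := link_conn hτ (by omega) {i | ∃ h : p i, (⟨i, h⟩ : κ) ∈ D}
        u.2.1 w.2.1 u.2.2 w.2.2 ⟨u.2, hu⟩ (fun ⟨_, h⟩ => hw h)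
      obtain ⟨hpa, haD⟩ := ha
      have hpb : p b := ⟨hbτ, hF.mono (Finset.subset_insert _ _)⟩
      have hbD : (⟨b, hpb⟩ : κ) ∉ D := fun h => hb ⟨hpb, h⟩
      have hne : b ≠ a := by rintro rfl; exact hbD haD
      refine ⟨⟨a, hpa⟩, ⟨b, hpb⟩, haD, hbD, ?_⟩
      simp only [M, Matrix.of_apply]
      have hbn : b ∉ insert a τ := by simp [hne, hbτ]
      rw [Psi_insert haτ, Psi_insert hbn, Finset.insert_comm]
      refine Psi_pos hL hF ?_
      rw [Finset.insert_comm, Finset.card_insert_of_notMem hbn, Finset.card_insert_of_notMem haτ]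
      simp; omega
    · intro y
      set Y : ι → ℝ := fun i => if h : p i then y ⟨i, h⟩ else 0 with hYdef
      have hYτ : ∀ t ∈ τ, Y t = 0 := by
        intro t ht
        simp only [hYdef]
        rw [dif_neg]
        intro h; exact h.1 ht
      have hYe : ∀ u : κ, Y u.1 = y u := by
        intro u; simp only [hYdef]; rw [dif_pos u.2]
      have h1 : ∑ u : κ, ∑ w : κ, M u w * y u * y w = C.Psi τ (Y :: Y :: z :: L) := by
        rw [hquad Y hYτ]; simp only [hYe]
      have h2 : C.Psi τ (Y :: Y :: z :: L) = ∑ u : κ, z' u.1 * C.Psi τ (ev u.1 :: Y :: Y :: L) := by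
        rw [← hvan z' hz'τ, hz', Psi_shift]
        refine Psi_perm ?_
        exact (List.Perm.cons Y (List.Perm.swap z Y L)).trans (List.Perm.swap z Y (Y :: L))
      rw [h1, h2]
      refine Finset.sum_le_sum fun u _ => ?_
      have h3 : ∑ w : κ, M u w * y w = C.Psi τ (ev u.1 :: Y :: z :: L) := by
        rw [Psi_swap, hvan Y hYτ]
        refine Finset.sum_congr rfl fun w _ => ?_
        rw [hYe, Psi_swap]; simp only [M, Matrix.of_apply]; ring
      rw [h3, le_div_iff₀ (hd u), mul_assoc]
      exact mul_le_mul_of_nonneg_left (hIH u Y) (hy1 u.1 u.2.1).le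
    · have h1 : C.Psi τ (x :: z :: z :: L) = 0 := hx
      rw [← Psi_shift τ x (Φ.v I x), ← hx', hvan x' hx'τ] at h1
      exact h1

/-- Alexandrov-Fenchel inequality in the open chamber -/
theorem AF_open {L : List (ι → ℝ)} (hL : ∀ x ∈ L, x ∈ Φ.T) {τ : Finset ι} (hτ : Φ.Face τ)
    (hc : τ.card + L.length + 2 = N) {v : ι → ℝ} (hv : v ∈ Φ.T) (x : ι → ℝ) :
    C.Psi τ (x :: x :: L) * C.Psi τ (v :: v :: L) ≤ C.Psi τ (x :: v :: L) ^ 2 := by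
  obtain ⟨lam, hlam⟩ := AF_sig (C := C) L hL hτ hc
  refine lorentz_of lam hlam v (Psi_pos ?_ hτ (by simp; omega)) x
  intro y hy
  simp only [List.mem_cons] at hy
  rcases hy with rfl | rfl | hy
  exacts [hv, hv, hL y hy]

/-- Alexandrov-Fenchel inequality -/
theorem AF {L : List (ι → ℝ)} (hL : ∀ x ∈ L, x ∈ Φ.Tb)
    (hc : L.length + 2 = N) {v : ι → ℝ} (hv : v ∈ Φ.Tb) (x : ι → ℝ) :
    Phi C.c (x :: x :: L) * Phi C.c (v :: v :: L) ≤ Phi C.c (x :: v :: L) ^ 2 := by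
  set f : (ι → ℝ) × Bool → ℝ → (ι → ℝ) := fun k t => k.1 + (if k.2 then 0 else t) • Φ.h0 with hf
  have hfc : ∀ k, Continuous (f k) := by
    intro k
    simp only [hf]
    split_ifs
    · fun_prop
    · fun_prop
  set Ls : List ((ι → ℝ) × Bool) := L.map (fun y => (y, false)) with hLs
  have hmem : ∀ t : ℝ, 0 < t → ∀ y ∈ Φ.Tb, f (y, false) t ∈ Φ.T := by
    intro t ht y hy
    simp only [hf, Bool.false_eq_true, if_false]
    exact Tb_add_T hy (T_smul h0T ht)
  have hc2 : ∀ a b, Continuous (fun t => Phi C.c ((a :: b :: Ls).map (fun k => f k t))) := by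
    intro a b
    exact Phi_continuous C.c (a :: b :: Ls) f (fun k _ => hfc k)
  have h0 : ∀ k, f k 0 = k.1 := by intro k; simp [hf]
  have hxx : ∀ t, f (x, true) t = x := by intro t; simp [hf]
  have key : ∀ t : ℝ, 0 < t →
      Phi C.c (((x, true) :: (x, true) :: Ls).map (fun k => f k t)) *
      Phi C.c (((v, false) :: (v, false) :: Ls).map (fun k => f k t)) ≤
      Phi C.c (((x, true) :: (v, false) :: Ls).map (fun k => f k t)) ^ 2 := by
    intro t ht
    simp only [List.map_cons, hxx]
    have := AF_open (C := C) (L := Ls.map (fun k => f k t)) (by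
      intro y hy
      simp only [hLs, List.map_map, List.mem_map, Function.comp] at hy
      obtain ⟨z, hz, rfl⟩ := hy
      exact hmem t ht z (hL z hz)) face_empty (by simp [hLs, hc]) (hmem t ht v hv) x
    simpa only [Psi_empty] using this
  have hlim : Phi C.c (((x, true) :: (x, true) :: Ls).map (fun k => f k 0)) *
      Phi C.c (((v, false) :: (v, false) :: Ls).map (fun k => f k 0)) ≤
      Phi C.c (((x, true) :: (v, false) :: Ls).map (fun k => f k 0)) ^ 2 := by
    have c1 := ((hc2 (x, true) (x, true)).mul (hc2 (v, false) (v, false))).continuousWithinAt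
      (s := Set.Ioi 0) (x := 0)
    have c2 := ((hc2 (x, true) (v, false)).pow 2).continuousWithinAt (s := Set.Ioi 0) (x := 0)
    refine le_of_tendsto_of_tendsto c1 c2 ?_
    filter_upwards [self_mem_nhdsWithin] with t ht
    exact key t ht
  have hL0 : Ls.map (fun k => f k 0) = L := by
    simp only [h0, hLs, List.map_map, Function.comp_def]
    simp
  simp only [List.map_cons, hL0] at hlim
  simpa only [h0] using hlim

end Coef
end Esterov

open scoped Matrix
set_option linter.all false
namespace Esterov

lemma lp {N : ℕ} {κ : Type*} [Finite κ] (a : κ → Fin N → ℝ) (b : κ → ℝ)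
    (hc : IsCompact {x : Fin N → ℝ | ∀ k, a k ⬝ᵥ x ≤ b k})
    (hne : {x : Fin N → ℝ | ∀ k, a k ⬝ᵥ x ≤ b k}.Nonempty) (ξ : Fin N → ℝ) :
    ∃ x, (∀ k, a k ⬝ᵥ x ≤ b k) ∧ (∀ y, (∀ k, a k ⬝ᵥ y ≤ b k) → ξ ⬝ᵥ y ≤ ξ ⬝ᵥ x) ∧
      ∀ y, (∀ k, a k ⬝ᵥ x = b k → a k ⬝ᵥ y = 0) → y = 0 := by
  set P := {x : Fin N → ℝ | ∀ k, a k ⬝ᵥ x ≤ b k} with hP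
  have hcont : Continuous (fun x : Fin N → ℝ => ξ ⬝ᵥ x) := by fun_prop
  obtain ⟨x0, hx0, hmax⟩ := hc.exists_isMaxOn hne hcont.continuousOn
  set E := P ∩ {x | ξ ⬝ᵥ x0 ≤ ξ ⬝ᵥ x} with hE
  have hEc : IsCompact E := hc.inter_right (isClosed_le continuous_const hcont)
  obtain ⟨x, hx⟩ := hEc.extremePoints_nonempty ⟨x0, hx0, le_refl (ξ ⬝ᵥ x0)⟩
  have hxE : x ∈ E := hx.1
  have hxm : ∀ y ∈ P, ξ ⬝ᵥ y ≤ ξ ⬝ᵥ x := fun y hy => (hmax hy : ξ ⬝ᵥ y ≤ ξ ⬝ᵥ x0).trans hxE.2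
  refine ⟨x, hxE.1, hxm, fun y hy => ?_⟩
  have ev1 : ∀ᶠ t : ℝ in nhds 0, x + t • y ∈ P := by
    simp only [hP, Set.mem_setOf_eq]
    rw [Filter.eventually_all]
    intro k
    by_cases hk : a k ⬝ᵥ x = b k
    · refine Filter.Eventually.of_forall fun t => ?_
      rw [dotProduct_add, dotProduct_smul, hy k hk, hk]; simp
    · have h1 : a k ⬝ᵥ x < b k := lt_of_le_of_ne (hxE.1 k) hk
      have h2 : ContinuousAt (fun t : ℝ => a k ⬝ᵥ (x + t • y)) 0 := by
        apply Continuous.continuousAt; fun_prop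
      have h3 := h2.eventually_lt (continuousAt_const (y := b k)) (by simpa using h1)
      exact h3.mono fun t ht => ht.le
  have ev2 : ∀ᶠ t : ℝ in nhds 0, x + (-t) • y ∈ P := by
    have : Filter.Tendsto (fun t : ℝ => -t) (nhds 0) (nhds 0) := by
      simpa using (continuous_neg (G := ℝ)).tendsto 0
    exact this.eventually ev1
  have ev3 : ∀ᶠ t : ℝ in nhdsWithin 0 (Set.Ioi 0), (x + t • y ∈ P ∧ x + (-t) • y ∈ P) ∧ t ∈ Set.Ioi (0:ℝ) :=
    ((ev1.and ev2).filter_mono nhdsWithin_le_nhds).and self_mem_nhdsWithin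
  obtain ⟨t, ⟨h1, h2⟩, ht⟩ := ev3.exists
  have ht : 0 < t := ht
  have m1 := hxm _ h1
  have m2 := hxm _ h2
  simp only [dotProduct_add, dotProduct_smul, smul_eq_mul] at m1 m2
  have hz : t * (ξ ⬝ᵥ y) = 0 := by linarith
  have e1 : x + t • y ∈ E := ⟨h1, by
    have := hxE.2
    simp only [Set.mem_setOf_eq, dotProduct_add, dotProduct_smul, smul_eq_mul] at this ⊢; linarith⟩
  have e2 : x + (-t) • y ∈ E := ⟨h2, by
    have := hxE.2
    simp only [Set.mem_setOf_eq, dotProduct_add, dotProduct_smul, smul_eq_mul] at this ⊢; linarith⟩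
  have := hx.2 e1 e2 (by
    rw [openSegment_eq_image]
    refine ⟨1/2, by norm_num, ?_⟩
    ext i; simp; ring)
  have h4 : t • y = 0 := by simpa using this
  rcases smul_eq_zero.1 h4 with h | h
  · exact absurd h ht.ne'
  · exact h

lemma exists_dot {N : ℕ} (f : (Fin N → ℝ) →ₗ[ℝ] ℝ) : ∃ y : Fin N → ℝ, ∀ x, f x = x ⬝ᵥ y := by
  refine ⟨fun i => f (Pi.single i 1), fun x => ?_⟩
  conv_lhs => rw [← Finset.univ_sum_single x]
  rw [map_sum, dotProduct]
  refine Finset.sum_congr rfl fun i _ => ?_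
  have : Pi.single i (x i) = x i • (Pi.single i 1 : Fin N → ℝ) := by
    rw [← Pi.single_smul]; simp
  rw [this, map_smul, smul_eq_mul]

/-- choosing an N-subset -/
lemma exists_sub {N : ℕ} {ι : Type} [Fintype ι] [DecidableEq ι] (vec : ι → Fin N → ℝ) (A : Finset ι)
    (hA : ∀ y, (∀ k ∈ A, vec k ⬝ᵥ y = 0) → y = 0) :
    ∃ I ⊆ A, I.card = N ∧ ∀ y, (∀ k ∈ I, vec k ⬝ᵥ y = 0) → y = 0 := by
  classical
  obtain ⟨b, hb, hbs, hli⟩ : ∃ b : Set ι, b ⊆ (A : Set ι) ∧ 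
      (A : Set ι).image vec ⊆ (Submodule.span ℝ (vec '' b) : Set (Fin N → ℝ)) ∧ LinearIndepOn ℝ vec b := by
    obtain ⟨b, hb⟩ := exists_linearIndepOn_extension (v := vec) (s := ∅) (t := (A : Set ι))
      (linearIndepOn_empty ℝ vec) (Set.empty_subset _)
    exact ⟨b, hb.1, hb.2.2.1, hb.2.2.2⟩
  have hu : ∀ y, (∀ k ∈ b, vec k ⬝ᵥ y = 0) → y = 0 := by
    intro y hy
    apply hA
    intro k hk
    have h1 : vec k ∈ Submodule.span ℝ (vec '' b) := hbs ⟨k, hk, rfl⟩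
    generalize vec k = z at h1 ⊢
    induction h1 using Submodule.span_induction with
    | mem x hx => obtain ⟨j, hj, rfl⟩ := hx; exact hy j hj
    | zero => simp
    | add x z _ _ h1 h2 => rw [add_dotProduct, h1, h2, add_zero]
    | smul a x _ h => rw [smul_dotProduct, h, smul_zero]
  have htop : Submodule.span ℝ (vec '' b) = ⊤ := by
    by_contra hne
    obtain ⟨f, hf, hfb⟩ := Submodule.exists_le_ker_of_lt_top _ (lt_top_iff_ne_top.2 hne)
    obtain ⟨y, hfy⟩ := exists_dot f
    have h0 := hu y (fun k hk => by
      rw [← hfy]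
      exact hfb (Submodule.subset_span ⟨k, hk, rfl⟩))
    apply hf
    refine LinearMap.ext fun x => ?_
    rw [hfy, h0]; simp
  set I := A.filter (· ∈ b) with hI
  have hIb : (I : Set ι) = b := by
    ext k; simp only [hI, Finset.coe_filter, Set.mem_setOf_eq]
    exact ⟨fun h => h.2, fun h => ⟨hb h, h⟩⟩
  refine ⟨I, Finset.filter_subset _ _, ?_, fun y hy => hu y fun k hk => hy k ?_⟩
  · have h1 : LinearIndependent ℝ (fun k : (I : Set ι) => vec k) := by
      rw [hIb]; exact hli
    have h2 := linearIndependent_iff_card_eq_finrank_span.1 h1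
    rw [Set.finrank] at h2
    have h3 : Set.range (fun k : (I : Set ι) => vec k) = vec '' b := by
      rw [← hIb]; ext; simp
    rw [h3, htop, finrank_top] at h2
    simpa using h2
  · rw [← Finset.mem_coe, hIb]; exact hk

/-- vertex map -/
lemma exists_v {N : ℕ} {ι : Type} [Fintype ι] [DecidableEq ι] (vec : ι → Fin N → ℝ) (I : Finset ι)
    (hI : I.card = N) (hu : ∀ y, (∀ k ∈ I, vec k ⬝ᵥ y = 0) → y = 0) :
    ∃ v : (ι → ℝ) →ₗ[ℝ] (Fin N → ℝ), ∀ i ∈ I, ∀ h, vec i ⬝ᵥ v h = h i := by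
  set L : (Fin N → ℝ) →ₗ[ℝ] (I → ℝ) := LinearMap.pi fun i => dotProductBilin ℝ ℝ (vec i) with hL
  have hLi : ∀ x i, L x i = vec i ⬝ᵥ x := fun x i => by simp [hL]
  have hinj : Function.Injective L := by
    rw [← LinearMap.ker_eq_bot, LinearMap.ker_eq_bot']
    intro y hy
    apply hu
    intro k hk
    rw [← hLi y ⟨k, hk⟩, hy]; rfl
  set e := LinearEquiv.ofInjectiveOfFinrankEq L hinj (by simp [hI]) with he
  refine ⟨e.symm.toLinearMap ∘ₗ LinearMap.funLeft ℝ ℝ (fun i : I => (i : ι)), fun i hi h => ?_⟩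
  have h1 : ∀ z, L (e.symm z) = z := fun z => e.apply_symm_apply z
  rw [LinearMap.comp_apply, ← hLi _ ⟨i, hi⟩]
  show L (e.symm _) ⟨i, hi⟩ = _
  rw [h1]; rfl

end Esterov

open scoped Matrix
set_option linter.all false
namespace Esterov

lemma dot_le_hull {N : ℕ} {V : Set (Fin N → ℝ)} {ξ : Fin N → ℝ} {c : ℝ} (h : ∀ p ∈ V, ξ ⬝ᵥ p ≤ c)
    {x : Fin N → ℝ} (hx : x ∈ convexHull ℝ V) : ξ ⬝ᵥ x ≤ c := by
  have : Convex ℝ {x : Fin N → ℝ | ξ ⬝ᵥ x ≤ c} := by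
    have := convex_halfSpace_le (𝕜 := ℝ) (f := fun x : Fin N → ℝ => ξ ⬝ᵥ x)
      ⟨fun x y => dotProduct_add _ _ _, fun a x => dotProduct_smul _ _ _⟩ c
    exact this
  exact convexHull_min (t := {x : Fin N → ℝ | ξ ⬝ᵥ x ≤ c}) h this hx

lemma sep_hull {N : ℕ} {V : Set (Fin N → ℝ)} (hV : V.Finite) {x : Fin N → ℝ}
    (hx : x ∉ convexHull ℝ V) : ∃ (ξ : Fin N → ℝ) (c : ℝ), (∀ p ∈ convexHull ℝ V, ξ ⬝ᵥ p < c) ∧ c < ξ ⬝ᵥ x := by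
  obtain ⟨f, u, h1, h2⟩ := geometric_hahn_banach_closed_point (convex_convexHull ℝ V)
    (hV.isCompact_convexHull (𝕜 := ℝ)).isClosed hx
  obtain ⟨y, hy⟩ := exists_dot (f : (Fin N → ℝ) →ₗ[ℝ] ℝ)
  have hy : ∀ x, f x = y ⬝ᵥ x := fun x => by rw [dotProduct_comm]; exact hy x
  refine ⟨y, u, fun p hp => ?_, ?_⟩
  · rw [← hy]; exact h1 p hp
  · rw [← hy]; exact h2

lemma exists_U {N : ℕ} (hN : 0 < N) (V : Finset (Fin N → ℝ)) (x0 : Fin N → ℝ)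
    (hx0 : x0 ∈ interior (convexHull ℝ (V : Set (Fin N → ℝ)))) :
    ∃ U : Finset (Fin N → ℝ), (∀ u ∈ U, ∃ p ∈ V, u ⬝ᵥ (p - x0) = 1) ∧
      (∀ u ∈ U, ∀ p ∈ V, u ⬝ᵥ (p - x0) ≤ 1) ∧
      (∀ x, (∀ u ∈ U, u ⬝ᵥ (x - x0) ≤ 1) → x ∈ convexHull ℝ (V : Set (Fin N → ℝ))) := by
  classical
  set a : V → Fin N → ℝ := fun p => p.1 - x0 with ha
  set Po := {ξ : Fin N → ℝ | ∀ p : V, a p ⬝ᵥ ξ ≤ 1} with hPo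
  have hPoc : IsCompact Po := by
    refine Metric.isCompact_of_isClosed_isBounded ?_ ?_
    · rw [hPo, Set.setOf_forall]
      exact isClosed_iInter fun p => isClosed_le (by fun_prop) continuous_const
    · obtain ⟨r, hr, hb⟩ := Metric.mem_nhds_iff.1 (mem_interior_iff_mem_nhds.1 hx0)
      refine (Metric.isBounded_closedBall (x := (0 : Fin N → ℝ)) (r := 2 / r)).subset ?_
      intro ξ hξ
      have h1 : ∀ x ∈ Metric.ball x0 r, ξ ⬝ᵥ x ≤ 1 + ξ ⬝ᵥ x0 := by
        intro x hx
        refine dot_le_hull (fun p hp => ?_) (hb hx)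
        have := hξ ⟨p, hp⟩
        simp only [ha, sub_dotProduct] at this
        rw [dotProduct_comm ξ p, dotProduct_comm ξ x0]; linarith
      rw [mem_closedBall_zero_iff, pi_norm_le_iff_of_nonneg (by positivity)]
      intro i
      have h2 : ∀ s : ℝ, |s| < r → ξ i * s ≤ 1 := by
        intro s hs
        have := h1 (x0 + Pi.single i s) (by
          rw [mem_ball_iff_norm, add_sub_cancel_left, Pi.norm_single]; exact hs)
        rw [dotProduct_add, dotProduct_single] at this
        linarith
      have h3 := h2 (r/2) (by rw [abs_of_pos (by positivity)]; linarith)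
      have h4 := h2 (-(r/2)) (by rw [abs_neg, abs_of_pos (by positivity)]; linarith)
      rw [Real.norm_eq_abs, abs_le, neg_le, le_div_iff₀ hr, le_div_iff₀ hr]
      constructor <;> linarith
  set S := {ξ : Fin N → ℝ | (∀ p : V, a p ⬝ᵥ ξ ≤ 1) ∧
    ∀ y, (∀ p : V, a p ⬝ᵥ ξ = 1 → a p ⬝ᵥ y = 0) → y = 0} with hS
  have hSf : S.Finite := by
    refine Set.Finite.of_finite_image (f := fun ξ => {p : V | a p ⬝ᵥ ξ = 1}) (Set.toFinite _) ?_
    intro ξ hξ η hη he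
    have he : {p : V | a p ⬝ᵥ ξ = 1} = {p : V | a p ⬝ᵥ η = 1} := he
    rw [← sub_eq_zero]
    apply hξ.2
    intro p hp
    have : p ∈ {p : V | a p ⬝ᵥ η = 1} := by rw [← he]; exact hp
    have : a p ⬝ᵥ η = 1 := this
    rw [dotProduct_sub, hp, this, sub_self]
  refine ⟨hSf.toFinset, ?_, ?_, ?_⟩
  · intro u hu
    rw [Set.Finite.mem_toFinset] at hu
    by_contra hcon
    push Not at hcon
    have := hu.2 (fun _ => 1) (fun p hp => by
      exact absurd (by rw [dotProduct_comm]; exact hp) (hcon p.1 p.2))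
    have := congrFun this ⟨0, hN⟩
    simp at this
  · intro u hu p hp
    rw [Set.Finite.mem_toFinset] at hu
    rw [dotProduct_comm]; exact hu.1 ⟨p, hp⟩
  · intro x hx
    by_contra hcon
    obtain ⟨ξ, c, h1, h2⟩ := sep_hull V.finite_toSet hcon
    have h3 := h1 x0 (interior_subset hx0)
    set d := c - ξ ⬝ᵥ x0 with hd
    have hd0 : 0 < d := sub_pos.2 h3
    have hmem : ∀ p : V, a p ⬝ᵥ (d⁻¹ • ξ) ≤ 1 := by
      intro p
      have := h1 p.1 (subset_convexHull ℝ _ p.2)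
      rw [dotProduct_smul, smul_eq_mul, inv_mul_le_iff₀ hd0, mul_one]
      simp only [ha, sub_dotProduct]
      rw [dotProduct_comm _ ξ, dotProduct_comm _ ξ]; linarith
    obtain ⟨u, hu1, hu2, hu3⟩ := lp a (fun _ => 1) hPoc ⟨_, hmem⟩ (x - x0)
    have h5 := hu2 _ hmem
    have h6 := hx u (by rw [Set.Finite.mem_toFinset]; exact ⟨hu1, hu3⟩)
    rw [dotProduct_comm] at h6
    have h7 := h5.trans h6
    rw [dotProduct_smul, smul_eq_mul, inv_mul_le_iff₀ hd0, mul_one, sub_dotProduct,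
      dotProduct_comm _ ξ, dotProduct_comm _ ξ] at h7
    linarith

/-- `h` is the support function of `K` on the fan -/
def IsSupp {N : ℕ} {ι : Type} [Fintype ι] [DecidableEq ι] (Φ : Fan N ι) (K : Set (Fin N → ℝ)) (h : ι → ℝ) : Prop :=
  (∀ a ∈ K, ∀ u, Φ.vec u ⬝ᵥ a ≤ h u) ∧ ∀ I ∈ Φ.B, ∃ b ∈ K, ∀ i ∈ I, Φ.vec i ⬝ᵥ b = h i

lemma exists_generic {ι : Type} [Fintype ι] [DecidableEq ι] {κ : Type} [Finite κ]
    (f : κ → (ι → ℝ) →ₗ[ℝ] ℝ) (hf : ∀ k, f k ≠ 0) : ∃ g, ∀ k, f k g ≠ 0 := by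
  by_contra hcon
  push Not at hcon
  have := Subspace.biUnion_ne_univ_of_top_notMem (k := ℝ) (E := ι → ℝ)
    (s := (Set.finite_range (fun k => (f k).ker)).toFinset) (by
      rw [Set.Finite.mem_toFinset]
      rintro ⟨k, hk⟩
      exact hf k (LinearMap.ker_eq_top.1 hk))
  apply this
  rw [Set.eq_univ_iff_forall]
  intro g
  obtain ⟨k, hk⟩ := hcon g
  simp only [Set.mem_iUnion]
  exact ⟨(f k).ker, by rw [Set.Finite.mem_toFinset]; exact ⟨k, rfl⟩, hk⟩

end Esterov

open scoped Matrix
set_option linter.all false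
namespace Esterov

theorem fan_of {N : ℕ} (hN : 0 < N) (V : Finset (Fin N → ℝ)) (x0 : Fin N → ℝ)
    (hx0 : x0 ∈ interior (convexHull ℝ (V : Set (Fin N → ℝ)))) :
    ∃ (ι : Type) (_ : Fintype ι) (_ : DecidableEq ι) (Φ : Fan N ι) (h : ι → ℝ),
      IsSupp Φ (V : Set (Fin N → ℝ)) h := by
  classical
  obtain ⟨U, hU1, hU2, hU3⟩ := exists_U hN V x0 hx0
  let ι := {u // u ∈ U}
  let vec : ι → Fin N → ℝ := fun u => u.1
  have hVne : V.Nonempty := by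
    by_contra h
    rw [Finset.not_nonempty_iff_eq_empty] at h
    rw [h] at hx0; simp at hx0
  set Good : Finset ι → Prop := fun I => I.card = N ∧ ∀ y, (∀ k ∈ I, vec k ⬝ᵥ y = 0) → y = 0 with hGood
  let v : Finset ι → (ι → ℝ) →ₗ[ℝ] (Fin N → ℝ) := fun I =>
    if h : Good I then Classical.choose (exists_v vec I h.1 h.2) else 0
  have hv : ∀ I, Good I → ∀ i ∈ I, ∀ h, vec i ⬝ᵥ v I h = h i := by
    intro I hI
    simp only [v, dif_pos hI]
    exact Classical.choose_spec (exists_v vec I hI.1 hI.2)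
  let κ := {p : Finset ι × ι // Good p.1 ∧ p.2 ∉ p.1}
  let f : κ → (ι → ℝ) →ₗ[ℝ] ℝ := fun p => LinearMap.proj p.1.2 - (dotProductBilin ℝ ℝ (vec p.1.2)) ∘ₗ v p.1.1
  have hf : ∀ p h, f p h = h p.1.2 - vec p.1.2 ⬝ᵥ v p.1.1 h := fun p h => by simp [f]
  obtain ⟨g, hg⟩ := exists_generic f (by
    intro p h0
    have h1 : f p (ev p.1.2) = 0 := by rw [h0]; rfl
    have h2 : v p.1.1 (ev p.1.2) = 0 := by
      apply p.2.1.2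
      intro k hk
      rw [hv _ p.2.1 k hk]
      have : k ≠ p.1.2 := by rintro rfl; exact p.2.2 hk
      simp [ev, this]
    rw [hf, h2] at h1
    simp [ev] at h1)
  set hQ : ι → ℝ := fun u => 1 + vec u ⬝ᵥ x0 with hhQ
  have ev1 : ∀ᶠ ε : ℝ in nhdsWithin 0 (Set.Ioi 0), ∀ p : κ, (f p hQ + ε * f p g ≠ 0) ∧
      (f p hQ < 0 → f p hQ + ε * f p g < 0) := by
    rw [Filter.eventually_all]
    intro p
    have hcont : ContinuousAt (fun ε : ℝ => f p hQ + ε * f p g) 0 := by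
      apply Continuous.continuousAt; fun_prop
    refine Filter.Eventually.and ?_ ?_
    · by_cases h0 : f p hQ = 0
      · filter_upwards [self_mem_nhdsWithin] with ε hε
        rw [h0, zero_add]
        exact mul_ne_zero (ne_of_gt hε) (hg p)
      · exact (hcont.eventually_ne (by simpa using h0)).filter_mono nhdsWithin_le_nhds
    · by_cases h0 : f p hQ < 0
      · have := hcont.eventually_lt (continuousAt_const (y := (0:ℝ))) (by simpa using h0)
        exact (this.filter_mono nhdsWithin_le_nhds).mono fun _ h _ => h
      · exact Filter.Eventually.of_forall fun _ h => absurd h h0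
  have ev2 : ∀ᶠ ε : ℝ in nhdsWithin 0 (Set.Ioi 0), ∀ u : ι, vec u ⬝ᵥ x0 < hQ u + ε * g u := by
    rw [Filter.eventually_all]
    intro u
    have hcont : ContinuousAt (fun ε : ℝ => hQ u + ε * g u) 0 := by
      apply Continuous.continuousAt; fun_prop
    exact ((continuousAt_const (y := vec u ⬝ᵥ x0)).eventually_lt hcont (by simp [hhQ])).filter_mono
      nhdsWithin_le_nhds
  obtain ⟨ε, hε1, hε2⟩ := (ev1.and ev2).exists
  set hs : ι → ℝ := hQ + ε • g with hhs
  have hfs : ∀ p, f p hs = f p hQ + ε * f p g := by intro p; rw [hhs, map_add, map_smul, smul_eq_mul]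
  have hsu : ∀ u, hs u = hQ u + ε * g u := fun u => by simp [hhs]
  let B : Finset (Finset ι) := Finset.univ.filter fun I => Good I ∧ ∀ j, vec j ⬝ᵥ v I hs ≤ hs j
  have hB : ∀ I ∈ B, Good I ∧ ∀ j, vec j ⬝ᵥ v I hs ≤ hs j := fun I hI => (Finset.mem_filter.1 hI).2
  have hgen : ∀ I ∈ B, ∀ j, j ∉ I → vec j ⬝ᵥ v I hs < hs j := by
    intro I hI j hj
    refine lt_of_le_of_ne ((hB I hI).2 j) fun he => ?_
    have := (hε1 ⟨(I, j), (hB I hI).1, hj⟩).1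
    rw [← hfs, hf] at this
    exact this (by simp only; linarith)
  have hPc : IsCompact {x : Fin N → ℝ | ∀ u : ι, vec u ⬝ᵥ x ≤ hs u} := by
    obtain ⟨M, hM⟩ : ∃ M : ℝ, ∀ u : ι, hs u - vec u ⬝ᵥ x0 ≤ M := by
      obtain ⟨M, hM⟩ := (Set.finite_range (fun u : ι => hs u - vec u ⬝ᵥ x0)).bddAbove
      exact ⟨M, fun u => hM ⟨u, rfl⟩⟩
    set M' := max M 1 with hM'
    have hM0 : 0 < M' := lt_of_lt_of_le one_pos (le_max_right _ _)
    refine IsCompact.of_isClosed_subset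
      (((V.finite_toSet.isCompact_convexHull (𝕜 := ℝ))).image (f := fun y => x0 + M' • (y - x0)) (by fun_prop)) ?_ ?_
    · rw [Set.setOf_forall]
      exact isClosed_iInter fun p => isClosed_le (by fun_prop) continuous_const
    · intro x hx
      refine ⟨x0 + M'⁻¹ • (x - x0), hU3 _ fun u hu => ?_, ?_⟩
      · rw [add_sub_cancel_left, dotProduct_smul, smul_eq_mul, inv_mul_le_iff₀ hM0, mul_one, dotProduct_sub]
        have h1 := hx ⟨u, hu⟩
        have h2 := hM ⟨u, hu⟩
        have h3 := le_max_left M 1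
        simp only [vec] at h1 h2
        linarith
      · simp only [add_sub_cancel_left, smul_smul, mul_inv_cancel₀ hM0.ne', one_smul, add_sub_cancel]
  have hcover : ∀ ξ : Fin N → ℝ, ∃ I ∈ B, ∀ i ∈ I, 0 ≤ ξ ⬝ᵥ v I (ev i) := by
    intro ξ
    obtain ⟨x, hx1, hx2, hx3⟩ := lp vec hs hPc ⟨x0, fun u => by rw [hsu]; exact (hε2 u).le⟩ ξ
    obtain ⟨I, hIA, hIc, hIu⟩ := exists_sub vec (Finset.univ.filter fun k => vec k ⬝ᵥ x = hs k) (by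
      intro y hy; exact hx3 y fun k hk => hy k (by simpa using hk))
    have hG : Good I := ⟨hIc, hIu⟩
    have hIx : ∀ i ∈ I, vec i ⬝ᵥ x = hs i := fun i hi => by simpa using hIA hi
    have hxv : v I hs = x := by
      rw [← sub_eq_zero]
      apply hIu
      intro k hk
      rw [dotProduct_sub, hv I hG k hk, hIx k hk, sub_self]
    have hIB : I ∈ B := by
      refine Finset.mem_filter.2 ⟨Finset.mem_univ _, hG, ?_⟩
      rw [hxv]; exact hx1
    refine ⟨I, hIB, fun i hi => ?_⟩
    have ev3 : ∀ᶠ t : ℝ in nhdsWithin 0 (Set.Ioi 0), ∀ k, vec k ⬝ᵥ (x + t • (-v I (ev i))) ≤ hs k := by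
      rw [Filter.eventually_all]
      intro k
      by_cases hk : k ∈ I
      · filter_upwards [self_mem_nhdsWithin] with t ht
        have ht : 0 < t := ht
        rw [dotProduct_add, dotProduct_smul, dotProduct_neg, hv I hG k hk, hIx k hk]
        have : 0 ≤ (ev i : ι → ℝ) k := by
          simp only [ev, Pi.single_apply]; split_ifs <;> norm_num
        simp only [smul_eq_mul]
        nlinarith
      · have h1 := hgen I hIB k hk
        rw [hxv] at h1
        have h2 : ContinuousAt (fun t : ℝ => vec k ⬝ᵥ (x + t • (-v I (ev i)))) 0 := by
          apply Continuous.continuousAt; fun_prop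
        have h3 := h2.eventually_lt (continuousAt_const (y := hs k)) (by simpa using h1)
        exact (h3.mono fun t ht => ht.le).filter_mono nhdsWithin_le_nhds
    obtain ⟨t, ht1, ht⟩ := (ev3.and self_mem_nhdsWithin).exists
    have ht : 0 < t := ht
    have h4 := hx2 _ ht1
    rw [dotProduct_add, dotProduct_smul, dotProduct_neg, smul_eq_mul] at h4
    nlinarith
  refine ⟨ι, inferInstance, inferInstance, ⟨vec, B, v, fun I hI => (hB I hI).1.1,
    fun I hI => hv I (hB I hI).1, fun I hI => (hB I hI).1.2, hs, hgen, hcover⟩, hQ, ?_, ?_⟩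
  · intro a ha u
    have := hU2 u.1 u.2 a ha
    rw [dotProduct_sub] at this
    simp only [hhQ, vec]; linarith
  · intro I hI
    have hI : I ∈ B := hI
    have hG := (hB I hI).1
    have hy : ∀ j, vec j ⬝ᵥ v I hQ ≤ hQ j := by
      intro j
      by_cases hj : j ∈ I
      · exact (hv I hG j hj hQ).le
      · by_contra hcon
        have h1 := (hε1 ⟨(I, j), hG, hj⟩).2
        rw [← hfs, hf, hf] at h1
        have h2 := hgen I hI j hj
        simp only at h1
        push Not at hcon
        have := h1 (by linarith)
        linarith
    have hyV := hU3 (v I hQ) (fun u hu => by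
      have := hy ⟨u, hu⟩
      rw [dotProduct_sub]
      simp only [hhQ, vec] at this ⊢
      linarith)
    obtain ⟨p, hp, hmax⟩ := V.exists_max_image (fun p => (∑ i ∈ I, vec i) ⬝ᵥ p) hVne
    have h1 := dot_le_hull (ξ := ∑ i ∈ I, vec i) hmax hyV
    refine ⟨p, hp, ?_⟩
    have h2 : ∀ i ∈ I, 0 ≤ hQ i - vec i ⬝ᵥ p := by
      intro i hi
      have := hU2 i.1 i.2 p hp
      rw [dotProduct_sub] at this
      simp only [hhQ, vec]; linarith
    have h3 : ∑ i ∈ I, (hQ i - vec i ⬝ᵥ p) = 0 := by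
      refine le_antisymm ?_ (Finset.sum_nonneg h2)
      rw [sum_dotProduct, sum_dotProduct, Finset.sum_congr rfl (fun i hi => hv I hG i hi hQ)] at h1
      rw [Finset.sum_sub_distrib]; linarith
    intro i hi
    have := (Finset.sum_eq_zero_iff_of_nonneg h2).1 h3 i hi
    show vec i ⬝ᵥ p = hQ i
    linarith

end Esterov

open scoped Matrix
set_option linter.all false
namespace Esterov
namespace Fan
variable {N : ℕ} {ι : Type} [Fintype ι] [DecidableEq ι] {Φ : Fan N ι}

/-- signed indicator -/
noncomputable def sg (γ k : ℝ) : ℝ := if 0 < γ ∧ 0 < k then 1 else if γ < 0 ∧ k < 0 then -1 else 0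

lemma sg_congr {γ γ' : ℝ} (h : 0 < γ * γ') (k : ℝ) : sg γ k = sg γ' k := by
  rcases pos_and_pos_or_neg_and_neg_of_mul_pos h with ⟨h1, h2⟩ | ⟨h1, h2⟩
  · simp [sg, h1, h2, h1.not_gt, h2.not_gt]
  · simp [sg, h1, h2, h1.not_gt, h2.not_gt]

lemma sg_cross {α γ γ' k k' : ℝ} (hα : 0 < α) (hγ : γ ≠ 0) (hγ' : γ' ≠ 0) (hk : k ≠ 0) (hk' : k' ≠ 0) :
    sg γ k + sg (-α * γ) k' = sg γ' k + sg (-α * γ') k' := by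
  have key : ∀ γ, γ ≠ 0 → sg γ k + sg (-α * γ) k' = (if 0 < k then 1 else 0) + (if 0 < k' then 1 else 0) - 1 := by
    intro γ hγ
    rcases lt_or_gt_of_ne hγ with h | h
    · have h1 : 0 < -α * γ := by nlinarith
      rcases lt_or_gt_of_ne hk with h2 | h2 <;> rcases lt_or_gt_of_ne hk' with h3 | h3 <;>
        simp [sg, h, h1, h2, h3, h.not_gt, h1.not_gt, h2.not_gt, h3.not_gt, -neg_mul]
    · have h1 : -α * γ < 0 := by nlinarith
      rcases lt_or_gt_of_ne hk with h2 | h2 <;> rcases lt_or_gt_of_ne hk' with h3 | h3 <;>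
        simp [sg, h, h1, h2, h3, h.not_gt, h1.not_gt, h2.not_gt, h3.not_gt, -neg_mul]
  rw [key γ hγ, key γ' hγ']

lemma expand_insert {σ : Finset ι} {u : ι} (hu : u ∉ σ) (hI : insert u σ ∈ Φ.B) (ξ : Fin N → ℝ) :
    ξ = Φ.co (insert u σ) ξ u • Φ.vec u + ∑ t ∈ σ, Φ.co (insert u σ) ξ t • Φ.vec t := by
  conv_lhs => rw [expand hI ξ]
  rw [Finset.sum_insert hu]

lemma co_trans {σ : Finset ι} {u w : ι} (hu : u ∉ σ) (hw : w ∉ σ) (hI : insert u σ ∈ Φ.B)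
    (hI' : insert w σ ∈ Φ.B) (ξ : Fin N → ℝ) :
    Φ.co (insert w σ) ξ w = Φ.co (insert u σ) ξ u * Φ.co (insert w σ) (Φ.vec u) w := by
  conv_lhs => rw [expand_insert hu hI ξ]
  rw [co_add, Coef.co_span hI' (Finset.subset_insert _ _) _ hw, co_smul, add_zero]

lemma co_same {σ : Finset ι} {u w : ι} (hu : u ∉ σ) (hw : w ∉ σ) (hI : insert u σ ∈ Φ.B)
    (hI' : insert w σ ∈ Φ.B) (ξ : Fin N → ℝ) (h0 : Φ.co (insert u σ) ξ u = 0) {j : ι} (hj : j ∈ σ) :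
    Φ.co (insert w σ) ξ j = Φ.co (insert u σ) ξ j := by
  conv_lhs => rw [expand_insert hu hI ξ]
  rw [h0, zero_smul, zero_add, co_sum, Finset.sum_eq_single j]
  · rw [co_smul, co_vec hI' (Finset.mem_insert_of_mem hj)]; simp
  · intro t ht htj
    rw [co_smul, co_vec hI' (Finset.mem_insert_of_mem ht), if_neg htj, mul_zero]
  · intro h; exact absurd hj h

lemma opp {σ : Finset ι} {u w : ι} (hu : u ∉ σ) (hw : w ∉ σ) (hI : insert u σ ∈ Φ.B)
    (hI' : insert w σ ∈ Φ.B) (hne : u ≠ w) : Φ.co (insert w σ) (Φ.vec u) w < 0 := by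
  rcases lt_trichotomy (Φ.co (insert w σ) (Φ.vec u) w) 0 with h | h | h
  · exact h
  · have h1 := co_trans hw hu hI' hI (Φ.vec u)
    rw [h, zero_mul, co_vec hI (Finset.mem_insert_self _ _)] at h1
    simp at h1
  · exact absurd (ray_unique ⟨_, hI', subset_rfl⟩ ⟨_, hI, subset_rfl⟩ hw hu h _
      (expand_insert hw hI' (Φ.vec u))) hne

lemma exists_partner {σ : Finset ι} {u : ι} (hu : u ∉ σ) (hI : insert u σ ∈ Φ.B) :
    ∃ w, w ∉ σ ∧ w ≠ u ∧ insert w σ ∈ Φ.B := by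
  obtain ⟨J, hJ, hs, huJ⟩ := avoid (Face.mono ⟨_, hI, subset_rfl⟩ (Finset.subset_insert u σ)) hu
  have hc : (J \ σ).card = 1 := by
    rw [Finset.card_sdiff_of_subset hs, Φ.card_eq J hJ, ← Φ.card_eq _ hI, Finset.card_insert_of_notMem hu]
    omega
  obtain ⟨w, hw⟩ := Finset.card_eq_one.1 hc
  have hw' : w ∈ J \ σ := by rw [hw]; simp
  rw [Finset.mem_sdiff] at hw'
  have : insert w σ = J := by
    refine Finset.eq_of_subset_of_card_le (Finset.insert_subset hw'.1 hs) ?_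
    rw [Φ.card_eq J hJ, ← Φ.card_eq _ hI, Finset.card_insert_of_notMem hu, Finset.card_insert_of_notMem hw'.2]
  exact ⟨w, hw'.2, by rintro rfl; exact huJ hw'.1, by rw [this]; exact hJ⟩

lemma partner_unique {σ : Finset ι} {u w w' : ι} (hu : u ∉ σ) (hw : w ∉ σ) (hw' : w' ∉ σ)
    (hI : insert u σ ∈ Φ.B) (hJ : insert w σ ∈ Φ.B) (hJ' : insert w' σ ∈ Φ.B) (h1 : w ≠ u) (h2 : w' ≠ u) :
    w = w' := by
  by_contra hne
  have a := opp hu hw hI hJ (Ne.symm h1)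
  have b := opp hw hw' hJ hJ' hne
  have c := opp hu hw' hI hJ' (Ne.symm h2)
  have d := co_trans hw hw' hJ hJ' (Φ.vec u)
  nlinarith [mul_pos_of_neg_of_neg a b]

/-- signed count -/
noncomputable def GG (Φ : Fan N ι) (k : ι → ℝ) (ξ : Fin N → ℝ) : ℝ :=
  ∑ I ∈ Φ.B, ∏ i ∈ I, sg (Φ.co I ξ i) (k i)

lemma wall {k : ι → ℝ} (hk : ∀ u, k u ≠ 0) {ζ ξ ξ' : Fin N → ℝ}
    (hz : ∀ I ∈ Φ.B, ∀ i ∈ I, ∀ j ∈ I, Φ.co I ζ i = 0 → Φ.co I ζ j = 0 → i = j)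
    (h1 : ∀ I ∈ Φ.B, ∀ i ∈ I, Φ.co I ξ i ≠ 0) (h2 : ∀ I ∈ Φ.B, ∀ i ∈ I, Φ.co I ξ' i ≠ 0)
    (h3 : ∀ I ∈ Φ.B, ∀ i ∈ I, Φ.co I ζ i ≠ 0 → 0 < Φ.co I ζ i * Φ.co I ξ i)
    (h4 : ∀ I ∈ Φ.B, ∀ i ∈ I, Φ.co I ζ i ≠ 0 → 0 < Φ.co I ζ i * Φ.co I ξ' i) :
    GG Φ k ξ = GG Φ k ξ' := by
  classical
  set f : Finset ι → ℝ := fun I => ∏ i ∈ I, sg (Φ.co I ξ i) (k i) - ∏ i ∈ I, sg (Φ.co I ξ' i) (k i) with hf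
  set R : Finset ι → Finset ι → Prop := fun I J => ∃ σ u w, u ∉ σ ∧ w ∉ σ ∧ u ≠ w ∧ I = insert u σ ∧
    J = insert w σ ∧ I ∈ Φ.B ∧ J ∈ Φ.B ∧ Φ.co I ζ u = 0 with hR
  have Rsymm : ∀ I J, R I J → R J I := by
    rintro I J ⟨σ, u, w, hu, hw, huw, rfl, rfl, hI, hJ, h0⟩
    refine ⟨σ, w, u, hw, hu, huw.symm, rfl, rfl, hJ, hI, ?_⟩
    rw [co_trans hu hw hI hJ, h0, zero_mul]
  have Runiq : ∀ I J J', R I J → R I J' → J = J' := by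
    rintro I J J' ⟨σ, u, w, hu, hw, huw, rfl, rfl, hI, hJ, h0⟩ ⟨σ', u', w', hu', hw', huw', he, rfl, hI', hJ', h0'⟩
    have hmem : u' ∈ insert u σ := by rw [he]; exact Finset.mem_insert_self _ _
    have hueq : u = u' := hz _ hI u (Finset.mem_insert_self _ _) u' hmem h0 h0'
    subst hueq
    have hσ : σ = σ' := by
      have := congrArg (fun s => s.erase u) he
      simpa [Finset.erase_insert hu, Finset.erase_insert hu'] using this
    subst hσ
    rw [partner_unique hu hw hw' hI hJ hJ' huw.symm huw'.symm]
  have Rex : ∀ I ∈ Φ.B, (∃ u ∈ I, Φ.co I ζ u = 0) → ∃ J, R I J := by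
    rintro I hI ⟨u, hu, h0⟩
    have he : insert u (I.erase u) = I := Finset.insert_erase hu
    obtain ⟨w, hw, hwu, hJ⟩ := exists_partner (Finset.notMem_erase u I) (by rw [he]; exact hI)
    exact ⟨_, I.erase u, u, w, Finset.notMem_erase u I, hw, hwu.symm, he.symm, rfl, hI, hJ, h0⟩
  have Rcancel : ∀ I J, R I J → f I + f J = 0 := by
    rintro I J ⟨σ, u, w, hu, hw, huw, rfl, rfl, hI, hJ, h0⟩
    simp only [hf]
    rw [Finset.prod_insert hu, Finset.prod_insert hu, Finset.prod_insert hw, Finset.prod_insert hw]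
    have hnz : ∀ j ∈ σ, Φ.co (insert u σ) ζ j ≠ 0 := by
      intro j hj h
      have := hz _ hI u (Finset.mem_insert_self _ _) j (Finset.mem_insert_of_mem hj) h0 h
      subst this; exact hu hj
    have e1 : ∀ η : Fin N → ℝ, (∀ I ∈ Φ.B, ∀ i ∈ I, Φ.co I ζ i ≠ 0 → 0 < Φ.co I ζ i * Φ.co I η i) →
        ∏ i ∈ σ, sg (Φ.co (insert u σ) η i) (k i) = ∏ i ∈ σ, sg (Φ.co (insert u σ) ζ i) (k i) := by
      intro η hη
      refine Finset.prod_congr rfl fun j hj => (sg_congr (hη _ hI j (Finset.mem_insert_of_mem hj) (hnz j hj)) _).symm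
    have e2 : ∀ η : Fin N → ℝ, (∀ I ∈ Φ.B, ∀ i ∈ I, Φ.co I ζ i ≠ 0 → 0 < Φ.co I ζ i * Φ.co I η i) →
        ∏ i ∈ σ, sg (Φ.co (insert w σ) η i) (k i) = ∏ i ∈ σ, sg (Φ.co (insert u σ) ζ i) (k i) := by
      intro η hη
      refine Finset.prod_congr rfl fun j hj => ?_
      have := co_same hu hw hI hJ ζ h0 hj
      rw [← this]
      exact (sg_congr (hη _ hJ j (Finset.mem_insert_of_mem hj) (by rw [this]; exact hnz j hj)) _).symm
    rw [e1 ξ h3, e1 ξ' h4, e2 ξ h3, e2 ξ' h4, co_trans hu hw hI hJ ξ, co_trans hu hw hI hJ ξ']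
    have hα := opp hu hw hI hJ huw
    have := sg_cross (α := -Φ.co (insert w σ) (Φ.vec u) w) (by linarith)
      (h1 _ hI u (Finset.mem_insert_self _ _)) (h2 _ hI u (Finset.mem_insert_self _ _)) (hk u) (hk w)
    rw [neg_neg, mul_comm _ (Φ.co (insert u σ) ξ u), mul_comm _ (Φ.co (insert u σ) ξ' u)] at this
    linear_combination (∏ i ∈ σ, sg (Φ.co (insert u σ) ζ i) (k i)) * this
  have hz0 : ∀ I ∈ Φ.B, (¬ ∃ J, R I J) → f I = 0 := by
    intro I hI hn
    have hnz : ∀ j ∈ I, Φ.co I ζ j ≠ 0 := by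
      intro j hj h
      exact hn (Rex I hI ⟨j, hj, h⟩)
    simp only [hf]
    rw [sub_eq_zero]
    refine Finset.prod_congr rfl fun j hj => ?_
    rw [← sg_congr (h3 I hI j hj (hnz j hj)), ← sg_congr (h4 I hI j hj (hnz j hj))]
  have hsum : ∑ I ∈ Φ.B, f I = 0 := by
    refine Finset.sum_involution (fun I _ => if h : ∃ J, R I J then h.choose else I) ?_ ?_ ?_ ?_
    · intro I hI
      split_ifs with h
      · exact Rcancel _ _ h.choose_spec
      · rw [hz0 I hI h, add_zero]
    · intro I hI hne
      have h : ∃ J, R I J := by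
        by_contra h; exact hne (hz0 I hI h)
      simp only [dif_pos h]
      obtain ⟨σ, u, w, hu, hw, huw, he, he', _⟩ := h.choose_spec
      rw [he']
      intro h5
      rw [he] at h5
      have : w ∈ insert u σ := by rw [← h5]; exact Finset.mem_insert_self _ _
      rcases Finset.mem_insert.1 this with h | h
      · exact huw h.symm
      · exact hw h
    · intro I hI
      split_ifs with h
      · obtain ⟨σ, u, w, hu, hw, huw, he, he', _, hJ, _⟩ := h.choose_spec
        exact hJ
      · exact hI
    · intro I hI
      by_cases h : ∃ J, R I J
      · have h' : ∃ J', R h.choose J' := ⟨I, Rsymm _ _ h.choose_spec⟩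
        simp only [dif_pos h, dif_pos h']
        exact Runiq _ _ _ h'.choose_spec (Rsymm _ _ h.choose_spec)
      · simp only [dif_neg h]
  simp only [hf, Finset.sum_sub_distrib] at hsum
  exact sub_eq_zero.1 hsum

end Fan
end Esterov

open scoped Matrix
set_option linter.all false
namespace Esterov
namespace Fan
open Filter Topology
variable {N : ℕ} {ι : Type} [Fintype ι] [DecidableEq ι] {Φ : Fan N ι}

/-- generic covector -/
def Gen (Φ : Fan N ι) (ξ : Fin N → ℝ) : Prop := ∀ I ∈ Φ.B, ∀ i ∈ I, Φ.co I ξ i ≠ 0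

lemma loc_const (G : ℝ → ℝ) (h : ∀ t0, ∃ c, ∀ᶠ t in 𝓝[≠] t0, G t = c)
    (h0 : ∀ᶠ t in 𝓝[≠] 0, G t = G 0) (h1 : ∀ᶠ t in 𝓝[≠] 1, G t = G 1) : G 0 = G 1 := by
  choose g hg using h
  have uniq : ∀ t c, (∀ᶠ s in 𝓝[≠] t, G s = c) → g t = c := by
    intro t c hc
    obtain ⟨s, h1, h2⟩ := ((hg t).and hc).exists
    rw [← h1, h2]
  have hl : IsLocallyConstant g := by
    rw [IsLocallyConstant.iff_eventually_eq]
    intro t0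
    have h2 := eventually_eventually_nhdsWithin.2 (hg t0)
    have h3 : ∀ᶠ y in 𝓝[≠] t0, g y = g t0 := by
      filter_upwards [h2, self_mem_nhdsWithin] with y hy hne
      apply uniq
      have : 𝓝[≠] y ≤ 𝓝[≠] t0 ⊔ 𝓝[{t0}ᶜ] y := by
        refine le_sup_of_le_right ?_
        rw [IsOpen.nhdsWithin_eq isOpen_compl_singleton hne]
        exact nhdsWithin_le_nhds
      have h4 : 𝓝[≠] y ≤ 𝓝[{t0}ᶜ] y := by
        rw [IsOpen.nhdsWithin_eq isOpen_compl_singleton hne]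
        exact nhdsWithin_le_nhds
      exact h4 hy
    rw [eventually_nhdsWithin_iff] at h3
    filter_upwards [h3] with y hy
    by_cases hyt : y = t0
    · rw [hyt]
    · exact hy hyt
  rw [← uniq 0 _ h0, ← uniq 1 _ h1]
  exact hl.apply_eq_of_preconnectedSpace 0 1

lemma GG_const {k : ι → ℝ} (hk : ∀ u, k u ≠ 0) {ξ0 ξ1 : Fin N → ℝ} (h0 : Φ.Gen ξ0) (h1 : Φ.Gen ξ1)
    (hD : ∀ I ∈ Φ.B, ∀ i ∈ I, ∀ j ∈ I, i ≠ j →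
      Φ.co I ξ0 i * Φ.co I ξ1 j - Φ.co I ξ0 j * Φ.co I ξ1 i ≠ 0) :
    GG Φ k ξ0 = GG Φ k ξ1 := by
  set X : ℝ → Fin N → ℝ := fun t => (1 - t) • ξ0 + t • ξ1 with hX
  have cX : ∀ I t i, Φ.co I (X t) i = (1 - t) * Φ.co I ξ0 i + t * Φ.co I ξ1 i := by
    intro I t i; rw [hX]; simp only [co_add, co_smul]
  have hz : ∀ t, ∀ I ∈ Φ.B, ∀ i ∈ I, ∀ j ∈ I, Φ.co I (X t) i = 0 → Φ.co I (X t) j = 0 → i = j := by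
    intro t I hI i hi j hj e1 e2
    by_contra hne
    rw [cX] at e1 e2
    apply hD I hI i hi j hj hne
    have a1 : (1 - t) * (Φ.co I ξ0 i * Φ.co I ξ1 j - Φ.co I ξ0 j * Φ.co I ξ1 i) = 0 := by
      linear_combination Φ.co I ξ1 j * e1 - Φ.co I ξ1 i * e2
    have a2 : t * (Φ.co I ξ0 i * Φ.co I ξ1 j - Φ.co I ξ0 j * Φ.co I ξ1 i) = 0 := by
      linear_combination -Φ.co I ξ0 j * e1 + Φ.co I ξ0 i * e2
    linear_combination a1 + a2
  have ev1 : ∀ t0, ∀ᶠ t in 𝓝[≠] t0, ∀ I ∈ Φ.B, ∀ i ∈ I, Φ.co I (X t) i ≠ 0 ∧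
      (Φ.co I (X t0) i ≠ 0 → 0 < Φ.co I (X t0) i * Φ.co I (X t) i) := by
    intro t0
    rw [Finset.eventually_all]
    intro I hI
    rw [Finset.eventually_all]
    intro i hi
    by_cases hc : Φ.co I (X t0) i = 0
    · filter_upwards [self_mem_nhdsWithin] with t ht
      refine ⟨?_, fun h => absurd hc h⟩
      intro h2
      rw [cX] at hc h2
      have h3 : (t - t0) * (Φ.co I ξ1 i - Φ.co I ξ0 i) = 0 := by linear_combination h2 - hc
      rcases mul_eq_zero.1 h3 with h4 | h4
      · exact ht (sub_eq_zero.1 h4)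
      · have : Φ.co I ξ0 i = 0 := by linear_combination hc - t0 * h4
        exact h0 I hI i hi this
    · have hcont : Continuous (fun t => Φ.co I (X t0) i * Φ.co I (X t) i) := by
        simp only [cX]; fun_prop
      have h5 : 0 < Φ.co I (X t0) i * Φ.co I (X t0) i := mul_self_pos.2 hc
      have := (hcont.tendsto t0).eventually (lt_mem_nhds h5)
      filter_upwards [nhdsWithin_le_nhds this] with t ht
      exact ⟨fun h => by rw [h, mul_zero] at ht; exact lt_irrefl _ ht, fun _ => ht⟩
  have key := loc_const (fun t => GG Φ k (X t)) ?_ ?_ ?_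
  · have e0 : X 0 = ξ0 := by simp [hX]
    have e1 : X 1 = ξ1 := by simp [hX]
    simpa only [e0, e1] using key
  · intro t0
    obtain ⟨t1, ht1⟩ := (ev1 t0).exists
    refine ⟨GG Φ k (X t1), ?_⟩
    filter_upwards [ev1 t0] with t ht
    exact wall hk (hz t0) (fun I hI i hi => (ht I hI i hi).1) (fun I hI i hi => (ht1 I hI i hi).1)
      (fun I hI i hi => (ht I hI i hi).2) (fun I hI i hi => (ht1 I hI i hi).2)
  · have e0 : X 0 = ξ0 := by simp [hX]
    filter_upwards [ev1 0] with t ht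
    exact wall hk (hz 0) (fun I hI i hi => (ht I hI i hi).1) (by rw [e0]; exact h0)
      (fun I hI i hi => (ht I hI i hi).2) (fun I hI i hi h => mul_self_pos.2 h)
  · have e0 : X 1 = ξ1 := by simp [hX]
    filter_upwards [ev1 1] with t ht
    exact wall hk (hz 1) (fun I hI i hi => (ht I hI i hi).1) (by rw [e0]; exact h1)
      (fun I hI i hi => (ht I hI i hi).2) (fun I hI i hi h => mul_self_pos.2 h)

/-- `co` as a linear map -/
noncomputable def coL (Φ : Fan N ι) (I : Finset ι) (i : ι) : (Fin N → ℝ) →ₗ[ℝ] ℝ where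
  toFun ξ := Φ.co I ξ i
  map_add' := fun _ _ => co_add _ _ _ _
  map_smul' := fun _ _ => by simp [co_smul]

lemma exists_Gen : ∃ ξ, Φ.Gen ξ := by
  obtain ⟨g, hg⟩ := exists_generic (κ := {p : Finset ι × ι // p.1 ∈ Φ.B ∧ p.2 ∈ p.1})
    (fun p => Φ.coL p.1.1 p.1.2) (by
      rintro ⟨⟨I, i⟩, hI, hi⟩ h
      have h2 := LinearMap.congr_fun h (Φ.vec i)
      simp only [coL, LinearMap.coe_mk, AddHom.coe_mk, LinearMap.zero_apply] at h2
      rw [co_vec hI hi, if_pos rfl] at h2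
      exact one_ne_zero h2)
  exact ⟨g, fun I hI i hi => hg ⟨⟨I, i⟩, hI, hi⟩⟩

lemma GG_one {k : ι → ℝ} (hk : ∀ u, 0 < k u) {ξ : Fin N → ℝ} (h : Φ.Gen ξ) : GG Φ k ξ = 1 := by
  obtain ⟨I0, hI0, hc⟩ := Φ.cover ξ
  have hc' : ∀ i ∈ I0, 0 ≤ Φ.co I0 ξ i := hc
  unfold GG
  rw [Finset.sum_eq_single I0]
  · refine Finset.prod_eq_one fun i hi => ?_
    have : 0 < Φ.co I0 ξ i := lt_of_le_of_ne (hc i hi) (h I0 hI0 i hi).symm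
    simp [sg, this, hk i]
  · intro I hI hne
    by_contra hp
    rw [Finset.prod_eq_zero_iff] at hp
    push Not at hp
    have hpos : ∀ i ∈ I, 0 ≤ Φ.co I ξ i := by
      intro i hi
      by_contra hlt
      push Not at hlt
      apply hp i hi
      simp [sg, hlt.not_gt, (hk i).not_gt]
    have : ∃ i ∈ I, i ∉ I0 := by
      by_contra hcon
      push Not at hcon
      exact hne (Finset.eq_of_subset_of_card_le hcon (by rw [Φ.card_eq I hI, Φ.card_eq I0 hI0]))
    obtain ⟨i, hi, hi0⟩ := this
    exact h I hI i hi (P4 hI hI0 (Finset.empty_subset _) (Finset.empty_subset _) ξ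
      (fun i hi _ => hpos i hi) (fun i hi _ => hc i hi) i hi hi0)
  · intro hh; exact absurd hI0 hh

lemma ev_affine {α β : ℝ} (hβ : β ≠ 0) : ∀ᶠ δ in 𝓝[>] (0:ℝ), α + δ * β ≠ 0 := by
  have h1 : ∀ᶠ δ in 𝓝[≠] (0:ℝ), α + δ * β ≠ 0 := by
    by_cases hα : α = 0
    · filter_upwards [self_mem_nhdsWithin] with δ hδ
      rw [hα, zero_add]; exact mul_ne_zero hδ hβ
    · have : Continuous (fun δ : ℝ => α + δ * β) := by fun_prop
      refine nhdsWithin_le_nhds (this.continuousAt.eventually_ne ?_)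
      simpa using hα
  exact nhdsWithin_mono _ (fun x hx => ne_of_gt hx) h1

lemma GG_zero {k : ι → ℝ} (hk : ∀ u, k u ≠ 0) (hT : k ∈ Φ.Tb) {u : ι} (hu : k u < 0)
    {ξ : Fin N → ℝ} (h : Φ.Gen ξ) : GG Φ k ξ = 0 := by
  obtain ⟨g, hg⟩ := exists_generic
    (κ := {p : Finset ι × ι // p.1 ∈ Φ.B ∧ p.2 ∈ p.1} ⊕
      {p : Finset ι × ι × ι // p.1 ∈ Φ.B ∧ p.2.1 ∈ p.1 ∧ p.2.2 ∈ p.1 ∧ p.2.1 ≠ p.2.2})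
    (Sum.elim (fun p => Φ.coL p.1.1 p.1.2)
      (fun p => Φ.co p.1.1 ξ p.1.2.1 • Φ.coL p.1.1 p.1.2.2 - Φ.co p.1.1 ξ p.1.2.2 • Φ.coL p.1.1 p.1.2.1)) (by
      rintro (⟨⟨I, i⟩, hI, hi⟩ | ⟨⟨I, i, j⟩, hI, hi, hj, hij⟩) h1
      · have h2 := LinearMap.congr_fun h1 (Φ.vec i)
        simp only [Sum.elim_inl, coL, LinearMap.coe_mk, AddHom.coe_mk, LinearMap.zero_apply] at h2
        rw [co_vec hI hi, if_pos rfl] at h2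
        exact one_ne_zero h2
      · have h2 := LinearMap.congr_fun h1 (Φ.vec j)
        simp only [Sum.elim_inr, coL, LinearMap.sub_apply, LinearMap.smul_apply, LinearMap.coe_mk, AddHom.coe_mk, LinearMap.zero_apply] at h2
        simp only at hI hi hj hij
        rw [co_vec hI hj, if_pos rfl, co_vec hI hj, if_neg hij.symm] at h2
        simp at h2
        exact h I hI i hi h2)
  have g1 : ∀ I ∈ Φ.B, ∀ i ∈ I, Φ.co I g i ≠ 0 := fun I hI i hi => hg (Sum.inl ⟨⟨I, i⟩, hI, hi⟩)
  have g2 : ∀ I ∈ Φ.B, ∀ i ∈ I, ∀ j ∈ I, i ≠ j → Φ.co I ξ i * Φ.co I g j - Φ.co I ξ j * Φ.co I g i ≠ 0 :=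
    fun I hI i hi j hj hij => hg (Sum.inr ⟨⟨I, i, j⟩, hI, hi, hj, hij⟩)
  have E1 : ∀ᶠ δ in 𝓝[>] (0:ℝ), ∀ I ∈ Φ.B, ∀ i ∈ I, Φ.co I (Φ.vec u + δ • g) i ≠ 0 := by
    rw [Finset.eventually_all]; intro I hI
    rw [Finset.eventually_all]; intro i hi
    simp only [co_add, co_smul]
    exact ev_affine (g1 I hI i hi)
  have E2 : ∀ᶠ δ in 𝓝[>] (0:ℝ), ∀ I ∈ Φ.B, ∀ i ∈ I, ∀ j ∈ I, i ≠ j →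
      Φ.co I ξ i * Φ.co I (Φ.vec u + δ • g) j - Φ.co I ξ j * Φ.co I (Φ.vec u + δ • g) i ≠ 0 := by
    rw [Finset.eventually_all]; intro I hI
    rw [Finset.eventually_all]; intro i hi
    rw [Finset.eventually_all]; intro j hj
    rw [eventually_imp_distrib_left]; intro hij
    filter_upwards [ev_affine (α := Φ.co I ξ i * Φ.co I (Φ.vec u) j - Φ.co I ξ j * Φ.co I (Φ.vec u) i)
      (g2 I hI i hi j hj hij)] with δ hδ
    simp only [co_add, co_smul]
    intro h3; apply hδ; linear_combination h3
  have E3 : ∀ᶠ δ in 𝓝[>] (0:ℝ), ∀ I ∈ Φ.B, (Φ.vec u + δ • g) ⬝ᵥ Φ.v I k < 0 := by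
    rw [Finset.eventually_all]; intro I hI
    have hc : Continuous (fun δ : ℝ => (Φ.vec u + δ • g) ⬝ᵥ Φ.v I k) := by
      simp only [add_dotProduct, smul_dotProduct]; fun_prop
    refine nhdsWithin_le_nhds ((hc.tendsto 0).eventually (gt_mem_nhds ?_))
    simp
    exact (hT I hI u).trans_lt hu
  obtain ⟨δ, h1, h2, h3⟩ := (E1.and (E2.and E3)).exists
  rw [GG_const hk h h1 h2]
  unfold GG
  refine Finset.sum_eq_zero fun I hI => ?_
  by_contra hp
  rw [Finset.prod_eq_zero_iff] at hp
  push Not at hp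
  have h4 := h3 I hI
  rw [dot_expand hI] at h4
  refine absurd h4 (not_lt.2 (Finset.sum_nonneg fun i hi => ?_))
  rw [Φ.hv I hI i hi]
  have h5 := hp i hi
  unfold sg at h5
  split_ifs at h5 with h6 h7
  · exact (mul_pos h6.1 h6.2).le
  · exact (mul_pos_of_neg_of_neg h7.1 h7.2).le
  · exact absurd rfl h5

end Fan
end Esterov

open scoped Matrix
open Pointwise MeasureTheory
set_option linter.all false
namespace Esterov
namespace Fan
open Filter Topology
variable {N : ℕ} {ι : Type} [Fintype ι] [DecidableEq ι] {Φ : Fan N ι}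

/-- polytope -/
def P (Φ : Fan N ι) (h : ι → ℝ) : Set (Fin N → ℝ) := {x | ∀ u, Φ.vec u ⬝ᵥ x ≤ h u}

lemma P_le {h : ι → ℝ} {x : Fin N → ℝ} (hx : x ∈ Φ.P h) (ζ : Fin N → ℝ) :
    ∃ I ∈ Φ.B, ζ ⬝ᵥ x ≤ ζ ⬝ᵥ Φ.v I h := by
  obtain ⟨I, hI, hc⟩ := Φ.cover ζ
  refine ⟨I, hI, ?_⟩
  rw [dot_expand hI, dot_expand hI ζ (Φ.v I h)]
  refine Finset.sum_le_sum fun i hi => mul_le_mul_of_nonneg_left ?_ (hc i hi)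
  rw [Φ.hv I hI i hi]; exact hx i

lemma P_closed (h : ι → ℝ) : IsClosed (Φ.P h) := by
  unfold P
  simp only [Set.setOf_forall]
  exact isClosed_iInter fun u => isClosed_le (by fun_prop) continuous_const

lemma P_bdd (h : ι → ℝ) : Bornology.IsBounded (Φ.P h) := by
  classical
  set M : ℝ := ∑ I ∈ Φ.B, ∑ j, |(Φ.v I h) j| with hM
  rw [isBounded_iff_forall_norm_le]
  have hb : ∀ I ∈ Φ.B, ∀ j, |(Φ.v I h) j| ≤ M := by
    intro I hI j
    refine le_trans ?_ (Finset.single_le_sum (f := fun I => ∑ j, |(Φ.v I h) j|)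
      (fun I _ => Finset.sum_nonneg fun j _ => abs_nonneg _) hI)
    exact Finset.single_le_sum (f := fun j => |(Φ.v I h) j|) (fun j _ => abs_nonneg _) (Finset.mem_univ j)
  refine ⟨M, fun x hx => ?_⟩
  have hM0 : 0 ≤ M := Finset.sum_nonneg fun I _ => Finset.sum_nonneg fun j _ => abs_nonneg _
  rw [pi_norm_le_iff_of_nonneg hM0]
  intro j
  rw [Real.norm_eq_abs, abs_le]
  constructor
  · obtain ⟨I, hI, h1⟩ := P_le hx (-Pi.single j 1)
    simp at h1
    have := hb I hI j
    have h2 := neg_abs_le ((Φ.v I h) j)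
    linarith
  · obtain ⟨I, hI, h1⟩ := P_le hx (Pi.single j 1)
    simp at h1
    have := hb I hI j
    have h2 := le_abs_self ((Φ.v I h) j)
    linarith

/-- cone piece -/
def Dp (Φ : Fan N ι) (ξ : Fin N → ℝ) (I : Finset ι) : Set (Fin N → ℝ) :=
  {y | (∀ i ∈ I, Φ.co I ξ i * (Φ.vec i ⬝ᵥ y) < 0) ∧ -(ξ ⬝ᵥ y) ≤ 1}

lemma Dp_meas (ξ : Fin N → ℝ) (I : Finset ι) : MeasurableSet (Φ.Dp ξ I) := by
  unfold Dp
  refine MeasurableSet.inter (s₁ := {y | ∀ i ∈ I, Φ.co I ξ i * (Φ.vec i ⬝ᵥ y) < 0})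
    (s₂ := {y | -(ξ ⬝ᵥ y) ≤ 1}) ?_ ?_
  · have : {y | ∀ i ∈ I, Φ.co I ξ i * (Φ.vec i ⬝ᵥ y) < 0} = ⋂ i ∈ I, {y | Φ.co I ξ i * (Φ.vec i ⬝ᵥ y) < 0} := by
      ext y; simp
    rw [this]
    exact I.measurableSet_biInter fun i _ => (isOpen_lt (by fun_prop) continuous_const).measurableSet
  · exact (isClosed_le (by fun_prop) continuous_const).measurableSet

lemma Dp_fin {ξ : Fin N → ℝ} (hξ : Φ.Gen ξ) {I : Finset ι} (hI : I ∈ Φ.B) :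
    volume (Φ.Dp ξ I) < ⊤ := by
  apply Bornology.IsBounded.measure_lt_top
  rw [isBounded_iff_forall_norm_le]
  refine ⟨∑ i ∈ I, |Φ.co I ξ i|⁻¹ * ‖Φ.v I (ev i)‖, fun y hy => ?_⟩
  rw [x_expand hI y]
  refine (norm_sum_le _ _).trans (Finset.sum_le_sum fun i hi => ?_)
  rw [norm_smul]
  refine mul_le_mul_of_nonneg_right ?_ (norm_nonneg _)
  have hne := abs_pos.2 (hξ I hI i hi)
  rw [Real.norm_eq_abs, ← one_div, le_div_iff₀ hne, ← abs_mul, mul_comm, abs_of_neg (hy.1 i hi)]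
  refine le_trans ?_ hy.2
  rw [dot_expand hI ξ y, ← Finset.sum_neg_distrib]
  exact Finset.single_le_sum (f := fun i => -(Φ.co I ξ i * (Φ.vec i ⬝ᵥ y)))
    (fun i hi => by have := hy.1 i hi; linarith) hi

lemma Dp_pos {ξ : Fin N → ℝ} (hξ : Φ.Gen ξ) {I : Finset ι} (hI : I ∈ Φ.B) :
    0 < volume (Φ.Dp ξ I) := by
  set U : Set (Fin N → ℝ) := {y | (∀ i ∈ I, Φ.co I ξ i * (Φ.vec i ⬝ᵥ y) < 0) ∧ -(ξ ⬝ᵥ y) < 1} with hU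
  have hUo : IsOpen U := by
    have : U = (⋂ i ∈ I, {y | Φ.co I ξ i * (Φ.vec i ⬝ᵥ y) < 0}) ∩ {y | -(ξ ⬝ᵥ y) < 1} := by
      ext y; simp [hU]
    rw [this]
    exact (isOpen_biInter_finset fun i _ => isOpen_lt (by fun_prop) continuous_const).inter
      (isOpen_lt (by fun_prop) continuous_const)
  have hUne : U.Nonempty := by
    set y0 := Φ.v I (fun i => - Φ.co I ξ i) with hy0
    have e : ∀ i ∈ I, Φ.vec i ⬝ᵥ y0 = - Φ.co I ξ i := fun i hi => Φ.hv I hI i hi _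
    set M := -(ξ ⬝ᵥ y0) with hM
    have hM0 : 0 ≤ M := by
      rw [hM, dot_expand hI, ← Finset.sum_neg_distrib]
      refine Finset.sum_nonneg fun i hi => ?_
      rw [e i hi]; nlinarith [mul_self_nonneg (Φ.co I ξ i)]
    refine ⟨(M + 1)⁻¹ • y0, fun i hi => ?_, ?_⟩
    · rw [dotProduct_smul, e i hi, smul_eq_mul]
      have h1 := mul_self_pos.2 (hξ I hI i hi)
      have h2 : 0 < (M + 1)⁻¹ := by positivity
      nlinarith [mul_pos h1 h2]
    · rw [dotProduct_smul, smul_eq_mul, ← mul_neg, ← hM, inv_mul_lt_iff₀ (by positivity)]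
      linarith
  refine (hUo.measure_pos volume hUne).trans_le (measure_mono ?_)
  rintro y ⟨h1, h2⟩; exact ⟨h1, h2.le⟩

/-- sign -/
noncomputable def eps (Φ : Fan N ι) (ξ : Fin N → ℝ) (I : Finset ι) : ℝ :=
  ∏ i ∈ I, (if 0 < Φ.co I ξ i then 1 else -1)

/-- Lawrence coefficient -/
noncomputable def aa (Φ : Fan N ι) (ξ : Fin N → ℝ) (I : Finset ι) : ℝ :=
  Φ.eps ξ I * volume.real (Φ.Dp ξ I)

lemma aa_pos {ξ : Fin N → ℝ} (hξ : Φ.Gen ξ) {I : Finset ι} (hI : I ∈ Φ.B) :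
    0 < Φ.aa ξ I * ∏ i ∈ I, Φ.co I ξ i := by
  have h1 : 0 < volume.real (Φ.Dp ξ I) :=
    ENNReal.toReal_pos (Dp_pos hξ hI).ne' (Dp_fin hξ hI).ne
  have h2 : 0 < Φ.eps ξ I * ∏ i ∈ I, Φ.co I ξ i := by
    rw [eps, ← Finset.prod_mul_distrib]
    refine Finset.prod_pos fun i hi => ?_
    rcases lt_or_gt_of_ne (hξ I hI i hi) with h | h
    · rw [if_neg h.not_gt]; linarith
    · rw [if_pos h]; linarith
  have := mul_pos h1 h2
  rw [aa]; linarith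

lemma prod_sg {ξ : Fin N → ℝ} (hξ : Φ.Gen ξ) {I : Finset ι} (hI : I ∈ Φ.B) {k : ι → ℝ} (hk : ∀ u, k u ≠ 0)
    [Decidable (∀ i ∈ I, 0 < Φ.co I ξ i * k i)] :
    ∏ i ∈ I, sg (Φ.co I ξ i) (k i) = Φ.eps ξ I * (if ∀ i ∈ I, 0 < Φ.co I ξ i * k i then 1 else 0) := by
  split_ifs with h
  · rw [mul_one, eps]
    refine Finset.prod_congr rfl fun i hi => ?_
    rcases pos_and_pos_or_neg_and_neg_of_mul_pos (h i hi) with ⟨h1, h2⟩ | ⟨h1, h2⟩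
    · simp [sg, h1, h2]
    · simp [sg, h1, h2, h1.not_gt]
  · push Not at h
    obtain ⟨i, hi, h⟩ := h
    rw [mul_zero]
    refine Finset.prod_eq_zero hi ?_
    unfold sg
    rw [if_neg, if_neg]
    · rintro ⟨h1, h2⟩; nlinarith
    · rintro ⟨h1, h2⟩; nlinarith

lemma hyper_null {h : ι → ℝ} (hh : h ∈ Φ.T) (u : ι) : ∀ᵐ x : Fin N → ℝ, h u - Φ.vec u ⬝ᵥ x ≠ 0 := by
  by_cases hv : Φ.vec u = 0
  · obtain ⟨I, hI⟩ := exists_B (Φ := Φ)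
    have hu : u ∉ I := by
      intro hu
      have := Φ.hv I hI u hu (ev u)
      rw [hv] at this
      simp [ev] at this
    have := hh I hI u hu
    rw [hv, zero_dotProduct] at this
    refine Filter.Eventually.of_forall fun x => ?_
    rw [hv, zero_dotProduct, sub_zero]; exact this.ne'
  · rw [ae_iff]
    have hne : Φ.vec u ⬝ᵥ Φ.vec u ≠ 0 := fun h => hv (dotProduct_self_eq_zero.1 h)
    set x0 := (h u / (Φ.vec u ⬝ᵥ Φ.vec u)) • Φ.vec u with hx0
    have e0 : Φ.vec u ⬝ᵥ x0 = h u := by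
      rw [hx0, dotProduct_smul, smul_eq_mul, div_mul_cancel₀ _ hne]
    set W : Submodule ℝ (Fin N → ℝ) := LinearMap.ker ((Fintype.linearCombination ℝ (Φ.vec u))) with hW
    have hWm : ∀ x, x ∈ W ↔ Φ.vec u ⬝ᵥ x = 0 := by
      intro x
      rw [hW, LinearMap.mem_ker, Fintype.linearCombination_apply, dotProduct]
      simp only [smul_eq_mul, mul_comm]
    have hWt : W ≠ ⊤ := by
      intro h; exact hne ((hWm _).1 (h ▸ Submodule.mem_top))
    have h0 := Measure.addHaar_submodule volume W hWt
    have : {x | ¬ (h u - Φ.vec u ⬝ᵥ x ≠ 0)} = (fun x => x + (-x0)) ⁻¹' (W : Set (Fin N → ℝ)) := by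
      ext x
      simp only [Set.mem_setOf_eq, Set.mem_preimage, SetLike.mem_coe, hWm, not_not]
      rw [dotProduct_add, dotProduct_neg, e0]
      constructor <;> intro h <;> linarith
    rw [this, measure_preimage_add_right]
    exact h0

lemma vol_piece {ξ : Fin N → ℝ} {I : Finset ι} (hI : I ∈ Φ.B) (h : ι → ℝ) {s : ℝ}
    (hs : s < ξ ⬝ᵥ Φ.v I h) :
    volume {x | (∀ i ∈ I, 0 < Φ.co I ξ i * (h i - Φ.vec i ⬝ᵥ x)) ∧ s ≤ ξ ⬝ᵥ x} =
      ENNReal.ofReal ((ξ ⬝ᵥ Φ.v I h - s) ^ N) * volume (Φ.Dp ξ I) := by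
  set σ := ξ ⬝ᵥ Φ.v I h - s with hσ
  have hσ0 : 0 < σ := sub_pos.2 hs
  have e1 : {x | (∀ i ∈ I, 0 < Φ.co I ξ i * (h i - Φ.vec i ⬝ᵥ x)) ∧ s ≤ ξ ⬝ᵥ x} =
      (fun x => x + (-Φ.v I h)) ⁻¹' (σ • Φ.Dp ξ I) := by
    ext x
    simp only [Set.mem_setOf_eq, Set.mem_preimage]
    rw [Set.mem_smul_set_iff_inv_smul_mem₀ hσ0.ne']
    simp only [Dp, Set.mem_setOf_eq, dotProduct_smul, dotProduct_add, dotProduct_neg, smul_eq_mul]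
    refine and_congr (forall_congr' fun i => forall_congr' fun hi => ?_) ?_
    · rw [Φ.hv I hI i hi]
      have h2 : 0 < σ⁻¹ := inv_pos.2 hσ0
      have : Φ.co I ξ i * (σ⁻¹ * (Φ.vec i ⬝ᵥ x + -h i)) = -(σ⁻¹ * (Φ.co I ξ i * (h i - Φ.vec i ⬝ᵥ x))) := by ring
      rw [this, neg_lt_zero, mul_pos_iff_of_pos_left h2]
    · rw [← mul_neg, inv_mul_le_iff₀ hσ0, hσ]
      constructor <;> intro h <;> linarith
  rw [e1, measure_preimage_add_right, Measure.addHaar_smul]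
  simp [abs_of_pos hσ0]

lemma lawrence {ξ : Fin N → ℝ} (hξ : Φ.Gen ξ) {h : ι → ℝ} (hh : h ∈ Φ.T) {s : ℝ}
    (hs : ∀ I ∈ Φ.B, s < ξ ⬝ᵥ Φ.v I h) :
    volume.real (Φ.P h) = ∑ I ∈ Φ.B, Φ.aa ξ I * (ξ ⬝ᵥ Φ.v I h - s) ^ N := by
  classical
  set D : Finset ι → Set (Fin N → ℝ) := fun I =>
    {x | (∀ i ∈ I, 0 < Φ.co I ξ i * (h i - Φ.vec i ⬝ᵥ x)) ∧ s ≤ ξ ⬝ᵥ x} with hD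
  have hDm : ∀ I, MeasurableSet (D I) := by
    intro I
    have : D I = (⋂ i ∈ I, {x | 0 < Φ.co I ξ i * (h i - Φ.vec i ⬝ᵥ x)}) ∩ {x | s ≤ ξ ⬝ᵥ x} := by
      ext x; simp [hD]
    rw [this]
    exact (I.measurableSet_biInter fun i _ => (isOpen_lt continuous_const (by fun_prop)).measurableSet).inter
      (isClosed_le continuous_const (by fun_prop)).measurableSet
  have hDv : ∀ I ∈ Φ.B, volume.real (D I) = (ξ ⬝ᵥ Φ.v I h - s) ^ N * volume.real (Φ.Dp ξ I) := by
    intro I hI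
    rw [Measure.real, hD, vol_piece hI h (hs I hI), ENNReal.toReal_mul, ENNReal.toReal_ofReal]
    · rfl
    · exact pow_nonneg (sub_pos.2 (hs I hI)).le _
  have hDf : ∀ I ∈ Φ.B, volume (D I) ≠ ⊤ := by
    intro I hI
    rw [hD, vol_piece hI h (hs I hI)]
    exact ENNReal.mul_ne_top ENNReal.ofReal_ne_top (Dp_fin hξ hI).ne
  have hPm : MeasurableSet (Φ.P h) := (P_closed h).measurableSet
  have hIntg : ∫ x, (Φ.P h).indicator (1 : (Fin N → ℝ) → ℝ) x =
      ∫ x, ∑ I ∈ Φ.B, Φ.eps ξ I * (D I).indicator (1 : (Fin N → ℝ) → ℝ) x := by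
    refine integral_congr_ae ?_
    filter_upwards [ae_all_iff.2 (hyper_null hh)] with x hx
    set k : ι → ℝ := fun u => h u - Φ.vec u ⬝ᵥ x with hk
    have hkT : k ∈ Φ.Tb := by
      have : k = h + Φ.ell (-x) := by
        ext u; simp [hk, ell, sub_eq_add_neg]
      rw [this]; exact Tb_add (T_sub_Tb hh) (ell_Tb _)
    by_cases hsx : s ≤ ξ ⬝ᵥ x
    · have e1 : ∑ I ∈ Φ.B, Φ.eps ξ I * (D I).indicator (1 : (Fin N → ℝ) → ℝ) x = GG Φ k ξ := by
        refine Finset.sum_congr rfl fun I hI => ?_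
        rw [prod_sg hξ hI hx, Set.indicator_apply]
        simp [hD, hsx, hk]
      rw [e1]
      by_cases hxP : x ∈ Φ.P h
      · rw [Set.indicator_of_mem hxP, GG_one _ hξ]
        · rfl
        · intro u
          exact lt_of_le_of_ne (sub_nonneg.2 (hxP u)) (hx u).symm
      · rw [Set.indicator_of_notMem hxP]
        simp only [P, Set.mem_setOf_eq, not_forall, not_le] at hxP
        obtain ⟨u, hu⟩ := hxP
        rw [GG_zero hx hkT (u := u) (sub_neg.2 hu) hξ]
    · rw [Set.indicator_of_notMem, Finset.sum_eq_zero]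
      · intro I hI
        rw [Set.indicator_of_notMem, mul_zero]
        intro h; exact hsx h.2
      · intro hxP
        obtain ⟨I, hI, h1⟩ := P_le hxP (-ξ)
        simp only [neg_dotProduct, neg_le_neg_iff] at h1
        exact hsx ((hs I hI).le.trans h1)
  rw [integral_indicator_one hPm] at hIntg
  rw [hIntg, integral_finset_sum]
  · refine Finset.sum_congr rfl fun I hI => ?_
    rw [integral_const_mul, integral_indicator_one (hDm I), hDv I hI, aa]; ring
  · intro I hI
    refine Integrable.const_mul ?_ _
    exact (integrable_indicator_iff (hDm I)).2 
      (integrableOn_const (C := (1:ℝ)) (hDf I hI))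

lemma lawrence_all {ξ : Fin N → ℝ} (hξ : Φ.Gen ξ) {h : ι → ℝ} (hh : h ∈ Φ.T) (s : ℝ) :
    volume.real (Φ.P h) = ∑ I ∈ Φ.B, Φ.aa ξ I * (ξ ⬝ᵥ Φ.v I h - s) ^ N := by
  set p : Polynomial ℝ := ∑ I ∈ Φ.B, Polynomial.C (Φ.aa ξ I) * (Polynomial.C (ξ ⬝ᵥ Φ.v I h) - Polynomial.X) ^ N with hp
  have hpe : ∀ s, p.eval s = ∑ I ∈ Φ.B, Φ.aa ξ I * (ξ ⬝ᵥ Φ.v I h - s) ^ N := by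
    intro s; simp [hp, Polynomial.eval_finset_sum]
  have : Polynomial.C (volume.real (Φ.P h)) = p := by
    apply Polynomial.eq_of_infinite_eval_eq
    have hev : ∃ s0 : ℝ, ∀ s < s0, ∀ I ∈ Φ.B, s < ξ ⬝ᵥ Φ.v I h := by
      refine ⟨-∑ I ∈ Φ.B, |ξ ⬝ᵥ Φ.v I h|, fun s hs I hI => ?_⟩
      have h1 := Finset.single_le_sum (f := fun I => |ξ ⬝ᵥ Φ.v I h|) (fun _ _ => abs_nonneg _) hI
      have h2 := neg_abs_le (ξ ⬝ᵥ Φ.v I h)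
      linarith
    obtain ⟨s0, hs0⟩ := hev
    refine (Set.Iio_infinite s0).mono fun s hs => ?_
    simp only [Set.mem_setOf_eq, hpe, Polynomial.eval_C]
    exact lawrence hξ hh (hs0 s hs)
  rw [← hpe, ← this, Polynomial.eval_C]

lemma lawrence_der (hN : 0 < N) {ξ : Fin N → ℝ} (hξ : Φ.Gen ξ) {h : ι → ℝ} (hh : h ∈ Φ.T) :
    ∑ I ∈ Φ.B, Φ.aa ξ I * (ξ ⬝ᵥ Φ.v I h) ^ (N - 1) = 0 := by
  have h1 : HasDerivAt (fun s : ℝ => ∑ I ∈ Φ.B, Φ.aa ξ I * (ξ ⬝ᵥ Φ.v I h - s) ^ N)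
      (∑ I ∈ Φ.B, Φ.aa ξ I * ((N : ℝ) * (ξ ⬝ᵥ Φ.v I h - 0) ^ (N - 1) * (-1))) 0 := by
    refine HasDerivAt.fun_sum fun I _ => HasDerivAt.const_mul _ ?_
    exact ((hasDerivAt_id (0:ℝ)).const_sub (ξ ⬝ᵥ Φ.v I h)).pow N
  have h2 : (fun s : ℝ => ∑ I ∈ Φ.B, Φ.aa ξ I * (ξ ⬝ᵥ Φ.v I h - s) ^ N) = fun _ => volume.real (Φ.P h) := by
    ext s; exact (lawrence_all hξ hh s).symm
  rw [h2] at h1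
  have h3 := h1.unique (hasDerivAt_const 0 _)
  have h4 : (-(N:ℝ)) * ∑ I ∈ Φ.B, Φ.aa ξ I * (ξ ⬝ᵥ Φ.v I h) ^ (N - 1) = 0 := by
    rw [← h3, Finset.mul_sum]
    refine Finset.sum_congr rfl fun I _ => ?_
    rw [sub_zero]; ring
  rcases mul_eq_zero.1 h4 with h | h
  · exfalso; simp at h; omega
  · exact h

end Fan
end Esterov

open scoped Matrix
open Pointwise MeasureTheory
set_option linter.all false
namespace Esterov
namespace Fan
open Filter Topology
variable {N : ℕ} {ι : Type} [Fintype ι] [DecidableEq ι] {Φ : Fan N ι}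

/-- untruncated coefficients -/
noncomputable def c2 (Φ : Fan N ι) (ξ : Fin N → ℝ) (l : List ι) : ℝ :=
  ∑ I ∈ Φ.B, Φ.aa ξ I * (l.map (Φ.co I ξ)).prod

lemma c2_perm (ξ : Fin N → ℝ) : PermInv (Φ.c2 ξ) := by
  intro l l' h
  unfold c2
  refine Finset.sum_congr rfl fun I _ => ?_
  rw [(h.map _).prod_eq]

lemma v_dot (I : Finset ι) (ξ : Fin N → ℝ) (x : ι → ℝ) :
    ξ ⬝ᵥ Φ.v I x = ∑ u, x u * Φ.co I ξ u := by
  have : x = ∑ u, x u • ev u := by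
    ext w; simp [ev, Finset.sum_apply, Pi.single_apply]
  conv_lhs => rw [this]
  rw [map_sum, dotProduct_sum]
  refine Finset.sum_congr rfl fun u _ => ?_
  rw [map_smul, dotProduct_smul, co, smul_eq_mul]

lemma Phi_prod (f : ι → ℝ) (L : List (ι → ℝ)) :
    Phi (fun l => (l.map f).prod) L = (L.map (fun x => ∑ u, x u * f u)).prod := by
  induction L with
  | nil => rfl
  | cons x L ih =>
    rw [Phi_cons]
    simp only [List.map_cons, List.prod_cons, Phi_smul_coef, ih]
    rw [Finset.sum_mul]
    refine Finset.sum_congr rfl fun u _ => ?_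
    ring

lemma Phi_c2 (ξ : Fin N → ℝ) (L : List (ι → ℝ)) :
    Phi (Φ.c2 ξ) L = ∑ I ∈ Φ.B, Φ.aa ξ I * (L.map (fun x => ξ ⬝ᵥ Φ.v I x)).prod := by
  unfold c2
  rw [Phi_sum_coef]
  refine Finset.sum_congr rfl fun I _ => ?_
  rw [Phi_smul_coef, Phi_prod]
  simp only [v_dot]

lemma co_notMem {I : Finset ι} (hI : I ∈ Φ.B) (ξ : Fin N → ℝ) {k : ι} (hk : k ∉ I) : Φ.co I ξ k = 0 := by
  have : Φ.v I (ev k) = 0 := by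
    apply Φ.uniq I hI
    intro i hi
    rw [Φ.hv I hI i hi]
    have : i ≠ k := by rintro rfl; exact hk hi
    simp [ev, this]
  rw [co, this, dotProduct_zero]

lemma exists_T_add (y : ι → ℝ) : ∃ M : ℝ, 0 < M ∧ M • Φ.h0 + y ∈ Φ.T := by
  have : ∀ᶠ M : ℝ in atTop, 0 < M ∧ ∀ I ∈ Φ.B, ∀ j : ι, j ∉ I → 0 < Φ.gap (M • Φ.h0 + y) I j := by
    refine (eventually_gt_atTop 0).and ?_
    rw [Finset.eventually_all]; intro I hI
    rw [eventually_all]; intro j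
    rw [eventually_imp_distrib_left]; intro hj
    simp only [gap_add, gap_smul]
    have hg := gap_pos h0T hI hj
    exact (tendsto_atTop_add_const_right _ _ (tendsto_id.atTop_mul_const hg)).eventually_gt_atTop 0
  obtain ⟨M, h1, h2⟩ := this.exists
  exact ⟨M, h1, mem_T_iff.2 h2⟩

lemma T_add {h k : ι → ℝ} (hh : h ∈ Φ.T) (hk : k ∈ Φ.T) : h + k ∈ Φ.T := Tb_add_T (T_sub_Tb hh) hk

lemma dd_zero_T (F : (ι → ℝ) → ℝ) (hF : ∀ h ∈ Φ.T, F h = 0) (xs : List (ι → ℝ)) (hxs : ∀ x ∈ xs, x ∈ Φ.T) :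
    ∀ h ∈ Φ.T, dd F xs h = 0 := by
  induction xs with
  | nil => exact hF
  | cons x xs ih =>
    intro h hh
    have ih' := ih fun y hy => hxs y (List.mem_cons_of_mem _ hy)
    rw [dd_cons, ih' h hh, ih' (h + x) (T_add hh (hxs x (by simp))), sub_zero]

lemma c2_zero (hN : 0 < N) {ξ : Fin N → ℝ} (hξ : Φ.Gen ξ) (l : List ι) (hl : l.length = N - 1) :
    Φ.c2 ξ l = 0 := by
  have h1 : ∀ xs : List (ι → ℝ), (∀ x ∈ xs, x ∈ Φ.T) → xs.length = N - 1 → Phi (Φ.c2 ξ) xs = 0 := by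
    intro xs hxs hlen
    have h2 := dd_Phi_pow (c2_perm (Φ := Φ) ξ) xs (N - 1) [] Φ.h0 hlen.ge
    rw [if_pos hlen.symm, dd_zero_T _ _ xs hxs _ h0T] at h2
    · simp only [List.append_nil] at h2
      rcases mul_eq_zero.1 h2.symm with h3 | h3
      · exact absurd h3 (by positivity)
      · exact h3
    · intro h hh
      rw [List.append_nil, Phi_c2]
      simp only [List.map_replicate, List.prod_replicate]
      exact lawrence_der hN hξ hh
  have h2 : ∀ ys xs : List (ι → ℝ), (∀ x ∈ xs, x ∈ Φ.T) → (ys ++ xs).length = N - 1 → Phi (Φ.c2 ξ) (ys ++ xs) = 0 := by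
    intro ys
    induction ys with
    | nil => exact h1
    | cons y ys ih =>
      intro xs hxs hlen
      obtain ⟨M, hM, hMT⟩ := exists_T_add (Φ := Φ) y
      have e : y = (M • Φ.h0 + y) - M • Φ.h0 := by simp
      have hz : ∀ z ∈ Φ.T, Phi (Φ.c2 ξ) (z :: (ys ++ xs)) = 0 := by
        intro z hz
        rw [← Phi_middle (c2_perm ξ)]
        apply ih
        · intro x hx
          rcases List.mem_cons.1 hx with rfl | hx
          · exact hz
          · exact hxs x hx
        · simp at hlen ⊢; omega
      rw [List.cons_append, e, Phi_sub, hz _ hMT, hz _ (T_smul h0T hM), sub_zero]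
  have h3 := h2 (l.map ev) [] (by simp) (by simpa using hl)
  rw [Coef.Phi_map_ev] at h3
  simpa [Phi_nil] using h3

/-- the coefficient system of a fan -/
noncomputable def mkCoef (Φ : Fan N ι) (hN : 0 < N) {ξ : Fin N → ℝ} (hξ : Φ.Gen ξ) : Coef Φ where
  c := fun l => if l.length = N then (N.factorial : ℝ) * Φ.c2 ξ l else 0
  perm := by
    intro l l' h
    simp only [h.length_eq, c2_perm ξ l l' h]
  len := by
    intro l hl; rw [if_neg hl]
  face := by
    intro l hl
    split_ifs with h
    · rw [c2, Finset.sum_eq_zero, mul_zero]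
      intro I hI
      have : ∃ k ∈ l, k ∉ I := by
        by_contra hcon
        push Not at hcon
        exact hl ⟨I, hI, fun k hk => hcon k (List.mem_toFinset.1 hk)⟩
      obtain ⟨k, hk, hkI⟩ := this
      rw [List.prod_eq_zero (List.mem_map.2 ⟨k, hk, co_notMem hI ξ hkI⟩), mul_zero]
    · rfl
  pos := by
    intro l hl hB
    have hlen : l.length = N := by
      rw [← Φ.card_eq _ hB, List.toFinset_card_of_nodup hl]
    rw [if_pos hlen]
    refine mul_pos (by positivity) ?_
    rw [c2, Finset.sum_eq_single l.toFinset]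
    · have := aa_pos hξ hB
      rwa [List.prod_toFinset _ hl] at this
    · intro I hI hne
      have : ∃ k ∈ l, k ∉ I := by
        by_contra hcon
        push Not at hcon
        refine hne (Finset.eq_of_subset_of_card_le (fun k hk => hcon k (List.mem_toFinset.1 hk)) ?_).symm
        rw [Φ.card_eq I hI, Φ.card_eq _ hB]
      obtain ⟨k, hk, hkI⟩ := this
      rw [List.prod_eq_zero (List.mem_map.2 ⟨k, hk, co_notMem hI ξ hkI⟩), mul_zero]
    · intro h; exact absurd hB h
  ker := by
    intro x l
    by_cases hl : l.length = N - 1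
    · have hl' : ∀ u : ι, (u :: l).length = N := by intro u; simp [hl]; omega
      simp only [hl', if_true, c2, List.map_cons, List.prod_cons]
      have h1 : ∑ u, (Φ.vec u ⬝ᵥ x) * ((N.factorial : ℝ) * ∑ I ∈ Φ.B, Φ.aa ξ I * (Φ.co I ξ u * (l.map (Φ.co I ξ)).prod))
          = N.factorial * ∑ I ∈ Φ.B, Φ.aa ξ I * ((∑ u, Φ.ell x u * Φ.co I ξ u) * (l.map (Φ.co I ξ)).prod) := by
        simp only [Finset.mul_sum, Finset.sum_mul]
        rw [Finset.sum_comm]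
        refine Finset.sum_congr rfl fun I _ => Finset.sum_congr rfl fun u _ => ?_
        simp only [ell]; ring
      rw [h1]
      have h2 : ∑ I ∈ Φ.B, Φ.aa ξ I * ((∑ u, Φ.ell x u * Φ.co I ξ u) * (l.map (Φ.co I ξ)).prod)
          = (ξ ⬝ᵥ x) * Φ.c2 ξ l := by
        rw [c2, Finset.mul_sum]
        refine Finset.sum_congr rfl fun I hI => ?_
        rw [← v_dot, v_ell hI]; ring
      rw [h2, c2_zero hN hξ l hl, mul_zero, mul_zero]
    · refine Finset.sum_eq_zero fun u _ => ?_
      rw [if_neg, mul_zero]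
      simp; omega

lemma vol_T (hN : 0 < N) {ξ : Fin N → ℝ} (hξ : Φ.Gen ξ) {h : ι → ℝ} (hh : h ∈ Φ.T) :
    Phi (mkCoef Φ hN hξ).c (List.replicate N h) = N.factorial * volume.real (Φ.P h) := by
  have : Phi (mkCoef Φ hN hξ).c (List.replicate N h) =
      Phi (fun l => (N.factorial : ℝ) * Φ.c2 ξ l) (List.replicate N h) := by
    apply Phi_congr_len
    intro l hl
    rw [List.length_replicate] at hl
    simp [mkCoef, hl]
  rw [this, Phi_smul_coef, Phi_c2, lawrence_all hξ hh 0]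
  simp

lemma exists_Coef (hN : 0 < N) (Φ : Fan N ι) : ∃ C : Coef Φ, ∀ h ∈ Φ.Tb,
    Phi C.c (List.replicate N h) = N.factorial * volume.real (Φ.P h) := by
  obtain ⟨ξ, hξ⟩ := exists_Gen (Φ := Φ)
  refine ⟨mkCoef Φ hN hξ, fun h hh => ?_⟩
  obtain ⟨y, -, hy⟩ := Coef.shift_pos (Φ := Φ) face_empty h0T
  set k : ι → ℝ := fun u => Φ.h0 u - Φ.vec u ⬝ᵥ y with hk
  have hkpos : ∀ u, 0 < k u := fun u => hy u (by simp)
  have hkT : k ∈ Φ.T := by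
    have : k = Φ.ell (-y) + Φ.h0 := by
      ext u; simp [hk, ell]; ring
    rw [this]; exact Tb_add_T (ell_Tb _) h0T
  set δ : ℕ → ℝ := fun n => 1 / ((n : ℝ) + 1) with hδ
  have hδ0 : ∀ n, 0 < δ n := fun n => by simp only [hδ]; positivity
  have hδt : Tendsto δ atTop (𝓝 0) := tendsto_one_div_add_atTop_nhds_zero_nat
  have hδa : Antitone δ := by
    intro m n hmn
    simp only [hδ]
    apply one_div_le_one_div_of_le (by positivity)
    have : (m : ℝ) ≤ n := by exact_mod_cast hmn
    linarith
  have hi : Φ.P h = ⋂ n, Φ.P (h + δ n • k) := by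
    ext x
    simp only [Set.mem_iInter, P, Set.mem_setOf_eq, Pi.add_apply, Pi.smul_apply, smul_eq_mul]
    constructor
    · intro h1 n u
      have := mul_pos (hδ0 n) (hkpos u)
      linarith [h1 u]
    · intro h1 u
      have : Tendsto (fun n => h u + δ n * k u) atTop (𝓝 (h u + 0 * k u)) :=
        (hδt.mul_const _).const_add _
      rw [zero_mul, add_zero] at this
      exact ge_of_tendsto' this fun n => h1 n u
  have hm : Tendsto (fun n => volume (Φ.P (h + δ n • k))) atTop (𝓝 (volume (Φ.P h))) := by
    rw [hi]
    refine tendsto_measure_iInter_atTop (fun n => (P_closed _).measurableSet.nullMeasurableSet) ?_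
      ⟨0, (P_bdd _).measure_lt_top.ne⟩
    intro m n hmn x hx u
    refine (hx u).trans ?_
    simp only [Pi.add_apply, Pi.smul_apply, smul_eq_mul]
    have := mul_le_mul_of_nonneg_right (hδa hmn) (hkpos u).le
    linarith
  have hm' : Tendsto (fun n => N.factorial * volume.real (Φ.P (h + δ n • k))) atTop
      (𝓝 (N.factorial * volume.real (Φ.P h))) :=
    ((ENNReal.tendsto_toReal (P_bdd h).measure_lt_top.ne).comp hm).const_mul _
  have hc : Continuous (fun t : ℝ => Phi (mkCoef Φ hN hξ).c (List.replicate N (h + t • k))) := by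
    have := Phi_continuous (X := ℝ) (mkCoef Φ hN hξ).c (List.replicate N ()) (fun _ t => h + t • k)
      (fun _ _ => by fun_prop)
    simpa only [List.map_replicate] using this
  have hc' := ((hc.tendsto 0).comp hδt)
  simp only [zero_smul, add_zero] at hc'
  refine tendsto_nhds_unique hc' ?_
  refine hm'.congr fun n => ?_
  exact (vol_T hN hξ (Tb_add_T hh (T_smul hkT (hδ0 n)))).symm

end Fan
end Esterov

open scoped Matrix
open Pointwise MeasureTheory
set_option linter.all false
namespace Esterov
open Fan
section supp
variable {N : ℕ} {ι : Type} [Fintype ι] [DecidableEq ι] {Φ : Fan N ι}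

lemma IsSupp.v_eq {K : Set (Fin N → ℝ)} {h : ι → ℝ} (hK : IsSupp Φ K h) {I : Finset ι} (hI : I ∈ Φ.B) :
    Φ.v I h ∈ K := by
  obtain ⟨b, hb, he⟩ := hK.2 I hI
  have : Φ.v I h = b := uniq' hI fun i hi => by rw [Φ.hv I hI i hi, he i hi]
  rw [this]; exact hb

lemma IsSupp.Tb {K : Set (Fin N → ℝ)} {h : ι → ℝ} (hK : IsSupp Φ K h) : h ∈ Φ.Tb :=
  fun I hI j => hK.1 _ (hK.v_eq hI) j

lemma IsSupp.P_eq {K : Set (Fin N → ℝ)} (hf : K.Finite) {h : ι → ℝ} (hK : IsSupp Φ K h) :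
    Φ.P h = convexHull ℝ K := by
  apply Set.Subset.antisymm
  · intro x hx
    by_contra hxK
    obtain ⟨ζ, c, h1, h2⟩ := sep_hull hf hxK
    obtain ⟨I, hI, h3⟩ := P_le hx ζ
    have := h1 _ (subset_convexHull ℝ K (hK.v_eq hI))
    linarith
  · intro x hx u
    exact dot_le_hull (fun a ha => hK.1 a ha u) hx

lemma IsSupp.add {K L : Set (Fin N → ℝ)} {h g : ι → ℝ} (hK : IsSupp Φ K h) (hL : IsSupp Φ L g) :
    IsSupp Φ (K + L) (h + g) := by
  refine ⟨?_, fun I hI => ?_⟩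
  · rintro _ ⟨a, ha, b, hb, rfl⟩ u
    simp only [dotProduct_add, Pi.add_apply]
    exact add_le_add (hK.1 a ha u) (hL.1 b hb u)
  · obtain ⟨a, ha, h1⟩ := hK.2 I hI
    obtain ⟨b, hb, h2⟩ := hL.2 I hI
    refine ⟨a + b, Set.add_mem_add ha hb, fun i hi => ?_⟩
    rw [dotProduct_add, h1 i hi, h2 i hi]; rfl

lemma IsSupp.zero : IsSupp Φ (0 : Set (Fin N → ℝ)) 0 := by
  refine ⟨?_, fun I hI => ⟨0, rfl, by simp⟩⟩
  rintro a ha u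
  rw [Set.mem_zero.1 ha]; simp

lemma IsSupp.sum {κ : Type*} (s : Finset κ) {K : κ → Set (Fin N → ℝ)} {h : κ → ι → ℝ}
    (hK : ∀ k ∈ s, IsSupp Φ (K k) (h k)) : IsSupp Φ (∑ k ∈ s, K k) (∑ k ∈ s, h k) := by
  classical
  induction s using Finset.induction_on with
  | empty => simpa using IsSupp.zero
  | insert a s ha ih =>
    rw [Finset.sum_insert ha, Finset.sum_insert ha]
    exact (hK a (by simp)).add (ih fun k hk => hK k (by simp [hk]))

lemma IsSupp.of_add {K L : Set (Fin N → ℝ)} (hf : K.Finite) {g : ι → ℝ} (hKL : IsSupp Φ (K + L) g) :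
    ∃ h, IsSupp Φ K h := by
  have hne : K.Nonempty := by
    obtain ⟨I, hI⟩ := exists_B (Φ := Φ)
    obtain ⟨_, ⟨a, ha, _⟩, _⟩ := hKL.2 I hI
    exact ⟨a, ha⟩
  have : ∀ u, ∃ m, (∀ a ∈ K, Φ.vec u ⬝ᵥ a ≤ m) ∧ ∃ a ∈ K, Φ.vec u ⬝ᵥ a = m := by
    intro u
    obtain ⟨a, ha, hm⟩ := Set.exists_max_image K (fun a => Φ.vec u ⬝ᵥ a) hf hne
    exact ⟨_, hm, a, ha, rfl⟩
  choose h h1 h2 using this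
  refine ⟨h, fun a ha u => h1 u a ha, fun I hI => ?_⟩
  obtain ⟨_, ⟨a, ha, l, hl, rfl⟩, he⟩ := hKL.2 I hI
  refine ⟨a, ha, fun i hi => le_antisymm (h1 i a ha) ?_⟩
  obtain ⟨a', ha', e⟩ := h2 i
  have h3 := hKL.1 _ (Set.add_mem_add ha' hl) i
  have h4 := he i hi
  simp only [dotProduct_add] at h3 h4
  linarith

lemma IsSupp.exists_eq {K : Set (Fin N → ℝ)} {h : ι → ℝ} (hK : IsSupp Φ K h) {u : ι} (hu : Φ.Face {u}) :
    ∃ a ∈ K, Φ.vec u ⬝ᵥ a = h u := by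
  obtain ⟨I, hI, hs⟩ := hu
  obtain ⟨b, hb, he⟩ := hK.2 I hI
  exact ⟨b, hb, he u (hs (by simp))⟩

end supp

lemma toR_add {N : ℕ} (a b : Fin N → ℤ) : toR (a + b) = toR a + toR b := by
  ext i; simp [toR]
lemma toR_sub {N : ℕ} (a b : Fin N → ℤ) : toR (a - b) = toR a - toR b := by
  ext i; simp [toR]
lemma toR_zero {N : ℕ} : toR (0 : Fin N → ℤ) = 0 := by
  ext i; simp [toR]
lemma toR_inj {N : ℕ} : Function.Injective (toR (n := N)) := by
  intro a b h
  ext i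
  have := congrFun h i
  simpa [toR] using this

/-- support of a lattice set -/
def Sp {N : ℕ} {ι : Type} [Fintype ι] [DecidableEq ι] (Φ : Fan N ι) (K : Finset (Fin N → ℤ)) (h : ι → ℝ) : Prop :=
  IsSupp Φ (toR '' (K : Set (Fin N → ℤ))) h

theorem master {N : ℕ} (hN : 0 < N) (F : Finset (Finset (Fin N → ℤ))) (hF : ∀ K ∈ F, K.Nonempty) :
    ∃ (ι : Type) (_ : Fintype ι) (_ : DecidableEq ι) (Φ : Fan N ι) (C : Coef Φ),
      (∀ K ∈ F, ∃ h, Sp Φ K h) ∧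
      ∀ h ∈ Φ.Tb, Phi C.c (List.replicate N h) = N.factorial * volume.real (Φ.P h) := by
  classical
  set E : Finset (Fin N → ℤ) := insert 0 (Finset.univ.image fun i => Pi.single i 1) with hE
  set F' := insert E F with hF'
  set V : Finset (Fin N → ℤ) := ∑ K ∈ F', K with hV
  have hsplit : ∀ K ∈ F', ∃ R : Finset (Fin N → ℤ), R.Nonempty ∧ V = K + R := by
    intro K hK
    refine ⟨∑ L ∈ F'.erase K, L, ?_, (Finset.add_sum_erase _ _ hK).symm⟩
    have : ∀ s : Finset (Finset (Fin N → ℤ)), (∀ L ∈ s, L.Nonempty) → (∑ L ∈ s, L).Nonempty := by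
      intro s
      induction s using Finset.induction_on with
      | empty => intro _; simp
      | insert a s ha ih =>
        intro h
        rw [Finset.sum_insert ha]
        exact (h a (by simp)).add (ih fun L hL => h L (by simp [hL]))
    apply this
    intro L hL
    rcases Finset.mem_insert.1 (Finset.mem_of_mem_erase hL) with rfl | h
    · exact ⟨0, by simp [hE]⟩
    · exact hF L h
  have himg : ∀ K R : Finset (Fin N → ℤ), toR '' ((K + R : Finset (Fin N → ℤ)) : Set (Fin N → ℤ)) =
      toR '' (K : Set (Fin N → ℤ)) + toR '' (R : Set (Fin N → ℤ)) := by
    intro K R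
    rw [Finset.coe_add]
    ext x
    constructor
    · rintro ⟨_, ⟨a, ha, b, hb, rfl⟩, rfl⟩
      exact ⟨toR a, ⟨a, ha, rfl⟩, toR b, ⟨b, hb, rfl⟩, (toR_add a b).symm⟩
    · rintro ⟨_, ⟨a, ha, rfl⟩, _, ⟨b, hb, rfl⟩, rfl⟩
      exact ⟨a + b, ⟨a, ha, b, hb, rfl⟩, toR_add a b⟩
  have hIntg : (interior (convexHull ℝ (toR '' (V : Set (Fin N → ℤ))))).Nonempty := by
    obtain ⟨R, ⟨p, hp⟩, hVR⟩ := hsplit E (by simp [hF'])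
    have hne : (toR '' (V : Set (Fin N → ℤ))).Nonempty := by
      refine ⟨toR (0 + p), 0 + p, ?_, rfl⟩
      rw [hVR]; exact Finset.add_mem_add (by simp [hE]) hp
    rw [interior_convexHull_nonempty_iff_affineSpan_eq_top,
      AffineSubspace.affineSpan_eq_top_iff_vectorSpan_eq_top_of_nonempty _ _ _ hne, eq_top_iff,
      ← (Pi.basisFun ℝ (Fin N)).span_eq, Submodule.span_le]
    rintro _ ⟨i, rfl⟩
    have h1 : toR (Pi.single i 1 + p) ∈ toR '' (V : Set (Fin N → ℤ)) := by
      refine ⟨_, ?_, rfl⟩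
      rw [hVR]; exact Finset.add_mem_add (by simp [hE]) hp
    have h2 : toR (0 + p) ∈ toR '' (V : Set (Fin N → ℤ)) := by
      refine ⟨_, ?_, rfl⟩
      rw [hVR]; exact Finset.add_mem_add (by simp [hE]) hp
    have h3 := vsub_mem_vectorSpan ℝ h1 h2
    have e : (Pi.basisFun ℝ (Fin N)) i = toR (Pi.single i 1 + p) -ᵥ toR (0 + p) := by
      rw [toR_add, toR_add, toR_zero]
      ext j
      simp [Pi.single_apply, toR]
    rw [e]
    exact h3
  obtain ⟨x0, hx0⟩ := hIntg
  obtain ⟨ι, i1, i2, Φ, h, hh⟩ := fan_of hN (V.image toR) x0 (by rw [Finset.coe_image]; exact hx0)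
  obtain ⟨C, hC⟩ := exists_Coef hN Φ
  refine ⟨ι, i1, i2, Φ, C, fun K hK => ?_, hC⟩
  obtain ⟨R, hR, hVR⟩ := hsplit K (by simp [hF', hK])
  rw [Finset.coe_image, hVR, himg] at hh
  exact hh.of_add ((Finset.finite_toSet K).image _)

section vol
variable {N : ℕ} {ι : Type} [Fintype ι] [DecidableEq ι] {Φ : Fan N ι} {C : Coef Φ}

/-- `C` computes volumes -/
def Vol (C : Coef Φ) : Prop :=
  ∀ h ∈ Φ.Tb, Phi C.c (List.replicate N h) = N.factorial * volume.real (Φ.P h)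

lemma MV_eq (hN : 0 < N) (hC : Vol C) (B : Fin N → Finset (Fin N → ℤ)) (hs : Fin N → ι → ℝ)
    (hB : ∀ i, Sp Φ (B i) (hs i)) : MV B = Phi C.c (List.ofFn hs) := by
  classical
  have hfin : ∀ S : Finset (Fin N), (∑ i ∈ S, toR '' (B i : Set (Fin N → ℤ))).Finite := by
    intro S
    induction S using Finset.induction_on with
    | empty => simp
    | insert a s ha ih =>
      rw [Finset.sum_insert ha]
      exact ((Finset.finite_toSet _).image _).add ih
  have hS : ∀ S : Finset (Fin N), IsSupp Φ (∑ i ∈ S, toR '' (B i : Set (Fin N → ℤ))) (∑ i ∈ S, hs i) :=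
    fun S => IsSupp.sum S fun i _ => hB i
  have hval : ∀ S : Finset (Fin N), (N.factorial : ℝ) *
      (volume (convexHull ℝ (∑ i ∈ S, toR '' (B i : Set (Fin N → ℤ))))).toReal =
      Phi C.c (List.replicate N (0 + ∑ i ∈ S, hs i)) := by
    intro S
    rw [zero_add, hC _ (hS S).Tb, (hS S).P_eq (hfin S)]; rfl
  have hdd := dd_eq_sum (fun h => Phi C.c (List.replicate N h ++ [])) hs (List.finRange N) (List.nodup_finRange N) 0
  rw [dd_Phi_pow C.perm _ N [] 0 (by simp), if_pos (by simp)] at hdd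
  simp only [List.append_nil, List.length_finRange] at hdd
  have htf : (List.finRange N).toFinset = Finset.univ := by ext; simp
  rw [htf, ← Finset.sum_filter_add_sum_filter_not _ (fun S : Finset (Fin N) => S.Nonempty)] at hdd
  have h0 : ∑ S ∈ Finset.univ.powerset.filter (fun S : Finset (Fin N) => ¬ S.Nonempty),
      (-1 : ℝ) ^ (N - S.card) * Phi C.c (List.replicate N (0 + ∑ i ∈ S, hs i)) = 0 := by
    refine Finset.sum_eq_zero fun S hS => ?_
    have : S = ∅ := Finset.not_nonempty_iff_eq_empty.1 (Finset.mem_filter.1 hS).2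
    rw [this, Finset.sum_empty, add_zero]
    obtain ⟨m, rfl⟩ : ∃ m, N = m + 1 := ⟨N - 1, by omega⟩
    rw [List.replicate_succ, Phi_zero, mul_zero]
  rw [h0, add_zero] at hdd
  have hf : (N.factorial : ℝ) ≠ 0 := by positivity
  have : (N.factorial : ℝ) * MV B = N.factorial * Phi C.c (List.ofFn hs) := by
    rw [List.ofFn_eq_map, hdd, MV, Finset.mul_sum]
    refine Finset.sum_congr rfl fun S _ => ?_
    rw [← hval]; ring
  exact mul_left_cancel₀ hf this

end vol
end Esterov

open scoped Matrix
open Pointwise MeasureTheory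
set_option linter.all false
namespace Esterov
open Fan Coef
section seg
variable {N : ℕ} {ι : Type} [Fintype ι] [DecidableEq ι] {Φ : Fan N ι} {C : Coef Φ}

/-- support function of a segment -/
noncomputable def hseg (Φ : Fan N ι) (w : Fin N → ℝ) : ι → ℝ := fun u => max 0 (Φ.vec u ⬝ᵥ w)

/-- the fan refines the normal fan of the segment -/
def Good (Φ : Fan N ι) (w : Fin N → ℝ) : Prop := IsSupp Φ {0, w} (hseg Φ w)

lemma Good.of (w : Fin N → ℝ) {h : ι → ℝ} (hh : IsSupp Φ {0, w} h) : Good Φ w := by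
  refine ⟨?_, fun I hI => ?_⟩
  · rintro a (rfl | rfl) u
    · simp [hseg]
    · simp [hseg]
  · obtain ⟨b, hb, he⟩ := hh.2 I hI
    refine ⟨b, hb, fun i hi => ?_⟩
    have h0 := hh.1 0 (by simp) i
    have hw := hh.1 w (by simp) i
    rw [← he i hi] at h0 hw
    have hb' : b = 0 ∨ b = w := hb
    unfold hseg
    rcases hb' with hb | hb <;> subst hb
    · rw [max_eq_left]
      · simp
      · simpa using hw
    · rw [max_eq_right]
      simpa using h0

lemma span_perp {κ : Type*} {ws : κ → Fin N → ℝ} {ξ : Fin N → ℝ} (h : ∀ k, ξ ⬝ᵥ ws k = 0)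
    {x : Fin N → ℝ} (hx : x ∈ Submodule.span ℝ (Set.range ws)) : ξ ⬝ᵥ x = 0 := by
  induction hx using Submodule.span_induction with
  | mem x hx => obtain ⟨k, rfl⟩ := hx; exact h k
  | zero => simp
  | add x y _ _ hx hy => rw [dotProduct_add, hx, hy, add_zero]
  | smul a x _ hx => rw [dotProduct_smul, hx, smul_zero]

lemma Good.ker_eq {σ : Finset ι} (hσ : Φ.Face σ) {n : ℕ} {ws : Fin n → Fin N → ℝ}
    (hli : LinearIndependent ℝ ws) (hn : σ.card + n = N)
    (hperp : ∀ k, ∀ t ∈ σ, Φ.vec t ⬝ᵥ ws k = 0) {z : Fin N → ℝ} (hz : ∀ t ∈ σ, Φ.vec t ⬝ᵥ z = 0) :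
    z ∈ Submodule.span ℝ (Set.range ws) := by
  classical
  obtain ⟨I, hI, hs⟩ := hσ
  set D : Submodule ℝ (Fin N → ℝ) := Submodule.span ℝ (((I \ σ).image fun i => Φ.v I (ev i) : Finset (Fin N → ℝ)) : Set (Fin N → ℝ)) with hD
  have hmem : ∀ x : Fin N → ℝ, (∀ t ∈ σ, Φ.vec t ⬝ᵥ x = 0) → x ∈ D := by
    intro x hx
    rw [x_expand hI x]
    refine Submodule.sum_mem _ fun i hi => ?_
    by_cases hiσ : i ∈ σ
    · rw [hx i hiσ, zero_smul]; exact D.zero_mem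
    · refine D.smul_mem _ (Submodule.subset_span ?_)
      simp only [Finset.coe_image, Set.mem_image, Finset.mem_coe]
      exact ⟨i, by simp [hi, hiσ], rfl⟩
  have hd : Module.finrank ℝ D ≤ n := by
    refine (finrank_span_finset_le_card _).trans (Finset.card_image_le.trans ?_)
    rw [Finset.card_sdiff_of_subset hs, Φ.card_eq I hI]; omega
  have hle : Submodule.span ℝ (Set.range ws) ≤ D := by
    rw [Submodule.span_le]
    rintro _ ⟨k, rfl⟩
    exact hmem _ (hperp k)
  have : Submodule.span ℝ (Set.range ws) = D := by
    apply Submodule.eq_of_le_of_finrank_le hle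
    rw [finrank_span_eq_card hli]; simpa using hd
  rw [this]
  exact hmem z hz

lemma face_of_ne {τ : Finset ι} {L : List (ι → ℝ)} (h : C.Psi τ L ≠ 0) : Φ.Face τ := by
  by_contra hτ
  exact h (Psi_nonface hτ L)

lemma len_of_ne {τ : Finset ι} {L : List (ι → ℝ)} (h : C.Psi τ L ≠ 0) : τ.card + L.length = N := by
  by_contra hτ
  exact h (Psi_len hτ)

lemma Good.perp {τ : Finset ι} {w : Fin N → ℝ} (hw : Good Φ w) {L : List (ι → ℝ)}
    (h : C.Psi τ (hseg Φ w :: L) ≠ 0) : ∀ t ∈ τ, Φ.vec t ⬝ᵥ w = 0 := by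
  by_contra hc
  push Not at hc
  obtain ⟨t, ht, hne⟩ := hc
  obtain ⟨I, hI, hs⟩ := face_of_ne h
  obtain ⟨b, hb, he⟩ := hw.2 I hI
  apply h
  rw [RED τ (hseg Φ w) b (fun t ht => (he t (hs ht)).symm)]
  refine Finset.sum_eq_zero fun u _ => ?_
  by_cases hu : Φ.Face (insert u τ)
  · obtain ⟨J, hJ, hsJ⟩ := hu
    obtain ⟨b', hb', he'⟩ := hw.2 J hJ
    have e1 := he t (hs ht)
    have e2 := he' t (hsJ (by simp [ht]))
    have : b = b' := by
      rcases hb with hb | hb <;> rcases hb' with hb' | hb'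
      · rw [hb, hb']
      · rw [hb] at e1; rw [hb'] at e2; rw [← e1] at e2
        simp at e2; exact absurd e2 hne
      · rw [hb] at e1; rw [hb'] at e2; rw [← e2] at e1
        simp at e1; exact absurd e1 hne
      · rw [hb, hb']
    rw [this, he' u (hsJ (by simp)), sub_self, zero_mul]
  · rw [Psi_nonface hu, mul_zero]

lemma seg_red {τ : Finset ι} {w : Fin N → ℝ} (hp : ∀ t ∈ τ, Φ.vec t ⬝ᵥ w = 0) (L : List (ι → ℝ)) :
    C.Psi τ (hseg Φ w :: L) = ∑ u ∈ Finset.univ.filter (· ∉ τ), hseg Φ w u * C.Psi (insert u τ) L := by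
  rw [RED τ (hseg Φ w) 0]
  · simp
  · intro t ht; simp [hseg, hp t ht]

/-- nonzero segment terms are transversal -/
lemma seg_indep (ws : List (Fin N → ℝ)) (hg : ∀ w ∈ ws, Good Φ w) (τ : Finset ι)
    (h : C.Psi τ (ws.map (hseg Φ)) ≠ 0) :
    (∀ k : Fin ws.length, ∀ t ∈ τ, Φ.vec t ⬝ᵥ ws.get k = 0) ∧ LinearIndependent ℝ ws.get := by
  induction ws generalizing τ with
  | nil => exact ⟨fun k => k.elim0, (by haveI : IsEmpty (Fin ([] : List (Fin N → ℝ)).length) := Fin.isEmpty; exact linearIndependent_empty_type)⟩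
  | cons w ws ih =>
    rw [List.map_cons] at h
    have hp := (hg w (by simp)).perp h
    rw [seg_red hp] at h
    obtain ⟨u, hu, hne⟩ := Finset.exists_ne_zero_of_sum_ne_zero h
    have h1 : C.Psi (insert u τ) (ws.map (hseg Φ)) ≠ 0 := right_ne_zero_of_mul hne
    have h2 : hseg Φ w u ≠ 0 := left_ne_zero_of_mul hne
    obtain ⟨i1, i2⟩ := ih (fun z hz => hg z (by simp [hz])) _ h1
    constructor
    · intro k
      refine Fin.cases ?_ ?_ k
      · exact hp
      · intro k t ht
        exact i1 k t (by simp [ht])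
    · have : (w :: ws).get = Fin.cons w ws.get := by
        funext k
        refine Fin.cases ?_ ?_ k
        · rfl
        · intro k; rfl
      rw [this]
      refine linearIndependent_finCons.2 ⟨i2, fun hw => h2 ?_⟩
      simp [hseg, span_perp (fun k => i1 k u (by simp)) hw]

lemma seg_step {τ : Finset ι} {u : ι} (hu : u ∉ τ) {w : Fin N → ℝ} (hp : ∀ t ∈ τ, Φ.vec t ⬝ᵥ w = 0)
    (hpos : 0 < Φ.vec u ⬝ᵥ w) {ws : List (Fin N → ℝ)} (hg : ∀ w ∈ ws, Good Φ w)
    (h : C.Psi (insert u τ) (ws.map (hseg Φ)) ≠ 0) :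
    C.Psi τ ((w :: ws).map (hseg Φ)) = (Φ.vec u ⬝ᵥ w) * C.Psi (insert u τ) (ws.map (hseg Φ)) := by
  classical
  rw [List.map_cons, seg_red hp, Finset.sum_eq_single u]
  · rw [hseg, max_eq_right hpos.le]
  · intro u' hu' hne
    simp only [Finset.mem_filter, Finset.mem_univ, true_and] at hu'
    by_contra hc
    have h1 : C.Psi (insert u' τ) (ws.map (hseg Φ)) ≠ 0 := right_ne_zero_of_mul hc
    have h2 : hseg Φ w u' ≠ 0 := left_ne_zero_of_mul hc
    have h3 : 0 < Φ.vec u' ⬝ᵥ w := by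
      by_contra h3
      exact h2 (max_eq_left (not_lt.1 h3))
    obtain ⟨p1, li⟩ := seg_indep ws hg _ h1
    obtain ⟨p2, -⟩ := seg_indep ws hg _ h
    have hf := face_of_ne h
    have hcard := len_of_ne h
    rw [List.length_map] at hcard
    obtain ⟨I, hI, hs⟩ := id hf
    have hz : ∀ i ∈ I, i ∉ insert u τ → Φ.co I (Φ.vec u') i = 0 := by
      intro i hi hiτ
      have hm := Good.ker_eq hf li hcard p2 (z := Φ.v I (ev i)) (by
        intro t ht
        rw [Φ.hv I hI t (hs ht)]
        have : t ≠ i := fun e => hiτ (e ▸ ht)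
        simp [ev, this])
      rw [co]
      exact span_perp (fun k => p1 k u' (by simp)) hm
    have hexp : Φ.vec u' = Φ.co I (Φ.vec u') u • Φ.vec u + ∑ t ∈ τ, Φ.co I (Φ.vec u') t • Φ.vec t := by
      conv_lhs => rw [expand hI (Φ.vec u')]
      rw [← Finset.sum_insert (f := fun t => Φ.co I (Φ.vec u') t • Φ.vec t) hu]
      symm
      refine Finset.sum_subset hs fun i hi hni => ?_
      rw [hz i hi hni, zero_smul]
    have hcp : 0 < Φ.co I (Φ.vec u') u := by
      have := congrArg (· ⬝ᵥ w) hexp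
      simp only [add_dotProduct, sum_dotProduct, smul_dotProduct] at this
      rw [Finset.sum_eq_zero (fun t ht => by rw [hp t ht, smul_zero]), add_zero, smul_eq_mul] at this
      rw [this] at h3
      exact pos_of_mul_pos_left h3 hpos.le
    exact hne (ray_unique hf (face_of_ne h1) hu hu' hcp _ hexp)
  · intro hc; simp [hu] at hc

/-- the set of positive segment terms -/
def SegSet (C : Coef Φ) (τ : Finset ι) (Ks : List (Set (Fin N → ℝ))) : Set ℝ :=
  {x | ∃ ws : List (Fin N → ℝ), List.Forall₂ (fun w K => ∃ a ∈ K, ∃ b ∈ K, w = b - a) ws Ks ∧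
    x = C.Psi τ (ws.map (hseg Φ)) ∧ 0 < x}

lemma forall2_good {ws : List (Fin N → ℝ)} {Ks : List (Set (Fin N → ℝ))}
    (h : List.Forall₂ (fun w K => ∃ a ∈ K, ∃ b ∈ K, w = b - a) ws Ks)
    (hK : ∀ K ∈ Ks, ∀ a ∈ K, ∀ b ∈ K, Good Φ (b - a)) : ∀ w ∈ ws, Good Φ w := by
  induction h with
  | nil => simp
  | @cons w K ws Ks h1 h2 ih =>
    intro z hz
    rcases List.mem_cons.1 hz with rfl | hz
    · obtain ⟨a, ha, b, hb, rfl⟩ := h1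
      exact hK K (by simp) a ha b hb
    · exact ih (fun K hK' => hK K (by simp [hK'])) z hz

/-- decomposition of a mixed volume into segment terms -/
lemma SEG {Ks : List (Set (Fin N → ℝ))} {hs : List (ι → ℝ)} (hKh : List.Forall₂ (IsSupp Φ) Ks hs)
    (hK : ∀ K ∈ Ks, ∀ a ∈ K, ∀ b ∈ K, Good Φ (b - a)) (τ : Finset ι) :
    C.Psi τ hs ∈ AddSubmonoid.closure (SegSet C τ Ks) := by
  induction hKh generalizing τ with
  | nil =>
    rcases (Psi_nonneg (C := C) (L := []) (by simp) τ).eq_or_lt with h | h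
    · rw [← h]; exact zero_mem _
    · exact AddSubmonoid.subset_closure ⟨[], List.Forall₂.nil, rfl, h⟩
  | @cons K h Ks hs hk hks ih =>
    by_cases hτ : Φ.Face τ
    swap
    · rw [Psi_nonface hτ]; exact zero_mem _
    obtain ⟨I, hI, hsI⟩ := hτ
    obtain ⟨a, ha, hea⟩ := hk.2 I hI
    rw [RED τ h a (fun t ht => (hea t (hsI ht)).symm)]
    refine sum_mem fun u hu => ?_
    simp only [Finset.mem_filter, Finset.mem_univ, true_and] at hu
    by_cases hf : Φ.Face (insert u τ)
    swap
    · rw [Psi_nonface hf, mul_zero]; exact zero_mem _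
    obtain ⟨J, hJ, hsJ⟩ := hf
    obtain ⟨b, hb, heb⟩ := hk.2 J hJ
    have e : h u - Φ.vec u ⬝ᵥ a = Φ.vec u ⬝ᵥ (b - a) := by
      rw [dotProduct_sub, heb u (hsJ (by simp))]
    have hge : 0 ≤ Φ.vec u ⬝ᵥ (b - a) := by
      rw [← e]; exact sub_nonneg.2 (hk.1 a ha u)
    rw [e]
    rcases hge.eq_or_lt with h0 | h0
    · rw [← h0, zero_mul]; exact zero_mem _
    have hp : ∀ t ∈ τ, Φ.vec t ⬝ᵥ (b - a) = 0 := by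
      intro t ht
      rw [dotProduct_sub, heb t (hsJ (by simp [ht])), hea t (hsI ht), sub_self]
    have := ih (fun K hK' => hK K (by simp [hK'])) (insert u τ)
    generalize C.Psi (insert u τ) hs = val at this ⊢
    induction this using AddSubmonoid.closure_induction with
    | mem x hx =>
      obtain ⟨ws, h1, h2, h3⟩ := hx
      refine AddSubmonoid.subset_closure ⟨(b - a) :: ws, List.Forall₂.cons ⟨a, ha, b, hb, rfl⟩ h1, ?_, mul_pos h0 h3⟩
      rw [h2, seg_step hu hp h0 (forall2_good h1 fun K hK' => hK K (by simp [hK'])) (by rw [← h2]; exact h3.ne')]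
    | zero => rw [mul_zero]; exact zero_mem _
    | add x y _ _ hx hy => rw [mul_add]; exact add_mem hx hy

lemma closure_ge {S : Set ℝ} (hS : ∀ x ∈ S, 0 < x) {x : ℝ} (hx : x ∈ AddSubmonoid.closure S) :
    0 ≤ x ∧ (x ≠ 0 → ∃ y ∈ S, y ≤ x) := by
  induction hx using AddSubmonoid.closure_induction with
  | mem x hx => exact ⟨(hS x hx).le, fun _ => ⟨x, hx, le_rfl⟩⟩
  | zero => exact ⟨le_rfl, fun h => absurd rfl h⟩
  | add x y _ _ hx hy =>
    refine ⟨add_nonneg hx.1 hy.1, fun h => ?_⟩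
    by_cases h0 : x = 0
    · have : y ≠ 0 := by rintro rfl; simp [h0] at h
      obtain ⟨z, hz, hzy⟩ := hy.2 this
      exact ⟨z, hz, by linarith [hx.1]⟩
    · obtain ⟨z, hz, hzy⟩ := hx.2 h0
      exact ⟨z, hz, by linarith [hy.1]⟩

end seg
end Esterov

open scoped Matrix
open Pointwise MeasureTheory
set_option linter.all false
namespace Esterov
open Fan Coef

lemma image_seg {N : ℕ} (w : Fin N → ℤ) :
    toR '' ((({0, w} : Finset (Fin N → ℤ))) : Set (Fin N → ℤ)) = {0, toR w} := by
  simp [Set.image_pair, toR_zero]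

lemma MV_seg {N : ℕ} (hN : 0 < N) (w : Fin N → Fin N → ℤ) :
    MV (fun i => {0, w i}) = |(Matrix.of fun i j => ((w i j : ℤ) : ℝ)).det| := by
  classical
  unfold MV
  simp only [image_seg]
  rw [Finset.sum_eq_single Finset.univ]
  · rw [← parallelepiped_eq_convexHull, Finset.card_univ, Fintype.card_fin, Nat.sub_self, pow_zero, one_mul]
    have := Measure.addHaar_parallelepiped (Pi.basisFun ℝ (Fin N)) (fun i => toR (w i))
    have hv : (Pi.basisFun ℝ (Fin N)).addHaar = volume := by
      rw [Module.Basis.addHaar, Module.Basis.parallelepiped_basisFun, addHaarMeasure_eq_volume_pi]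
    rw [hv] at this
    rw [this, ENNReal.toReal_ofReal (abs_nonneg _), Pi.basisFun_det_apply]
    rfl
  · intro S hS hSu
    have : volume (convexHull ℝ (∑ i ∈ S, ({0, toR (w i)} : Set (Fin N → ℝ)))) = 0 := by
      set D : Submodule ℝ (Fin N → ℝ) := Submodule.span ℝ ((S.image fun i => toR (w i) : Finset (Fin N → ℝ)) : Set (Fin N → ℝ)) with hD
      have hlt : S.card < N := by
        have := Finset.card_lt_card (Finset.ssubset_univ_iff.2 hSu)
        simpa using this
      have hDt : D ≠ ⊤ := by
        intro h
        have h1 : Module.finrank ℝ D ≤ S.card := (finrank_span_finset_le_card _).trans Finset.card_image_le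
        rw [h, finrank_top] at h1
        simp at h1
        omega
      refine measure_mono_null ?_ (Measure.addHaar_submodule volume D hDt)
      refine convexHull_min ?_ D.convex
      intro x hx
      rw [Set.mem_finset_sum] at hx
      obtain ⟨g, hg, rfl⟩ := hx
      refine D.sum_mem fun i hi => ?_
      rcases hg hi with h | h
      · rw [h]; exact D.zero_mem
      · rw [h]; apply Submodule.subset_span; simp only [Finset.coe_image]; exact ⟨i, hi, rfl⟩
    rw [this]; simp
  · intro h
    haveI : Nonempty (Fin N) := ⟨⟨0, hN⟩⟩
    exact absurd (by simp) h

section ctx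
variable {N : ℕ} {ι : Type} [Fintype ι] [DecidableEq ι] {Φ : Fan N ι} {C : Coef Φ}

lemma Good.of_Sp {w : Fin N → ℤ} {h : ι → ℝ} (hh : Sp Φ {0, w} h) : Good Φ (toR w) := by
  unfold Sp at hh
  rw [image_seg] at hh
  exact Good.of _ hh

lemma Good.Sp {w : Fin N → ℤ} (hh : Good Φ (toR w)) : Sp Φ {0, w} (hseg Φ (toR w)) := by
  unfold Esterov.Sp
  rw [image_seg]
  exact hh

lemma Good.Tb {w : Fin N → ℝ} (hh : Good Φ w) : hseg Φ w ∈ Φ.Tb := IsSupp.Tb hh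

lemma seg_det (hN : 0 < N) (hC : Vol C) (w : Fin N → Fin N → ℤ) (hg : ∀ i, Good Φ (toR (w i))) :
    Phi C.c (List.ofFn fun i => hseg Φ (toR (w i))) = ((|(Matrix.of w).det| : ℤ) : ℝ) := by
  rw [← MV_eq hN hC (fun i => {0, w i}) _ (fun i => (hg i).Sp), MV_seg hN, Int.cast_abs]
  congr 1
  have := (Int.castRingHom ℝ).map_det (Matrix.of w)
  simp only [Int.coe_castRingHom] at this
  rw [this]
  rfl

lemma Phi_le_cons {x y : ι → ℝ} (h : ∀ u, Φ.Face {u} → x u ≤ y u) {L : List (ι → ℝ)}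
    (hL : ∀ z ∈ L, z ∈ Φ.Tb) : Phi C.c (x :: L) ≤ Phi C.c (y :: L) := by
  rw [← Psi_empty, ← Psi_empty, Psi_cons_ev, Psi_cons_ev ∅ y]
  refine Finset.sum_le_sum fun u _ => ?_
  rw [Psi_insert (by simp)]
  by_cases hu : Φ.Face {u}
  · exact mul_le_mul_of_nonneg_right (h u hu) (Psi_nonneg hL _)
  · have : C.Psi (insert u ∅) L = 0 := Psi_nonface hu L
    rw [this, mul_zero, mul_zero]

lemma Phi_mono {L L' : List (ι → ℝ)} (h : List.Forall₂ (fun x y => ∀ u, Φ.Face {u} → x u ≤ y u) L L')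
    (hL : ∀ z ∈ L, z ∈ Φ.Tb) (hL' : ∀ z ∈ L', z ∈ Φ.Tb) (p : List (ι → ℝ)) (hp : ∀ z ∈ p, z ∈ Φ.Tb) :
    Phi C.c (p ++ L) ≤ Phi C.c (p ++ L') := by
  induction h generalizing p with
  | nil => exact le_rfl
  | @cons x y L L' h1 h2 ih =>
    have e1 : Phi C.c (p ++ x :: L) = Phi C.c (x :: (p ++ L)) := Phi_perm List.perm_middle C.perm
    have e2 : Phi C.c (p ++ y :: L) = Phi C.c (y :: (p ++ L)) := Phi_perm List.perm_middle C.perm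
    rw [e1]
    refine (Phi_le_cons (y := y) h1 ?_).trans ?_
    · intro z hz
      rcases List.mem_append.1 hz with hz | hz
      · exact hp z hz
      · exact hL z (by simp [hz])
    · rw [← e2]
      have := ih (fun z hz => hL z (by simp [hz])) (fun z hz => hL' z (by simp [hz])) (p ++ [y]) (by
        intro z hz
        rcases List.mem_append.1 hz with hz | hz
        · exact hp z hz
        · rw [List.mem_singleton.1 hz]; exact hL' y (by simp))
      simpa using this

lemma IsSupp.le {K L : Set (Fin N → ℝ)} {h g : ι → ℝ} (hK : IsSupp Φ K h) (hL : IsSupp Φ L g)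
    (hs : K ⊆ L) : ∀ u, Φ.Face {u} → h u ≤ g u := by
  intro u hu
  obtain ⟨a, ha, e⟩ := hK.exists_eq hu
  rw [← e]
  exact hL.1 a (hs ha) u

lemma Psi_ofFn_mono {n : ℕ} {f g : Fin n → ι → ℝ} (h : ∀ k u, Φ.Face {u} → f k u ≤ g k u)
    (hf : ∀ k, f k ∈ Φ.Tb) (hg : ∀ k, g k ∈ Φ.Tb) : Phi C.c (List.ofFn f) ≤ Phi C.c (List.ofFn g) := by
  have := Phi_mono (C := C) (L := List.ofFn f) (L' := List.ofFn g) (by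
    rw [List.forall₂_iff_get]
    refine ⟨by simp, fun i h1 h2 => ?_⟩
    simp only [List.get_ofFn]
    exact h _) (by simpa [List.mem_ofFn] using hf) (by simpa [List.mem_ofFn] using hg) [] (by simp)
  simpa using this

/-- translation of a segment: `hseg (b-a) + ell a` -/
lemma seg_le {K : Set (Fin N → ℝ)} {h : ι → ℝ} (hK : IsSupp Φ K h) {a b : Fin N → ℝ} (ha : a ∈ K) (hb : b ∈ K) (u : ι) :
    hseg Φ (b - a) u + Φ.ell a u ≤ h u := by
  unfold hseg ell
  rcases le_total 0 (Φ.vec u ⬝ᵥ (b - a)) with h1 | h1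
  · rw [max_eq_right h1, dotProduct_sub]
    linarith [hK.1 b hb u]
  · rw [max_eq_left h1]
    linarith [hK.1 a ha u]

lemma seg_shift {n : ℕ} (f : Fin n → ι → ℝ) (a : Fin n → Fin N → ℝ) (p : List (ι → ℝ)) :
    Phi C.c (p ++ List.ofFn (fun k => f k + Φ.ell (a k))) = Phi C.c (p ++ List.ofFn f) := by
  induction n generalizing p with
  | zero => simp
  | succ n ih =>
    rw [List.ofFn_succ, List.ofFn_succ]
    have e : ∀ (x : ι → ℝ) L, Phi C.c (p ++ x :: L) = Phi C.c (x :: (p ++ L)) :=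
      fun x L => Phi_perm List.perm_middle C.perm
    have := ih (fun k => f k.succ) (fun k => a k.succ) (p ++ [f 0])
    rw [e, Phi_add]
    have h0 : ∀ L, Phi C.c (Φ.ell (a 0) :: L) = 0 := fun L => by rw [← Psi_empty, Psi_ker]
    rw [h0, add_zero, ← e]
    simpa using this

/-- lower bound by a transversal -/
lemma seg_lower {n : ℕ} {K : Fin n → Set (Fin N → ℝ)} {h : Fin n → ι → ℝ} (hK : ∀ k, IsSupp Φ (K k) (h k))
    {a b : Fin n → Fin N → ℝ} (ha : ∀ k, a k ∈ K k) (hb : ∀ k, b k ∈ K k) (hg : ∀ k, Good Φ (b k - a k)) :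
    Phi C.c (List.ofFn fun k => hseg Φ (b k - a k)) ≤ Phi C.c (List.ofFn h) := by
  have := seg_shift (C := C) (fun k => hseg Φ (b k - a k)) a []
  simp only [List.nil_append] at this
  rw [← this]
  exact Psi_ofFn_mono (fun k u _ => seg_le (hK k) (ha k) (hb k) u)
    (fun k => Tb_add (hg k).Tb (ell_Tb _)) (fun k => (hK k).Tb)

end ctx
end Esterov

open scoped Matrix
open Pointwise MeasureTheory
set_option linter.all false
namespace Esterov
open Fan Coef

/-- A fan adapted to a tuple. -/
structure Ctx {N : ℕ} (A : Fin N → Finset (Fin N → ℤ)) {ι : Type} [Fintype ι] [DecidableEq ι]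
    {Φ : Fan N ι} (C : Coef Φ) (h : Fin N → ι → ℝ) : Prop where
  hN : 0 < N
  vol : Vol C
  sp : ∀ i, Sp Φ (A i) (h i)
  good : ∀ i, ∀ a ∈ A i, ∀ b ∈ A i, Good Φ (toR b - toR a)
  goodE : ∀ j, Good Φ (Pi.single j 1)

lemma exists_ctx {N : ℕ} (hN : 0 < N) (A : Fin N → Finset (Fin N → ℤ)) (hne : ∀ i, (A i).Nonempty) :
    ∃ (ι : Type) (_ : Fintype ι) (_ : DecidableEq ι) (Φ : Fan N ι) (C : Coef Φ) (h : Fin N → ι → ℝ),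
      Ctx A C h := by
  classical
  set F : Finset (Finset (Fin N → ℤ)) := Finset.univ.image A ∪
    (Finset.univ.biUnion fun i => (A i ×ˢ A i).image fun p => {0, p.2 - p.1}) ∪
    Finset.univ.image (fun j : Fin N => {0, Pi.single j 1}) with hF
  obtain ⟨ι, i1, i2, Φ, C, h1, h2⟩ := master hN F (by
    intro K hK
    simp only [hF, Finset.mem_union, Finset.mem_image, Finset.mem_univ, true_and, Finset.mem_biUnion] at hK
    rcases hK with (⟨i, rfl⟩ | ⟨i, p, hp, rfl⟩) | ⟨j, rfl⟩
    · exact hne i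
    · simp
    · simp)
  have hA : ∀ i, ∃ h, Sp Φ (A i) h := fun i => h1 _ (by simp [hF])
  choose h hh using hA
  refine ⟨ι, i1, i2, Φ, C, h, hN, h2, hh, ?_, ?_⟩
  · intro i a ha b hb
    obtain ⟨g, hg⟩ := h1 {0, b - a} (by
      simp only [hF, Finset.mem_union, Finset.mem_image, Finset.mem_univ, true_and, Finset.mem_biUnion]
      exact Or.inl (Or.inr ⟨i, (a, b), by simp [ha, hb], rfl⟩))
    have := Good.of_Sp hg
    rwa [toR_sub] at this
  · intro j
    obtain ⟨g, hg⟩ := h1 {0, Pi.single j 1} (by simp [hF])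
    have := Good.of_Sp hg
    have e : toR (Pi.single j 1 : Fin N → ℤ) = Pi.single j 1 := by
      ext k; simp [toR, Pi.single_apply]
    rwa [e] at this

namespace Ctx
variable {N : ℕ} {A : Fin N → Finset (Fin N → ℤ)} {ι : Type} [Fintype ι] [DecidableEq ι]
    {Φ : Fan N ι} {C : Coef Φ} {h : Fin N → ι → ℝ}

lemma MV_eq (X : Ctx A C h) (b : Fin N → Fin N) : MV (fun s => A (b s)) = Phi C.c (List.ofFn fun s => h (b s)) :=
  Esterov.MV_eq X.hN X.vol _ _ fun s => X.sp (b s)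

lemma Tb (X : Ctx A C h) (i) : h i ∈ Φ.Tb := (X.sp i).Tb

/-- all segment terms of a list of sets -/
lemma segset (X : Ctx A C h) {n : ℕ} (k : Fin n → Fin N) (τ : Finset ι) {x : ℝ}
    (hx : x ∈ SegSet C τ (List.ofFn fun s => toR '' (A (k s) : Set (Fin N → ℤ)))) :
    ∃ a b : Fin n → Fin N → ℤ, (∀ s, a s ∈ A (k s)) ∧ (∀ s, b s ∈ A (k s)) ∧
      x = C.Psi τ (List.ofFn fun s => hseg Φ (toR (b s) - toR (a s))) ∧ 0 < x := by
  obtain ⟨ws, h1, h2, h3⟩ := hx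
  have hl : ws.length = n := by simpa using h1.length_eq
  rw [List.forall₂_iff_get] at h1
  have : ∀ s : Fin n, ∃ a b : Fin N → ℤ, a ∈ A (k s) ∧ b ∈ A (k s) ∧ ws.get (s.cast hl.symm) = toR b - toR a := by
    intro s
    have := h1.2 s (by rw [hl]; exact s.2) (by simp)
    simp only [List.get_ofFn] at this
    obtain ⟨_, ⟨a, ha, rfl⟩, _, ⟨b, hb, rfl⟩, e⟩ := this
    exact ⟨a, b, ha, hb, e⟩
  choose a b ha hb e using this
  refine ⟨a, b, ha, hb, ?_, h3⟩
  rw [h2]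
  congr 1
  apply List.ext_get
  · simp [hl]
  · intro s h1 h2
    have h2' : s < n := by simpa using h2
    have := e ⟨s, h2'⟩
    simp only [List.get_eq_getElem, List.getElem_map, List.getElem_ofFn] at this ⊢
    rw [← this]
    rfl

lemma seg (X : Ctx A C h) {n : ℕ} (k : Fin n → Fin N) (τ : Finset ι) :
    C.Psi τ (List.ofFn fun s => h (k s)) ∈
      AddSubmonoid.closure (SegSet C τ (List.ofFn fun s => toR '' (A (k s) : Set (Fin N → ℤ)))) := by
  apply SEG
  · rw [List.forall₂_iff_get]
    refine ⟨by simp, fun i h1 h2 => ?_⟩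
    simp only [List.get_ofFn]
    exact X.sp _
  · intro K hK
    rw [List.mem_ofFn] at hK
    obtain ⟨s, rfl⟩ := hK
    rintro _ ⟨a, ha, rfl⟩ _ ⟨b, hb, rfl⟩
    exact X.good _ a ha b hb

lemma exists_seg (X : Ctx A C h) {n : ℕ} (k : Fin n → Fin N) (τ : Finset ι)
    (hne : C.Psi τ (List.ofFn fun s => h (k s)) ≠ 0) :
    ∃ a b : Fin n → Fin N → ℤ, (∀ s, a s ∈ A (k s)) ∧ (∀ s, b s ∈ A (k s)) ∧
      0 < C.Psi τ (List.ofFn fun s => hseg Φ (toR (b s) - toR (a s))) ∧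
      C.Psi τ (List.ofFn fun s => hseg Φ (toR (b s) - toR (a s))) ≤ C.Psi τ (List.ofFn fun s => h (k s)) := by
  obtain ⟨y, hy, hle⟩ := (closure_ge (fun x hx => by obtain ⟨ws, _, _, h3⟩ := hx; exact h3) (X.seg k τ)).2 hne
  obtain ⟨a, b, ha, hb, e, hp⟩ := X.segset k τ hy
  exact ⟨a, b, ha, hb, by rwa [← e], by rwa [← e]⟩

lemma det_eq (X : Ctx A C h) (w : Fin N → Fin N → ℤ) (hg : ∀ i, Good Φ (toR (w i))) :
    C.Psi ∅ (List.ofFn fun i => hseg Φ (toR (w i))) = ((|(Matrix.of w).det| : ℤ) : ℝ) := by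
  rw [Psi_empty]; exact seg_det X.hN X.vol w hg

lemma one_le (w : Fin N → Fin N → ℤ) (X : Ctx A C h) (hg : ∀ i, Good Φ (toR (w i)))
    (hne : C.Psi ∅ (List.ofFn fun i => hseg Φ (toR (w i))) ≠ 0) :
    1 ≤ C.Psi ∅ (List.ofFn fun i => hseg Φ (toR (w i))) := by
  rw [X.det_eq w hg] at hne ⊢
  have h1 : |(Matrix.of w).det| ≠ 0 := by exact_mod_cast hne
  have h2 : 0 ≤ |(Matrix.of w).det| := abs_nonneg _
  have : 1 ≤ |(Matrix.of w).det| := by omega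
  exact_mod_cast this

lemma nat (X : Ctx A C h) (b : Fin N → Fin N) : ∃ m : ℕ, MV (fun s => A (b s)) = m := by
  rw [X.MV_eq b, ← Psi_empty]
  have := X.seg b ∅
  generalize C.Psi ∅ (List.ofFn fun s => h (b s)) = x at this ⊢
  induction this using AddSubmonoid.closure_induction with
  | mem x hx =>
    obtain ⟨a, b, ha, hb, e, hp⟩ := X.segset _ _ hx
    have := X.det_eq (fun s => b s - a s) (fun s => by rw [toR_sub]; exact X.good _ _ (ha s) _ (hb s))
    simp only [toR_sub] at this
    rw [this] at e
    refine ⟨(|(Matrix.of (fun s => b s - a s)).det|).toNat, ?_⟩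
    rw [e]
    rw [← Int.cast_natCast, Int.toNat_of_nonneg (abs_nonneg _)]
  | zero => exact ⟨0, by simp⟩
  | add x y _ _ hx hy =>
    obtain ⟨m, rfl⟩ := hx
    obtain ⟨n, rfl⟩ := hy
    exact ⟨m + n, by simp⟩

/-- independent transversals from positivity -/
lemma indep_of_pos (X : Ctx A C h) (b : Fin N → Fin N) (hp : MV (fun s => A (b s)) ≠ 0) :
    ∃ p q : Fin N → Fin N → ℤ, (∀ s, p s ∈ A (b s)) ∧ (∀ s, q s ∈ A (b s)) ∧
      LinearIndependent ℝ (fun s => toR (q s) - toR (p s)) := by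
  rw [X.MV_eq b, ← Psi_empty] at hp
  obtain ⟨p, q, hp', hq, h1, h2⟩ := X.exists_seg b ∅ hp
  refine ⟨p, q, hp', hq, ?_⟩
  have := X.det_eq (fun s => q s - p s) (fun s => by rw [toR_sub]; exact X.good _ _ (hp' s) _ (hq s))
  simp only [toR_sub] at this
  rw [this] at h1
  have hd : (Matrix.of (fun s => q s - p s)).det ≠ 0 := by
    intro h0; rw [h0] at h1; simp at h1
  have h3 := (Int.castRingHom ℝ).map_det (Matrix.of (fun s => q s - p s))
  have : IsUnit ((Int.castRingHom ℝ).mapMatrix (Matrix.of (fun s => q s - p s))).det := by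
    rw [← h3, isUnit_iff_ne_zero]
    simpa using hd
  rw [← Matrix.isUnit_iff_isUnit_det] at this
  have h4 := Matrix.linearIndependent_rows_of_isUnit this
  have h5 : ((Int.castRingHom ℝ).mapMatrix (Matrix.of (fun s => q s - p s))).row = fun s => toR (q s) - toR (p s) := by
    funext s j
    simp [toR, Matrix.row]
  rw [h5] at h4
  exact h4

lemma ge_one_of_indep (X : Ctx A C h) (b : Fin N → Fin N) (p q : Fin N → Fin N → ℤ) (hp : ∀ s, p s ∈ A (b s))
    (hq : ∀ s, q s ∈ A (b s)) (hli : LinearIndependent ℝ (fun s => toR (q s) - toR (p s))) :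
    1 ≤ MV (fun s => A (b s)) := by
  have hgd : ∀ s, Good Φ (toR (q s) - toR (p s)) := fun s => X.good _ _ (hp s) _ (hq s)
  rw [X.MV_eq b]
  refine le_trans ?_ (seg_lower (C := C) (K := fun s => toR '' (A (b s) : Set (Fin N → ℤ))) (h := fun s => h (b s))
    (fun s => X.sp (b s)) (a := fun s => toR (p s)) (b := fun s => toR (q s))
    (fun s => ⟨_, hp s, rfl⟩) (fun s => ⟨_, hq s, rfl⟩) hgd)
  rw [← Psi_empty]
  have := X.one_le (fun s => q s - p s) (fun s => by rw [toR_sub]; exact hgd s)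
  have h2 := X.det_eq (fun s => q s - p s) (fun s => by rw [toR_sub]; exact hgd s)
  simp only [toR_sub] at this h2
  apply this
  rw [h2]
  have hu : IsUnit (Matrix.of (fun s => toR (q s) - toR (p s))) := by
    rw [← Matrix.linearIndependent_rows_iff_isUnit]
    exact hli
  rw [Matrix.isUnit_iff_isUnit_det, isUnit_iff_ne_zero] at hu
  intro h0
  apply hu
  have h3 := (Int.castRingHom ℝ).map_det (Matrix.of (fun s => q s - p s))
  have h5 : (Matrix.of (fun s => q s - p s)).det = 0 := by
    have : |(Matrix.of (fun s => q s - p s)).det| = 0 := by exact_mod_cast h0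
    exact abs_eq_zero.1 this
  rw [h5] at h3
  simp only [map_zero] at h3
  rw [h3]
  congr 1
  ext s j
  simp [toR]

end Ctx
end Esterov

open scoped Matrix
open Pointwise MeasureTheory
set_option linter.all false
namespace Esterov

section rado
variable {V : Type*} [AddCommGroup V] [Module ℝ V] [FiniteDimensional ℝ V] {κ : Type*} [Fintype κ] [DecidableEq κ] [DecidableEq V]

/-- joint span -/
noncomputable def spn (X : κ → Finset V) (S : Finset κ) : Submodule ℝ V := S.sup fun i => Submodule.span ℝ (X i : Set V)

/-- joint rank -/
noncomputable def rkk (X : κ → Finset V) (S : Finset κ) : ℕ := Module.finrank ℝ (spn X S)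

lemma spn_le_iff {X : κ → Finset V} {S : Finset κ} {W : Submodule ℝ V} :
    spn X S ≤ W ↔ ∀ i ∈ S, ∀ x ∈ X i, x ∈ W := by
  unfold spn
  rw [Finset.sup_le_iff]
  simp only [Submodule.span_le]
  rfl

lemma mem_spn {X : κ → Finset V} {S : Finset κ} {i : κ} (hi : i ∈ S) {x : V} (hx : x ∈ X i) : x ∈ spn X S :=
  spn_le_iff.1 (le_refl (spn X S)) i hi x hx

lemma spn_mono {X : κ → Finset V} {S T : Finset κ} (h : S ⊆ T) : spn X S ≤ spn X T :=
  spn_le_iff.2 fun i hi x hx => mem_spn (h hi) hx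

lemma rkk_mono {X : κ → Finset V} {S T : Finset κ} (h : S ⊆ T) : rkk X S ≤ rkk X T :=
  Submodule.finrank_mono (spn_mono h)

lemma rkk_submod (X : κ → Finset V) (S T : Finset κ) : rkk X (S ∪ T) + rkk X (S ∩ T) ≤ rkk X S + rkk X T := by
  unfold rkk
  rw [← Submodule.finrank_sup_add_finrank_inf_eq (spn X S) (spn X T)]
  refine add_le_add (Submodule.finrank_mono ?_) (Submodule.finrank_mono ?_)
  · unfold spn; rw [Finset.sup_union]
  · exact le_inf (spn_mono Finset.inter_subset_left) (spn_mono Finset.inter_subset_right)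

theorem rado (m : ℕ) (X : κ → Finset V) (hm : ∑ i, (X i).card = m) (hX : ∀ S, S.card ≤ rkk X S) :
    ∃ x : κ → V, (∀ i, x i ∈ X i) ∧ LinearIndependent ℝ x := by
  induction m using Nat.strong_induction_on generalizing X with
  | _ m ih =>
  have hne : ∀ i, (X i).Nonempty := by
    intro i
    rw [Finset.nonempty_iff_ne_empty]
    intro h
    have h1 := hX {i}
    have : spn X {i} = ⊥ := by simp [spn, h]
    rw [rkk, this] at h1
    simp at h1
  by_cases hall : ∀ i, (X i).card ≤ 1
  · choose x hx using hne
    refine ⟨x, hx, ?_⟩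
    rw [linearIndependent_iff_card_le_finrank_span]
    have h1 := hX Finset.univ
    rw [Finset.card_univ] at h1
    refine h1.trans (Submodule.finrank_mono (spn_le_iff.2 ?_))
    intro i _ y hy
    rw [Finset.card_le_one.1 (hall i) y hy (x i) (hx i)]
    exact Submodule.subset_span ⟨i, rfl⟩
  · push Not at hall
    obtain ⟨i, hi⟩ := hall
    obtain ⟨x1, hx1, x2, hx2, hne12⟩ := Finset.one_lt_card.1 hi
    have key : ∀ x ∈ X i, (∀ S, S.card ≤ rkk (Function.update X i ((X i).erase x)) S) →
        ∃ x : κ → V, (∀ i, x i ∈ X i) ∧ LinearIndependent ℝ x := by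
      intro x hx hS
      obtain ⟨y, hy, hl⟩ := ih _ (by
        rw [← hm]
        refine Finset.sum_lt_sum (fun j _ => ?_) ⟨i, Finset.mem_univ _, ?_⟩
        · by_cases hj : j = i
          · subst hj; simp [Finset.card_erase_le]
          · simp [hj]
        · simp only [Function.update_self]
          exact Finset.card_erase_lt_of_mem hx) _ rfl hS
      refine ⟨y, fun j => ?_, hl⟩
      have := hy j
      by_cases hj : j = i
      · subst hj
        simp only [Function.update_self] at this
        exact Finset.mem_of_mem_erase this
      · simpa [hj] using this
    by_contra hcon
    have h1 := not_imp_not.2 (key x1 hx1) hcon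
    have h2 := not_imp_not.2 (key x2 hx2) hcon
    push Not at h1 h2
    obtain ⟨S, hS⟩ := h1
    obtain ⟨T, hT⟩ := h2
    have hmem : ∀ (x : V) (S : Finset κ), rkk (Function.update X i ((X i).erase x)) S < S.card → i ∈ S := by
      intro x S hS
      by_contra hn
      have : rkk (Function.update X i ((X i).erase x)) S = rkk X S := by
        unfold rkk spn
        have : S.sup (fun j => Submodule.span ℝ ((Function.update X i ((X i).erase x) j : Finset V) : Set V)) =
          S.sup (fun j => Submodule.span ℝ ((X j : Finset V) : Set V)) := by
          refine Finset.sup_congr rfl fun j hj => ?_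
          have : j ≠ i := fun e => hn (e ▸ hj)
          simp [this]
        rw [this]
      rw [this] at hS
      exact absurd (hX S) (by omega)
    have hiS := hmem x1 S hS
    have hiT := hmem x2 T hT
    unfold rkk at hS hT
    set W1 := spn (Function.update X i ((X i).erase x1)) S with hW1
    set W2 := spn (Function.update X i ((X i).erase x2)) T with hW2
    have e := Submodule.finrank_sup_add_finrank_inf_eq W1 W2
    have hm1 : ∀ j ∈ S, j ≠ i → ∀ x ∈ X j, x ∈ W1 := fun j hj hji x hx => mem_spn hj (by simpa [hji] using hx)
    have hm2 : ∀ j ∈ T, j ≠ i → ∀ x ∈ X j, x ∈ W2 := fun j hj hji x hx => mem_spn hj (by simpa [hji] using hx)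
    have hs1 : rkk X (S ∪ T) ≤ Module.finrank ℝ (W1 ⊔ W2 : Submodule ℝ V) := by
      refine Submodule.finrank_mono (spn_le_iff.2 fun j hj x hx => ?_)
      by_cases hji : j = i
      · subst hji
        by_cases hx1 : x = x1
        · exact Submodule.mem_sup_right (mem_spn hiT (by
            simp only [Function.update_self, Finset.mem_erase]
            exact ⟨by rw [hx1]; exact hne12, hx⟩))
        · exact Submodule.mem_sup_left (mem_spn hiS (by
            simp only [Function.update_self, Finset.mem_erase]
            exact ⟨hx1, hx⟩))
      · rcases Finset.mem_union.1 hj with h | h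
        · exact Submodule.mem_sup_left (hm1 j h hji x hx)
        · exact Submodule.mem_sup_right (hm2 j h hji x hx)
    have hs2 : rkk X ((S ∩ T).erase i) ≤ Module.finrank ℝ (W1 ⊓ W2 : Submodule ℝ V) := by
      refine Submodule.finrank_mono (spn_le_iff.2 fun j hj x hx => ?_)
      obtain ⟨hji, hj⟩ := Finset.mem_erase.1 hj
      obtain ⟨hj1, hj2⟩ := Finset.mem_inter.1 hj
      exact ⟨hm1 j hj1 hji x hx, hm2 j hj2 hji x hx⟩
    have a1 := hX (S ∪ T)
    have a2 := hX ((S ∩ T).erase i)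
    rw [Finset.card_erase_of_mem (Finset.mem_inter.2 ⟨hiS, hiT⟩)] at a2
    have a3 := Finset.card_union_add_card_inter S T
    have a4 : 0 < (S ∩ T).card := Finset.card_pos.2 ⟨i, Finset.mem_inter.2 ⟨hiS, hiT⟩⟩
    omega
end rado

lemma linIndep_toR {N : ℕ} {κ : Type*} {v : κ → Fin N → ℤ} (hv : LinearIndependent ℤ v) :
    LinearIndependent ℝ (fun k => toR (v k)) := by
  have h1 : LinearIndependent ℝ (fun k => (1 : ℝ) ⊗ₜ[ℤ] (v k)) := Module.Flat.linearIndependent_one_tmul hv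
  have h2 := h1.map' (TensorProduct.piScalarRight ℤ ℝ ℝ (Fin N)).toLinearMap
    (LinearMap.ker_eq_bot.2 (TensorProduct.piScalarRight ℤ ℝ ℝ (Fin N)).injective)
  have e : (fun k => toR (v k)) = (TensorProduct.piScalarRight ℤ ℝ ℝ (Fin N)).toLinearMap ∘ (fun k => (1 : ℝ) ⊗ₜ[ℤ] (v k)) := by
    funext k j
    simp [toR]
  rw [e]
  exact h2

/-- real difference set -/
noncomputable def DX {N : ℕ} (A : Fin N → Finset (Fin N → ℤ)) (i : Fin N) : Finset (Fin N → ℝ) := by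
  classical exact (A i ×ˢ A i).image fun p => toR p.2 - toR p.1

lemma mem_DX {N : ℕ} {A : Fin N → Finset (Fin N → ℤ)} {i : Fin N} {x : Fin N → ℝ} :
    x ∈ DX A i ↔ ∃ a ∈ A i, ∃ b ∈ A i, x = toR b - toR a := by
  classical
  unfold DX
  simp only [Finset.mem_image, Finset.mem_product, Prod.exists]
  constructor
  · rintro ⟨a, b, ⟨ha, hb⟩, rfl⟩; exact ⟨a, ha, b, hb, rfl⟩
  · rintro ⟨a, ha, b, hb, rfl⟩; exact ⟨a, b, ⟨ha, hb⟩, rfl⟩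

lemma irr_rk {N : ℕ} {A : Fin N → Finset (Fin N → ℤ)} (hA : IsIrreducibleTuple A) (I : Finset (Fin N))
    (h0 : 0 < I.card) (h1 : I.card < N) : I.card + 1 ≤ rkk (DX A) I := by
  by_contra hc
  apply hA
  set W := spn (DX A) I with hW
  set tR : (Fin N → ℤ) →ₗ[ℤ] (Fin N → ℝ) := 
    { toFun := toR, map_add' := toR_add, map_smul' := fun c x => by ext j; simp [toR] } with htR
  set L : Submodule ℤ (Fin N → ℤ) := (W.restrictScalars ℤ).comap tR with hL
  refine ⟨I, L, h0, h1, ?_, ?_⟩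
  · have hfr : Module.finrank ℤ L ≤ Module.finrank ℝ W := by
      have b := Module.finBasis ℤ L
      have li : LinearIndependent ℤ (fun k => ((b k : L) : Fin N → ℤ)) :=
        b.linearIndependent.map' L.subtype (Submodule.ker_subtype L)
      have li2 := linIndep_toR li
      have li3 : LinearIndependent ℝ (fun k => (⟨toR (b k), (b k).2⟩ : W)) := by
        apply LinearIndependent.of_comp W.subtype
        exact li2
      simpa using li3.fintype_card_le_finrank
    have : Module.finrank ℝ W < I.card + 1 := not_le.1 hc
    omega
  · intro i hi
    by_cases hne : (A i).Nonempty
    · obtain ⟨v, hv⟩ := hne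
      refine ⟨v, fun a ha => ?_⟩
      change toR (a - v) ∈ W
      rw [toR_sub]
      exact mem_spn hi (mem_DX.2 ⟨v, hv, a, ha, rfl⟩)
    · exact ⟨0, fun a ha => absurd ⟨a, ha⟩ hne⟩

/-- real form of irreducibility -/
structure Irr {N : ℕ} (A : Fin N → Finset (Fin N → ℤ)) : Prop where
  hN : 2 ≤ N
  rk : ∀ I : Finset (Fin N), 0 < I.card → I.card < N → I.card + 1 ≤ rkk (DX A) I

namespace Irr
variable {N : ℕ} {A : Fin N → Finset (Fin N → ℤ)}

lemma ne (H : Irr A) (i : Fin N) : (A i).Nonempty := by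
  have := H.rk {i} (by simp) (by have := H.hN; simp; omega)
  rw [Finset.nonempty_iff_ne_empty]
  intro h
  have h0 : DX A i = ∅ := by
    rw [Finset.eq_empty_iff_forall_notMem]; intro x hx
    obtain ⟨a, ha, _⟩ := mem_DX.1 hx
    simp [h] at ha
  have h2 : spn (DX A) {i} = ⊥ := by simp [spn, h0]
  rw [rkk, h2] at this
  simp at this

lemma rk' (H : Irr A) (I : Finset (Fin N)) : I.card ≤ rkk (DX A) I := by
  rcases Nat.eq_zero_or_pos I.card with h | h
  · omega
  by_cases h1 : I.card < N
  · have := H.rk I h h1; omega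
  · have hI : I = Finset.univ := by
      apply Finset.eq_univ_of_card
      have := Finset.card_le_univ I
      simp at this ⊢
      omega
    have h0N : 0 < N := by have := H.hN; omega
    have := H.rk (I.erase ⟨0, h0N⟩) 
    have hc : (I.erase ⟨0, h0N⟩).card = N - 1 := by
      rw [Finset.card_erase_of_mem (by simp [hI])]
      simp [hI]
    rw [hc] at this
    have h2 := this (by have := H.hN; omega) (by omega)
    have h3 := rkk_mono (X := DX A) (Finset.erase_subset ⟨0, h0N⟩ I)
    have h4 := Finset.card_le_univ I
    simp at h4
    omega
end Irr
end Esterov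

open scoped Matrix
open Pointwise MeasureTheory
set_option linter.all false
namespace Esterov
open Fan Coef

section comb
variable {κ : Type*} [Fintype κ] [DecidableEq κ]

/-- number of entries in `S` -/
def cnt (L : List κ) (S : Finset κ) : ℕ := (L.map fun x => if x ∈ S then 1 else 0).sum

lemma cnt_cons (x : κ) (L : List κ) (S : Finset κ) : cnt (x :: L) S = (if x ∈ S then 1 else 0) + cnt L S := by
  simp [cnt]

lemma cnt_perm {L L' : List κ} (h : L.Perm L') (S : Finset κ) : cnt L S = cnt L' S :=
  (h.map _).sum_eq

lemma cnt_mod (L : List κ) (S T : Finset κ) : cnt L (S ∪ T) + cnt L (S ∩ T) = cnt L S + cnt L T := by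
  induction L with
  | nil => simp [cnt]
  | cons x L ih =>
    simp only [cnt_cons, Finset.mem_union, Finset.mem_inter]
    by_cases h1 : x ∈ S <;> by_cases h2 : x ∈ T <;> simp [h1, h2] <;> omega

lemma cnt_compl (L : List κ) (S : Finset κ) : cnt L S + cnt L Sᶜ = L.length := by
  induction L with
  | nil => simp [cnt]
  | cons x L ih =>
    simp only [cnt_cons, Finset.mem_compl, List.length_cons]
    by_cases h1 : x ∈ S <;> simp [h1] <;> omega

lemma cnt_ge (L : List κ) (S : Finset κ) (h : ∀ x ∈ S, x ∈ L) : S.card ≤ cnt L S := by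
  have : cnt L S = (L.filter (· ∈ S)).length := by
    clear h
    induction L with
    | nil => rfl
    | cons x L ih =>
      rw [cnt_cons, List.filter_cons]
      by_cases h1 : x ∈ S <;> simp [h1, ih]; omega
  rw [this]
  refine le_trans ?_ (List.toFinset_card_le _)
  apply Finset.card_le_card
  intro x hx
  simp [hx, h x hx]

/-- exchange -/
lemma exch (ρ : Finset κ → ℕ) (hsub : ∀ S T, ρ (S ∪ T) + ρ (S ∩ T) ≤ ρ S + ρ T)
    (hρ : ∀ S : Finset κ, 0 < S.card → S.card < Fintype.card κ → S.card + 1 ≤ ρ S)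
    (L : List κ) (i : κ) (hlen : (i :: L).length = Fintype.card κ) (hf : ∀ S, cnt (i :: L) S ≤ ρ S)
    (Z : Finset κ) (hZ : Z.Nonempty) (hiZ : i ∉ Z) (hZL : ∀ x, x ∉ Z → x ∈ i :: L) :
    ∃ k ∈ Z, ∀ S, cnt (k :: L) S ≤ ρ S := by
  by_contra hcon
  push Not at hcon
  have hbad : ∀ k ∈ Z, ∃ S, k ∈ S ∧ i ∉ S ∧ cnt (i :: L) S = ρ S := by
    intro k hk
    obtain ⟨S, hS⟩ := hcon k hk
    have h1 := hf S
    rw [cnt_cons] at hS h1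
    refine ⟨S, ?_, ?_, ?_⟩
    · by_contra h
      simp only [h, if_false] at hS
      split_ifs at h1 <;> omega
    · intro h
      simp only [h, if_true] at h1
      split_ifs at hS <;> omega
    · rw [cnt_cons]
      split_ifs at hS h1 ⊢ <;> omega
  choose! f hf1 hf2 hf3 using hbad
  have key : ∀ Y : Finset κ, Y ⊆ Z → Y.Nonempty → cnt (i :: L) (Y.sup f) = ρ (Y.sup f) := by
    intro Y
    induction Y using Finset.induction_on with
    | empty => intro _ h; simp at h
    | insert a Y ha ih =>
      intro hs _
      rw [Finset.sup_insert]
      by_cases hY : Y.Nonempty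
      · have h1 := ih (fun x hx => hs (by simp [hx])) hY
        have h2 := hf3 a (hs (by simp))
        have h3 := hsub (f a) (Y.sup f)
        have h4 := cnt_mod (i :: L) (f a) (Y.sup f)
        have h5 := hf (f a ∪ Y.sup f)
        have h6 := hf (f a ∩ Y.sup f)
        change cnt (i :: L) (f a ∪ Y.sup f) = ρ (f a ∪ Y.sup f)
        omega
      · rw [Finset.not_nonempty_iff_eq_empty] at hY
        subst hY
        simpa using hf3 a (hs (by simp))
  have ht := key Z (Finset.Subset.refl _) hZ
  set S := Z.sup f with hS
  have hiS : i ∉ S := by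
    rw [hS, Finset.mem_sup]
    rintro ⟨k, hk, hik⟩
    exact hf2 k hk hik
  have hZS : Z ⊆ S := by
    intro k hk
    rw [hS, Finset.mem_sup]
    exact ⟨k, hk, hf1 k hk⟩
  have c1 := cnt_compl (i :: L) S
  have c2 := cnt_ge (i :: L) Sᶜ (fun x hx => hZL x fun h => (Finset.mem_compl.1 hx) (hZS h))
  have c3 := Finset.card_compl S
  have c4 : S.card < Fintype.card κ := Finset.card_lt_univ_of_notMem hiS
  have c5 := hρ S (Finset.card_pos.2 (hZ.mono hZS)) c4
  omega
end comb

section lor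
variable {N : ℕ} {ι : Type} [Fintype ι] [DecidableEq ι] {Φ : Fan N ι} {C : Coef Φ}

lemma lor_real {K P Q : ℝ} (hP : 0 ≤ P) (hQ : 0 ≤ Q)
    (h : ∀ s t : ℝ, 0 ≤ s → 0 ≤ t → 2 * s * t * K ≤ (s * P + t * Q) ^ 2) : K ≤ 2 * P * Q := by
  rcases hP.eq_or_lt with h0 | hP
  · subst h0
    by_contra hc
    have hK : 0 < K := by simpa using hc
    have := h ((Q ^ 2 + 1) / K) 1 (by positivity) (by norm_num)
    rw [mul_one, mul_assoc, div_mul_cancel₀ _ hK.ne'] at this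
    nlinarith [sq_nonneg Q]
  rcases hQ.eq_or_lt with h0 | hQ
  · subst h0
    by_contra hc
    have hK : 0 < K := by simpa using hc
    have := h 1 ((P ^ 2 + 1) / K) (by norm_num) (by positivity)
    rw [mul_one, mul_assoc, div_mul_cancel₀ _ hK.ne'] at this
    nlinarith [sq_nonneg P]
  · have := h Q P hQ.le hP.le
    have hpq : 0 < P * Q := by positivity
    nlinarith

lemma lorentz {p q r : ι → ℝ} {L : List (ι → ℝ)} (hL : ∀ x ∈ L, x ∈ Φ.Tb) (hlen : L.length + 2 = N)
    (hp : p ∈ Φ.Tb) (hq : q ∈ Φ.Tb) (hr : r ∈ Φ.Tb) :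
    Phi C.c (p :: p :: L) * Phi C.c (q :: r :: L) ≤ 2 * Phi C.c (p :: q :: L) * Phi C.c (p :: r :: L) := by
  have nn : ∀ x y : ι → ℝ, x ∈ Φ.Tb → y ∈ Φ.Tb → 0 ≤ Phi C.c (x :: y :: L) := by
    intro x y hx hy
    rw [← Psi_empty]
    apply Psi_nonneg
    intro z hz
    simp only [List.mem_cons] at hz
    rcases hz with rfl | rfl | hz
    · exact hx
    · exact hy
    · exact hL z hz
  apply lor_real (nn p q hp hq) (nn p r hp hr)
  intro s t hs ht
  have h := C.AF hL hlen hp (x := s • q + t • r)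
  have sw : ∀ x y : ι → ℝ, Phi C.c (x :: y :: L) = Phi C.c (y :: x :: L) := fun x y => Phi_swap C.perm _ _ _
  have e1 : Phi C.c ((s • q + t • r) :: p :: L) = s * Phi C.c (p :: q :: L) + t * Phi C.c (p :: r :: L) := by
    rw [Phi_add, Phi_smul, Phi_smul, sw q p, sw r p]
  have e3 : ∀ z, Phi C.c (z :: (s • q + t • r) :: L) = s * Phi C.c (z :: q :: L) + t * Phi C.c (z :: r :: L) := by
    intro z
    rw [sw, Phi_add, Phi_smul, Phi_smul, sw q z, sw r z]
  have e2 : Phi C.c ((s • q + t • r) :: (s • q + t • r) :: L) =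
      s * (s * Phi C.c (q :: q :: L) + t * Phi C.c (q :: r :: L)) + t * (s * Phi C.c (q :: r :: L) + t * Phi C.c (r :: r :: L)) := by
    rw [Phi_add, Phi_smul, Phi_smul, e3, e3, sw r q]
  rw [e1, e2] at h
  refine le_trans ?_ h
  have n1 := nn q q hq hq
  have n2 := nn r r hr hr
  have n3 := nn p p hp hp
  have : 2 * s * t * (Phi C.c (p :: p :: L) * Phi C.c (q :: r :: L)) =
    (2 * s * t * Phi C.c (q :: r :: L)) * Phi C.c (p :: p :: L) := by ring
  rw [this]
  refine mul_le_mul_of_nonneg_right ?_ n3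
  nlinarith [mul_nonneg (mul_nonneg hs hs) n1, mul_nonneg (mul_nonneg ht ht) n2]
end lor
end Esterov

open scoped Matrix
open Pointwise MeasureTheory
set_option linter.all false
namespace Esterov
open Fan Coef

section
variable {N : ℕ} {A : Fin N → Finset (Fin N → ℤ)} {ι : Type} [Fintype ι] [DecidableEq ι]
    {Φ : Fan N ι} {C : Coef Φ} {h : Fin N → ι → ℝ}

lemma list_as_fn {L : List (Fin N)} (hl : L.length = N) : ∃ b : Fin N → Fin N, L = List.ofFn b := by
  refine ⟨fun s => L.get (s.cast hl.symm), ?_⟩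
  apply List.ext_get
  · simp [hl]
  · intro n h1 h2
    simp

lemma Ctx.MV_list (X : Ctx A C h) (b : Fin N → Fin N) : MV (fun s => A (b s)) = Phi C.c ((List.ofFn b).map h) := by
  rw [X.MV_eq, List.map_ofFn]; rfl

lemma cnt_ofFn (b : Fin N → Fin N) (S : Finset (Fin N)) :
    cnt (List.ofFn b) S = (Finset.univ.filter fun s => b s ∈ S).card := by
  rw [cnt, List.map_ofFn, List.sum_ofFn, Finset.card_filter]
  rfl

/-- feasible lists have positive mixed volume -/
lemma Ctx.ge_one (X : Ctx A C h) {L : List (Fin N)} (hl : L.length = N)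
    (hf : ∀ S, cnt L S ≤ rkk (DX A) S) : 1 ≤ Phi C.c (L.map h) := by
  classical
  obtain ⟨b, rfl⟩ := list_as_fn hl
  rw [← X.MV_list]
  obtain ⟨x, hx, hli⟩ := rado _ (fun s => DX A (b s)) rfl (by
    intro T
    have h1 := hf (T.image b)
    rw [cnt_ofFn] at h1
    have h2 : T.card ≤ (Finset.univ.filter fun s => b s ∈ T.image b).card := by
      apply Finset.card_le_card
      intro s hs
      simp only [Finset.mem_filter, Finset.mem_univ, true_and]
      exact Finset.mem_image_of_mem b hs
    refine h2.trans (h1.trans (Submodule.finrank_mono (spn_le_iff.2 ?_)))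
    intro i hi y hy
    obtain ⟨s, hs, rfl⟩ := Finset.mem_image.1 hi
    exact mem_spn (X := fun s => DX A (b s)) hs hy)
  have : ∀ s, ∃ p q, p ∈ A (b s) ∧ q ∈ A (b s) ∧ x s = toR q - toR p := by
    intro s
    obtain ⟨p, hp, q, hq, e⟩ := mem_DX.1 (hx s)
    exact ⟨p, q, hp, hq, e⟩
  choose p q hp hq e using this
  refine X.ge_one_of_indep b p q hp hq ?_
  have : x = fun s => toR (q s) - toR (p s) := funext e
  rwa [← this]

lemma Ctx.feas (X : Ctx A C h) {L : List (Fin N)} (hl : L.length = N) (hne : Phi C.c (L.map h) ≠ 0) :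
    ∀ S, cnt L S ≤ rkk (DX A) S := by
  classical
  obtain ⟨b, rfl⟩ := list_as_fn hl
  rw [← X.MV_list] at hne
  obtain ⟨p, q, hp, hq, hli⟩ := X.indep_of_pos b hne
  intro S
  rw [cnt_ofFn]
  have h1 : LinearIndependent ℝ (fun s : {s // b s ∈ S} =>
      (⟨toR (q s) - toR (p s), mem_spn s.2 (mem_DX.2 ⟨_, hp s, _, hq s, rfl⟩)⟩ : spn (DX A) S)) := by
    apply LinearIndependent.of_comp (spn (DX A) S).subtype
    exact hli.comp (fun s : {s // b s ∈ S} => (s : Fin N)) Subtype.val_injective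
  have := h1.fintype_card_le_finrank
  rwa [Fintype.card_subtype] at this

lemma Ctx.nonneg (X : Ctx A C h) (L : List (Fin N)) : 0 ≤ Phi C.c (L.map h) := by
  rw [← Psi_empty]
  apply Psi_nonneg
  intro x hx
  obtain ⟨i, _, rfl⟩ := List.mem_map.1 hx
  exact X.Tb i

/-- number of missing sets -/
def miss (L : List (Fin N)) : ℕ := (Finset.univ.filter fun j => j ∉ L).card

lemma two_split {L : List (Fin N)} (h : ¬ L.Nodup) : ∃ i L', L.Perm (i :: i :: L') := by
  rw [List.nodup_iff_count_le_one] at h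
  push Not at h
  obtain ⟨i, hi⟩ := h
  have h1 : i ∈ L := List.count_pos_iff.1 (by omega)
  have h2 := List.perm_cons_erase h1
  have h3 : i ∈ L.erase i := List.count_pos_iff.1 (by rw [List.count_erase_self]; omega)
  exact ⟨i, (L.erase i).erase i, h2.trans ((List.perm_cons_erase h3).cons i)⟩

lemma Ctx.bound (X : Ctx A C h) (H : Irr A) {V : ℝ} (hV : MV A = V) (hV1 : 1 ≤ V) (r : ℕ) :
    ∀ L : List (Fin N), L.length = N → miss L = r → Phi C.c (L.map h) ≤ 2 ^ (2 ^ r - 1) * V ^ (2 ^ r) := by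
  classical
  induction r with
  | zero =>
    intro L hl hr
    have hall : ∀ j, j ∈ L := by
      intro j
      by_contra hj
      have : j ∈ (Finset.univ.filter fun j => j ∉ L) := by simp [hj]
      rw [miss, Finset.card_eq_zero] at hr
      rw [hr] at this; simp at this
    have hp : (List.finRange N).Perm L := by
      apply List.Subperm.perm_of_length_le
      · exact (List.nodup_finRange N).subperm fun x _ => hall x
      · simp [hl]
    have := X.MV_list id
    simp only [id] at this
    have e : Phi C.c (L.map h) = V := by
      rw [← hV, show MV A = MV (fun s => A s) from rfl, this, List.ofFn_id]
      exact (Phi_perm (hp.map h) C.perm).symm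
    rw [e]; simp
  | succ r ih =>
    intro L hl hr
    by_cases h0 : Phi C.c (L.map h) = 0
    · rw [h0]; positivity
    have hfeas := X.feas hl h0
    set Z : Finset (Fin N) := Finset.univ.filter fun j => j ∉ L with hZ
    have hZc : Z.card = r + 1 := hr
    have hZm : ∀ x, x ∈ Z ↔ x ∉ L := fun x => by simp [hZ]
    have hnd : ¬ L.Nodup := by
      intro hn
      have h1 : L.toFinset.card = N := by rw [List.toFinset_card_of_nodup hn, hl]
      have h2 : L.toFinset = Finset.univ := Finset.eq_univ_of_card _ (by simpa using h1)
      have h3 : Z = ∅ := by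
        rw [Finset.eq_empty_iff_forall_notMem]
        intro x hx
        rw [hZm] at hx
        apply hx
        rw [← List.mem_toFinset, h2]; simp
      rw [h3] at hZc; simp at hZc
    obtain ⟨i, L', hp⟩ := two_split hnd
    have hl' : L'.length + 2 = N := by have := hp.length_eq; simp only [List.length_cons] at this; omega
    have hZne : Z.Nonempty := Finset.card_pos.1 (by omega)
    have hmem : ∀ x, x ∈ L ↔ x = i ∨ x ∈ L' := fun x => by rw [hp.mem_iff]; simp
    have hiZ : i ∉ Z := by rw [hZm, hmem]; simp
    have hρ : ∀ S : Finset (Fin N), 0 < S.card → S.card < Fintype.card (Fin N) → S.card + 1 ≤ rkk (DX A) S := by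
      intro S h1 h2
      exact H.rk S h1 (by simpa using h2)
    have hf1 : ∀ S, cnt (i :: i :: L') S ≤ rkk (DX A) S := fun S => by rw [← cnt_perm hp]; exact hfeas S
    obtain ⟨j, hj, hfj⟩ := exch (rkk (DX A)) (rkk_submod _) hρ (i :: L') i (by simp; omega) hf1 Z hZne hiZ
      (by intro x hx; rw [hZm, not_not, hmem] at hx; simpa using hx)
    have hf2 : ∀ S, cnt (i :: j :: L') S ≤ rkk (DX A) S := fun S => by
      rw [cnt_perm (List.Perm.swap j i L')]; exact hfj S
    obtain ⟨k, hk, hfk⟩ := exch (rkk (DX A)) (rkk_submod _) hρ (j :: L') i (by simp; omega) hf2 Z hZne hiZ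
      (by
        intro x hx; rw [hZm, not_not, hmem] at hx
        rcases hx with rfl | hx
        · simp
        · simp [hx])
    have hpos := X.ge_one (L := k :: j :: L') (by simp; omega) hfk
    have hmiss : ∀ m ∈ Z, miss (i :: m :: L') = r := by
      intro m hm
      have : (Finset.univ.filter fun x => x ∉ i :: m :: L') = Z.erase m := by
        ext x
        simp only [Finset.mem_filter, Finset.mem_univ, true_and, Finset.mem_erase, hZm, hmem, List.mem_cons]
        tauto
      rw [miss, this, Finset.card_erase_of_mem hm, hZc]; rfl
    have b1 := ih (i :: k :: L') (by simp; omega) (hmiss k hk)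
    have b2 := ih (i :: j :: L') (by simp; omega) (hmiss j hj)
    have lor := lorentz (C := C) (L := L'.map h) (p := h i) (q := h k) (r := h j) (by
      intro x hx
      obtain ⟨i, _, rfl⟩ := List.mem_map.1 hx
      exact X.Tb i) (by simpa using hl') (X.Tb i) (X.Tb k) (X.Tb j)
    simp only [List.map_cons] at b1 b2 hpos
    have e : Phi C.c (L.map h) = Phi C.c (h i :: h i :: L'.map h) := by
      rw [Phi_perm (hp.map h) C.perm]; simp
    rw [e]
    have n0 : 0 ≤ Phi C.c (h i :: h i :: L'.map h) := by rw [← e]; exact X.nonneg L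
    have n1 : 0 ≤ Phi C.c (h i :: h k :: L'.map h) := by simpa using X.nonneg (i :: k :: L')
    have n2 : 0 ≤ Phi C.c (h i :: h j :: L'.map h) := by simpa using X.nonneg (i :: j :: L')
    calc Phi C.c (h i :: h i :: L'.map h) ≤ Phi C.c (h i :: h i :: L'.map h) * Phi C.c (h k :: h j :: L'.map h) :=
          le_mul_of_one_le_right n0 hpos
      _ ≤ 2 * Phi C.c (h i :: h k :: L'.map h) * Phi C.c (h i :: h j :: L'.map h) := lor
      _ ≤ 2 * (2 ^ (2 ^ r - 1) * V ^ (2 ^ r)) * (2 ^ (2 ^ r - 1) * V ^ (2 ^ r)) := by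
          gcongr
      _ = 2 ^ (2 ^ (r + 1) - 1) * V ^ (2 ^ (r + 1)) := by
          have : 2 ^ (r + 1) - 1 = 1 + (2 ^ r - 1) + (2 ^ r - 1) := by
            have := Nat.one_le_two_pow (n := r)
            rw [pow_succ]; omega
          rw [this, pow_succ 2 r, pow_mul]
          ring

lemma Ctx.bound_two (X : Ctx A C h) (H : Irr A) (hV : 2 ≤ MV A) (b : Fin N → Fin N) :
    MV (fun s => A (b s)) ≤ MV A ^ (2 ^ N) := by
  rw [X.MV_list]
  have h1 := X.bound H rfl (by linarith) _ (List.ofFn b) (by simp) rfl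
  refine h1.trans ?_
  set r := miss (List.ofFn b) with hr
  have hrN : r + 1 ≤ N := by
    have : (Finset.univ.filter fun j => j ∉ List.ofFn b).card < Fintype.card (Fin N) := by
      apply Finset.card_lt_univ_of_notMem (x := b ⟨0, X.hN⟩)
      simp [List.mem_ofFn]
    simpa [miss, hr] using this
  calc (2:ℝ) ^ (2 ^ r - 1) * MV A ^ (2 ^ r) ≤ MV A ^ (2 ^ r - 1) * MV A ^ (2 ^ r) := by gcongr
    _ = MV A ^ (2 ^ r - 1 + 2 ^ r) := (pow_add _ _ _).symm
    _ ≤ MV A ^ (2 ^ N) := by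
      apply pow_le_pow_right₀ (by linarith)
      have : 2 ^ (r + 1) ≤ 2 ^ N := Nat.pow_le_pow_right (by norm_num) hrN
      rw [pow_succ] at this
      omega

lemma Irr.MV_ge (H : Irr A) (X : Ctx A C h) : 1 ≤ MV A := by
  have := X.MV_list id
  simp only [id] at this
  rw [show MV A = MV (fun s => A s) from rfl, this]
  apply X.ge_one (by simp)
  intro S
  rw [cnt_ofFn]
  simpa using H.rk' S
end
end Esterov

open scoped Matrix
open Pointwise MeasureTheory
set_option linter.all false
namespace Esterov
open Fan Coef

lemma exists_ctx_ext {N : ℕ} (hN : 0 < N) (A : Fin N → Finset (Fin N → ℤ)) (hne : ∀ i, (A i).Nonempty)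
    (F0 : Finset (Finset (Fin N → ℤ))) (hF0 : ∀ K ∈ F0, K.Nonempty) :
    ∃ (ι : Type) (_ : Fintype ι) (_ : DecidableEq ι) (Φ : Fan N ι) (C : Coef Φ) (h : Fin N → ι → ℝ),
      Ctx A C h ∧ ∀ K ∈ F0, ∃ g, Sp Φ K g := by
  classical
  set F : Finset (Finset (Fin N → ℤ)) := Finset.univ.image A ∪
    (Finset.univ.biUnion fun i => (A i ×ˢ A i).image fun p => {0, p.2 - p.1}) ∪
    Finset.univ.image (fun j : Fin N => {0, Pi.single j 1}) ∪ F0 with hF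
  obtain ⟨ι, i1, i2, Φ, C, h1, h2⟩ := master hN F (by
    intro K hK
    simp only [hF, Finset.mem_union, Finset.mem_image, Finset.mem_univ, true_and, Finset.mem_biUnion] at hK
    rcases hK with ((⟨i, rfl⟩ | ⟨i, p, hp, rfl⟩) | ⟨j, rfl⟩) | hK
    · exact hne i
    · simp
    · simp
    · exact hF0 K hK)
  have hA : ∀ i, ∃ h, Sp Φ (A i) h := fun i => h1 _ (by simp [hF])
  choose h hh using hA
  refine ⟨ι, i1, i2, Φ, C, h, ⟨hN, h2, hh, ?_, ?_⟩, fun K hK => h1 K (by simp [hF, hK])⟩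
  · intro i a ha b hb
    obtain ⟨g, hg⟩ := h1 {0, b - a} (by
      simp only [hF, Finset.mem_union, Finset.mem_image, Finset.mem_univ, true_and, Finset.mem_biUnion]
      exact Or.inl (Or.inl (Or.inr ⟨i, (a, b), by simp [ha, hb], rfl⟩)))
    have := Good.of_Sp hg
    rwa [toR_sub] at this
  · intro j
    obtain ⟨g, hg⟩ := h1 {0, Pi.single j 1} (by simp [hF])
    have := Good.of_Sp hg
    have e : toR (Pi.single j 1 : Fin N → ℤ) = Pi.single j 1 := by
      ext k; simp [toR, Pi.single_apply]
    rwa [e] at this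

section
variable {N : ℕ} {A : Fin N → Finset (Fin N → ℤ)} {ι : Type} [Fintype ι] [DecidableEq ι]
    {Φ : Fan N ι} {C : Coef Φ} {h : Fin N → ι → ℝ}

/-- all indices but one -/
def rest (l : Fin N) : List (Fin N) := (List.finRange N).erase l

lemma rest_perm (l : Fin N) : (List.finRange N).Perm (l :: rest l) :=
  List.perm_cons_erase (List.mem_finRange l)

lemma rest_notMem (l : Fin N) : l ∉ rest l := by
  intro hl
  have := (rest_perm l).nodup_iff.1 (List.nodup_finRange N)
  exact (List.nodup_cons.1 this).1 hl

lemma rest_length (l : Fin N) : (rest l).length + 1 = N := by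
  have := (rest_perm l).length_eq
  simpa using this.symm

/-- the mixed area measure -/
noncomputable def al (C : Coef Φ) (h : Fin N → ι → ℝ) (l : Fin N) (u : ι) : ℝ :=
  Phi C.c (ev u :: (rest l).map h)

lemma nu_eq (l : Fin N) (x : ι → ℝ) : Phi C.c (x :: (rest l).map h) = ∑ u, x u * al C h l u :=
  Phi_cons_ev _ _ _

lemma al_eq_Psi (l : Fin N) (u : ι) : al C h l u = C.Psi {u} ((rest l).map h) := by
  unfold al
  rw [← Psi_empty, Psi_insert (by simp)]
  rfl

lemma Ctx.restTb (X : Ctx A C h) (L : List (Fin N)) : ∀ x ∈ L.map h, x ∈ Φ.Tb := by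
  intro x hx
  obtain ⟨i, _, rfl⟩ := List.mem_map.1 hx
  exact X.Tb i

lemma Ctx.al_nonneg (X : Ctx A C h) (l : Fin N) (u : ι) : 0 ≤ al C h l u := by
  rw [al_eq_Psi]
  exact Psi_nonneg (X.restTb _) _

lemma face_of_al {l : Fin N} {u : ι} (hu : al C h l u ≠ 0) : Φ.Face {u} := by
  rw [al_eq_Psi] at hu
  exact face_of_ne hu

lemma Ctx.MV_upd (X : Ctx A C h) (l : Fin N) {Z : Finset (Fin N → ℤ)} {g : ι → ℝ} (hg : Sp Φ Z g) :
    MV (Function.update A l Z) = ∑ u, g u * al C h l u := by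
  rw [← nu_eq, Esterov.MV_eq X.hN X.vol _ (Function.update h l g)]
  · rw [← List.map_id (List.ofFn _), List.map_id, List.ofFn_eq_map]
    refine Phi_perm (((rest_perm l).map _).trans ?_) C.perm
    rw [List.map_cons, Function.update_self]
    have : (rest l).map (Function.update h l g) = (rest l).map h := by
      apply List.map_congr_left
      intro i hi
      rw [Function.update_of_ne]
      rintro rfl
      exact rest_notMem _ hi
    rw [this]
  · intro i
    by_cases hi : i = l
    · subst hi; simpa using hg
    · simp only [Function.update_of_ne hi]; exact X.sp i

lemma Ctx.MV_self (X : Ctx A C h) (l : Fin N) : MV A = ∑ u, h l u * al C h l u := by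
  rw [← X.MV_upd l (X.sp l), Function.update_eq_self]

/-- the mixed area measure does not depend on the omitted set -/
lemma Ctx.al_indep (X : Ctx A C h) (H : Irr A) (hV : MV A = 1) (k l : Fin N) (u : ι) :
    al C h k u = al C h l u := by
  classical
  by_cases hkl : k = l
  · rw [hkl]
  have hlk : l ∈ rest k := by
    have := (rest_perm k).mem_iff.1 (List.mem_finRange l)
    simpa [Ne.symm hkl] using this
  set M := (rest k).erase l with hM
  have p1 : (rest k).Perm (l :: M) := List.perm_cons_erase hlk
  have p2 : (rest l).Perm (k :: M) := by
    have a := (rest_perm l).symm.trans ((rest_perm k).trans (p1.cons k))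
    exact (List.perm_cons l).1 (a.trans (List.Perm.swap _ _ _))
  have pN : (List.finRange N).Perm (k :: l :: M) := (rest_perm k).trans (p1.cons k)
  have hlen : M.length + 2 = N := by
    have := pN.length_eq
    simp only [List.length_finRange, List.length_cons] at this
    omega
  have hndM : (k :: l :: M).Nodup := pN.nodup_iff.1 (List.nodup_finRange N)
  have e1 : Phi C.c (h k :: h l :: M.map h) = 1 := by
    have := X.MV_list id
    simp only [id] at this
    rw [← hV, show MV A = MV (fun s => A s) from rfl, this, List.ofFn_id]
    exact (Phi_perm (pN.map h) C.perm).symm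
  have hcM : ∀ S : Finset (Fin N), cnt (k :: l :: M) S = S.card := by
    intro S
    rw [← cnt_perm pN, ← List.ofFn_id, cnt_ofFn]
    simp
  have key : ∀ m, m = k ∨ m = l → 1 ≤ Phi C.c (h m :: h m :: M.map h) := by
    intro m hm
    refine X.ge_one (L := m :: m :: M) (by simp; omega) ?_
    intro S
    have h1 := hcM S
    rw [cnt_cons, cnt_cons] at h1 ⊢
    rcases Nat.eq_zero_or_pos S.card with h0 | h0
    · have : S = ∅ := Finset.card_eq_zero.1 h0
      subst this
      simp [cnt]
    by_cases h2 : S.card < N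
    · have h3 := H.rk S h0 h2
      rcases hm with rfl | rfl <;> split_ifs at * <;> omega
    · have hS : S = Finset.univ := by
        apply Finset.eq_univ_of_card
        have := Finset.card_le_univ S
        simp at this ⊢
        omega
      have h3 := H.rk' S
      subst hS
      simp at h1 h3 ⊢
      omega
  have hTb := X.restTb M
  have hl1 := key k (Or.inl rfl)
  have hl2 := key l (Or.inr rfl)
  have af1 := C.AF (L := M.map h) hTb (by simp [hlen]) (X.Tb l) (h k)
  rw [e1] at af1
  have ekk : Phi C.c (h k :: h k :: M.map h) = 1 := by nlinarith
  have ell : Phi C.c (h l :: h l :: M.map h) = 1 := by nlinarith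
  set x := h k - h l with hx
  have s1 : Phi C.c (x :: h k :: M.map h) = 0 := by
    rw [hx, Phi_sub, ekk, Phi_swap C.perm, e1]; ring
  have s2 : Phi C.c (x :: h l :: M.map h) = 0 := by
    rw [hx, Phi_sub, ell, e1]; ring
  have s3 : Phi C.c (x :: x :: M.map h) = 0 := by
    have : Phi C.c (x :: x :: M.map h) = Phi C.c (x :: h k :: M.map h) - Phi C.c (x :: h l :: M.map h) := by
      rw [Phi_swap C.perm x (h k), Phi_swap C.perm x (h l), ← Phi_sub]
    rw [this, s1, s2]; ring
  have main : Phi C.c (x :: ev u :: M.map h) = 0 := by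
    by_contra hne
    set q := Phi C.c (x :: ev u :: M.map h) with hq
    set e := Phi C.c (ev u :: ev u :: M.map h) with he
    set f := Phi C.c (ev u :: h k :: M.map h) with hf
    have H1 : ∀ s : ℝ, 2 * s * q + e ≤ f ^ 2 := by
      intro s
      have af := C.AF (L := M.map h) hTb (by simp [hlen]) (X.Tb k) (s • x + ev u)
      rw [ekk, mul_one] at af
      have a1 : Phi C.c ((s • x + ev u) :: (s • x + ev u) :: M.map h) = 2 * s * q + e := by
        rw [Phi_add, Phi_smul, Phi_swap C.perm x, Phi_add, Phi_smul, s3, Phi_swap C.perm (ev u) (s • x + ev u),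
          Phi_add, Phi_smul, Phi_swap C.perm (ev u) x]
        ring
      have a2 : Phi C.c ((s • x + ev u) :: h k :: M.map h) = f := by
        rw [Phi_add, Phi_smul, s1]; ring
      rw [a1, a2] at af
      exact af
    have := H1 ((f ^ 2 - e + 1) / (2 * q))
    have e2 : 2 * ((f ^ 2 - e + 1) / (2 * q)) * q = f ^ 2 - e + 1 := by field_simp
    linarith
  have r1 : al C h k u = Phi C.c (h l :: ev u :: M.map h) := by
    unfold al
    rw [Phi_perm ((p1.map h).cons (ev u)) C.perm, List.map_cons, Phi_swap C.perm]
  have r2 : al C h l u = Phi C.c (h k :: ev u :: M.map h) := by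
    unfold al
    rw [Phi_perm ((p2.map h).cons (ev u)) C.perm, List.map_cons, Phi_swap C.perm]
  rw [hx, Phi_sub] at main
  rw [r1, r2]; linarith
end
end Esterov

open scoped Matrix
open Pointwise MeasureTheory
set_option linter.all false
namespace Esterov
open Fan Coef

section
variable {N : ℕ} {A : Fin N → Finset (Fin N → ℤ)} {ι : Type} [Fintype ι] [DecidableEq ι]
    {Φ : Fan N ι} {C : Coef Φ} {h : Fin N → ι → ℝ}

lemma Ctx.one_le_list (X : Ctx A C h) {W : List (Fin N → ℤ)} (hl : W.length = N)
    (hg : ∀ w ∈ W, Good Φ (toR w)) (hne : C.Psi ∅ (W.map fun w => hseg Φ (toR w)) ≠ 0) :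
    1 ≤ C.Psi ∅ (W.map fun w => hseg Φ (toR w)) := by
  have : ∃ w : Fin N → Fin N → ℤ, W = List.ofFn w := by
    refine ⟨fun s => W.get (s.cast hl.symm), ?_⟩
    apply List.ext_get
    · simp [hl]
    · intro n h1 h2
      simp
  obtain ⟨w, rfl⟩ := this
  have e : (List.ofFn w).map (fun w => hseg Φ (toR w)) = List.ofFn fun i => hseg Φ (toR (w i)) := by
    rw [List.map_ofFn]; rfl
  rw [e] at hne ⊢
  exact X.one_le w (fun i => hg _ (by rw [List.mem_ofFn]; exact ⟨i, rfl⟩)) hne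

/-- integrality of the mixed area measure -/
lemma Ctx.term_ge (X : Ctx A C h) (k : Fin N) {a b : Fin N → ℤ} (ha : a ∈ A k) (hb : b ∈ A k) {u : ι}
    (hu : al C h k u ≠ 0) (hpos : 0 < Φ.vec u ⬝ᵥ (toR b - toR a)) :
    1 ≤ al C h k u * (Φ.vec u ⬝ᵥ (toR b - toR a)) := by
  have e : (rest k).map h = List.ofFn fun s : Fin (rest k).length => h ((rest k).get s) := by
    apply List.ext_get
    · simp
    · intro n h1 h2; simp
  rw [al_eq_Psi, e] at hu ⊢
  obtain ⟨p, q, hp, hq, h1, h2⟩ := X.exists_seg _ {u} hu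
  set W : List (Fin N → ℤ) := List.ofFn fun s => q s - p s with hW
  have e2 : (List.ofFn fun s => hseg Φ (toR (q s) - toR (p s))) = (W.map toR).map (hseg Φ) := by
    rw [hW, List.map_ofFn, List.map_ofFn]
    congr 1; funext s; simp [toR_sub]
  have hgW : ∀ w ∈ W, Good Φ (toR w) := by
    intro w hw
    rw [hW, List.mem_ofFn] at hw
    obtain ⟨s, rfl⟩ := hw
    simp only [toR_sub]
    exact X.good _ _ (hp s) _ (hq s)
  rw [e2] at h1 h2
  have st := seg_step (C := C) (τ := ∅) (u := u) (by simp) (w := toR b - toR a) (by simp) hpos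
    (ws := W.map toR) (by
      intro w hw
      obtain ⟨v, hv, rfl⟩ := List.mem_map.1 hw
      exact hgW v hv) (by rw [insert_empty_eq]; exact h1.ne')
  rw [insert_empty_eq] at st
  have e3 : (((toR b - toR a) :: W.map toR).map (hseg Φ)) = ((b - a) :: W).map fun w => hseg Φ (toR w) := by
    simp [toR_sub, Function.comp_def]
  rw [e3] at st
  have o := X.one_le_list (W := (b - a) :: W) (by
      have := rest_length k
      simp [hW]; omega) (by
      intro w hw
      rcases List.mem_cons.1 hw with rfl | hw
      · rw [toR_sub]; exact X.good _ _ ha _ hb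
      · exact hgW w hw) (by rw [st]; positivity)
  rw [st] at o
  nlinarith

lemma Ctx.seg_tot (X : Ctx A C h) (k : Fin N) {a b : Fin N → ℤ} (ha : a ∈ A k) (hb : b ∈ A k) :
    ∑ u, hseg Φ (toR b - toR a) u * al C h k u ≤ MV A := by
  rw [X.MV_self k, ← nu_eq, ← nu_eq]
  have h1 : Phi C.c ((hseg Φ (toR b - toR a) + Φ.ell (toR a)) :: (rest k).map h) ≤ Phi C.c (h k :: (rest k).map h) := by
    apply Phi_le_cons _ (X.restTb _)
    intro u _
    exact seg_le (X.sp k) (Set.mem_image_of_mem _ ha) (Set.mem_image_of_mem _ hb) u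
  rw [Phi_add, ← Psi_empty (Φ.ell _ :: _), Psi_ker, add_zero] at h1
  exact h1

lemma hseg_nonneg (w : Fin N → ℝ) (u : ι) : 0 ≤ hseg Φ w u := le_max_left _ _

/-- the values are zero or one -/
lemma Ctx.term_eq (X : Ctx A C h) (hV : MV A = 1) (k : Fin N) {a b : Fin N → ℤ} (ha : a ∈ A k) (hb : b ∈ A k) {u : ι}
    (hnn : 0 ≤ Φ.vec u ⬝ᵥ (toR b - toR a)) :
    al C h k u * (Φ.vec u ⬝ᵥ (toR b - toR a)) = 0 ∨ al C h k u * (Φ.vec u ⬝ᵥ (toR b - toR a)) = 1 := by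
  by_cases hu : al C h k u = 0
  · left; rw [hu, zero_mul]
  rcases hnn.eq_or_lt with h0 | h0
  · left; rw [← h0, mul_zero]
  right
  have h1 := X.term_ge k ha hb hu h0
  have h2 := X.seg_tot k ha hb
  have h3 : hseg Φ (toR b - toR a) u * al C h k u ≤ ∑ u, hseg Φ (toR b - toR a) u * al C h k u :=
    Finset.single_le_sum (f := fun u => hseg Φ (toR b - toR a) u * al C h k u)
      (fun v _ => mul_nonneg (hseg_nonneg _ _) (X.al_nonneg k v)) (Finset.mem_univ u)
  have h4 : hseg Φ (toR b - toR a) u = Φ.vec u ⬝ᵥ (toR b - toR a) := max_eq_right h0.le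
  rw [h4] at h3
  rw [mul_comm] at h3
  linarith

/-- every point of `A k` is deficient in exactly one direction -/
lemma Ctx.phi_exists (X : Ctx A C h) (hV : MV A = 1) (k : Fin N) {a : Fin N → ℤ} (ha : a ∈ A k) :
    ∃ r : ι, ∀ u, al C h k u * h k u - al C h k u * (Φ.vec u ⬝ᵥ toR a) = if u = r then 1 else 0 := by
  set d : ι → ℝ := fun u => al C h k u * h k u - al C h k u * (Φ.vec u ⬝ᵥ toR a) with hd
  have h01 : ∀ u, d u = 0 ∨ d u = 1 := by
    intro u
    by_cases hu : al C h k u = 0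
    · left; simp [hd, hu]
    obtain ⟨b', hb', e⟩ := (X.sp k).exists_eq (face_of_al hu)
    obtain ⟨b, hb, rfl⟩ := hb'
    have := X.term_eq hV k ha hb (u := u) (by
      rw [dotProduct_sub, e]
      have := (X.sp k).1 _ (Set.mem_image_of_mem _ ha) u
      linarith)
    rw [dotProduct_sub, e, mul_sub] at this
    exact this
  have hsum : ∑ u, d u = 1 := by
    rw [hd, Finset.sum_sub_distrib]
    have e1 := X.MV_self k
    have e2 := nu_eq (C := C) (h := h) k (Φ.ell (toR a))
    rw [← Psi_empty, Psi_ker] at e2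
    have e3 : ∑ u, al C h k u * h k u = 1 := by
      rw [← hV, e1]; exact Finset.sum_congr rfl fun u _ => mul_comm _ _
    have e4 : ∑ u, al C h k u * (Φ.vec u ⬝ᵥ toR a) = 0 := by
      rw [e2]; exact Finset.sum_congr rfl fun u _ => mul_comm _ _
    rw [e3, e4, sub_zero]
  have hex : ∃ r, d r = 1 := by
    by_contra hc
    push Not at hc
    have : ∑ u, d u = 0 := Finset.sum_eq_zero fun u _ => (h01 u).resolve_right (hc u)
    linarith
  obtain ⟨r, hr⟩ := hex
  refine ⟨r, fun u => ?_⟩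
  show d u = _
  split_ifs with hur
  · rw [hur, hr]
  · rw [← Finset.add_sum_erase _ _ (Finset.mem_univ r), hr] at hsum
    have h0 : ∑ u ∈ Finset.univ.erase r, d u = 0 := by linarith
    have := (Finset.sum_eq_zero_iff_of_nonneg (fun v _ => by rcases h01 v with e | e <;> rw [e] <;> norm_num)).1 h0 u
    exact this (by simp [hur])

/-- positivity of segments -/
lemma Ctx.seg_pos (X : Ctx A C h) (H : Irr A) (k : Fin N) {a b : Fin N → ℤ} (ha : a ∈ A k) (hb : b ∈ A k)
    (hab : a ≠ b) : ∑ u, hseg Φ (toR b - toR a) u * al C h k u ≠ 0 := by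
  classical
  set Y : Fin N → Finset (Fin N → ℝ) := Function.update (DX A) k {toR b - toR a} with hY
  have hw : toR b - toR a ≠ 0 := by
    intro h0
    exact hab (toR_inj (sub_eq_zero.1 h0)).symm
  obtain ⟨x, hx, hli⟩ := rado _ Y rfl (by
    intro S
    have hle : rkk (DX A) (S.erase k) ≤ rkk Y S := by
      apply Submodule.finrank_mono
      rw [spn_le_iff]
      intro i hi y hy
      have hik : i ≠ k := Finset.ne_of_mem_erase hi
      exact mem_spn (Finset.mem_of_mem_erase hi) (by rw [hY, Function.update_of_ne hik]; exact hy)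
    by_cases hk : k ∈ S
    · have hc : (S.erase k).card + 1 = S.card := Finset.card_erase_add_one hk
      rcases Nat.eq_zero_or_pos (S.erase k).card with h0 | h0
      · have : 0 < rkk Y S := by
          rw [rkk, Module.finrank_pos_iff_exists_ne_zero]
          refine ⟨⟨toR b - toR a, mem_spn hk (by simp [hY])⟩, ?_⟩
          intro h0
          exact hw (congrArg Subtype.val h0)
        omega
      · have := H.rk (S.erase k) h0 (by
          have := Finset.card_le_univ S
          simp at this
          omega)
        omega
    · rw [Finset.erase_eq_of_notMem hk] at hle
      exact (H.rk' S).trans hle)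
  have : ∀ s, ∃ p q, p ∈ A s ∧ q ∈ A s ∧ x s = toR q - toR p ∧ (s = k → p = a ∧ q = b) := by
    intro s
    have := hx s
    by_cases hs : s = k
    · subst hs
      simp [hY] at this
      exact ⟨a, b, ha, hb, this, fun _ => ⟨rfl, rfl⟩⟩
    · rw [hY, Function.update_of_ne hs] at this
      obtain ⟨p, hp, q, hq, e⟩ := mem_DX.1 this
      exact ⟨p, q, hp, hq, e, fun h => absurd h hs⟩
  choose p q hp hq e hpq using this
  have hx' : x = fun s => toR (q s) - toR (p s) := funext e
  rw [hx'] at hli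
  -- compare with the tuple where `A k` is replaced by the segment
  have hne : Phi C.c (List.ofFn fun s => hseg Φ (toR (q s) - toR (p s))) ≠ 0 := by
    have := X.det_eq (fun s => q s - p s) (fun s => by rw [toR_sub]; exact X.good _ _ (hp s) _ (hq s))
    simp only [toR_sub, Psi_empty] at this
    rw [this]
    have hd : (Matrix.of fun s => toR (q s) - toR (p s)).det ≠ 0 := by
      have := (Matrix.linearIndependent_rows_iff_isUnit (A := Matrix.of fun s => toR (q s) - toR (p s))).1 hli
      exact (Matrix.isUnit_iff_isUnit_det _).1 this |>.ne_zero
    have hd' : (Matrix.of fun s => q s - p s).det ≠ 0 := by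
      intro h0
      apply hd
      have := (Int.castRingHom ℝ).map_det (Matrix.of fun s => q s - p s)
      rw [h0, map_zero] at this
      rw [this]
      congr 1
      ext i j
      simp [toR]
    exact_mod_cast abs_ne_zero.2 hd'
  have hlow := seg_shift (C := C) (fun s => hseg Φ (toR (q s) - toR (p s))) (fun s => toR (p s)) []
  simp only [List.nil_append] at hlow
  have hTbs : ∀ s, hseg Φ (toR (q s) - toR (p s)) + Φ.ell (toR (p s)) ∈ Φ.Tb := by
    intro s
    have := (X.good s _ (hp s) _ (hq s)).Tb
    exact Tb_add this ((ell_Tb _))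
  have hmono := Psi_ofFn_mono (C := C) (f := fun s => hseg Φ (toR (q s) - toR (p s)) + Φ.ell (toR (p s)))
    (g := Function.update h k (hseg Φ (toR b - toR a) + Φ.ell (toR a))) (by
      intro s u _
      by_cases hs : s = k
      · subst hs
        obtain ⟨e1, e2⟩ := hpq s rfl
        simp [e1, e2]
      · rw [Function.update_of_ne hs]
        exact seg_le (X.sp s) (Set.mem_image_of_mem _ (hp s)) (Set.mem_image_of_mem _ (hq s)) u) hTbs (by
      intro s
      by_cases hs : s = k
      · subst hs
        have := hTbs s
        obtain ⟨e1, e2⟩ := hpq s rfl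
        simpa [e1, e2] using this
      · rw [Function.update_of_ne hs]; exact X.Tb s)
  have hfin : Phi C.c (List.ofFn (Function.update h k (hseg Φ (toR b - toR a) + Φ.ell (toR a)))) =
      ∑ u, hseg Φ (toR b - toR a) u * al C h k u := by
    rw [← nu_eq, List.ofFn_eq_map, Phi_perm ((rest_perm k).map _) C.perm, List.map_cons, Function.update_self]
    have : (rest k).map (Function.update h k (hseg Φ (toR b - toR a) + Φ.ell (toR a))) = (rest k).map h := by
      apply List.map_congr_left
      intro i hi
      rw [Function.update_of_ne]
      rintro rfl
      exact rest_notMem _ hi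
    rw [this, Phi_add, ← Psi_empty (Φ.ell _ :: _), Psi_ker, add_zero]
  have hnn : 0 ≤ Phi C.c (List.ofFn fun s => hseg Φ (toR (q s) - toR (p s))) := by
    rw [← Psi_empty]
    apply Psi_nonneg
    intro y hy
    obtain ⟨s, rfl⟩ := List.mem_ofFn.1 hy
    exact (X.good s _ (hp s) _ (hq s)).Tb
  rw [← hfin]
  have : 0 < Phi C.c (List.ofFn fun s => hseg Φ (toR (q s) - toR (p s))) := lt_of_le_of_ne hnn hne.symm
  rw [← hlow] at this
  exact (lt_of_lt_of_le this hmono).ne'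
end
end Esterov

open scoped Matrix
open Pointwise MeasureTheory
set_option linter.all false
namespace Esterov
open Fan Coef

section
variable {N : ℕ} {A : Fin N → Finset (Fin N → ℤ)} {ι : Type} [Fintype ι] [DecidableEq ι]
    {Φ : Fan N ι} {C : Coef Φ} {h : Fin N → ι → ℝ}

/-- the combinatorial structure of an irreducible tuple of mixed volume one -/
lemma Ctx.struct (X : Ctx A C h) (H : Irr A) (hV : MV A = 1) :
    ∃ (α : ι → ℝ) (φ : Fin N → (Fin N → ℤ) → ι), (∀ u, 0 ≤ α u) ∧ (∀ u, α u ≠ 0 → Φ.Face {u}) ∧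
      (∀ l Z g, Sp Φ Z g → MV (Function.update A l Z) = ∑ u, g u * α u) ∧
      (∀ k, ∀ a ∈ A k, ∀ u, α u * h k u - α u * (Φ.vec u ⬝ᵥ toR a) = if u = φ k a then 1 else 0) ∧
      ∀ k, ∀ a ∈ A k, ∀ b ∈ A k, φ k a = φ k b → a = b := by
  classical
  set l0 : Fin N := ⟨0, X.hN⟩
  have hal : ∀ l u, al C h l u = al C h l0 u := fun l u => X.al_indep H hV l l0 u
  have : ∀ k, ∀ a, ∃ r : ι, a ∈ A k → ∀ u, al C h l0 u * h k u - al C h l0 u * (Φ.vec u ⬝ᵥ toR a) = if u = r then 1 else 0 := by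
    intro k a
    obtain ⟨a', ha'⟩ := H.ne k
    by_cases ha : a ∈ A k
    · obtain ⟨r, hr⟩ := X.phi_exists hV k ha
      simp only [hal] at hr
      exact ⟨r, fun _ => hr⟩
    · obtain ⟨r, hr⟩ := X.phi_exists hV k ha'
      exact ⟨r, fun h => absurd h ha⟩
  choose φ hφ using this
  refine ⟨al C h l0, φ, X.al_nonneg l0, fun u hu => face_of_al hu, ?_, hφ, ?_⟩
  · intro l Z g hg
    rw [X.MV_upd l hg]
    simp only [hal]
  · intro k a ha b hb hab
    by_contra hne
    apply X.seg_pos H k ha hb hne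
    apply Finset.sum_eq_zero
    intro u _
    rw [hal]
    have h1 := hφ k a ha u
    have h2 := hφ k b hb u
    rw [hab] at h1
    have h3 : al C h l0 u * (Φ.vec u ⬝ᵥ (toR b - toR a)) = 0 := by
      rw [dotProduct_sub, mul_sub]; linarith
    rcases mul_eq_zero.1 h3 with h0 | h0
    · rw [h0, mul_zero]
    · simp [hseg, h0]

lemma Ctx.card_le (X : Ctx A C h) (H : Irr A) (hV : MV A = 1) (k : Fin N) : (A k).card ≤ N + 1 := by
  classical
  obtain ⟨α, φ, h1, h2, h3, h4, h5⟩ := X.struct H hV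
  have hli : LinearIndependent ℝ (fun a : A k => ((toR a.1, (1 : ℝ)) : (Fin N → ℝ) × ℝ)) := by
    rw [Fintype.linearIndependent_iff]
    intro g hg b
    have e1 : ∑ a : A k, g a • toR a.1 = 0 := by
      have := congrArg Prod.fst hg
      simpa [Prod.fst_sum] using this
    have e2 : ∑ a : A k, g a = 0 := by
      have := congrArg Prod.snd hg
      simpa [Prod.snd_sum] using this
    set r := φ k b.1 with hr
    have e3 : ∑ a : A k, g a * (α r * (Φ.vec r ⬝ᵥ toR a.1)) = 0 := by
      have : ∑ a : A k, g a * (α r * (Φ.vec r ⬝ᵥ toR a.1)) = α r * (Φ.vec r ⬝ᵥ ∑ a : A k, g a • toR a.1) := by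
        rw [dotProduct_sum, Finset.mul_sum]
        refine Finset.sum_congr rfl fun a _ => ?_
        rw [dotProduct_smul, smul_eq_mul]; ring
      rw [this, e1]; simp
    have e4 : ∀ a : A k, g a * (α r * (Φ.vec r ⬝ᵥ toR a.1)) = g a * (α r * h k r) - if a = b then g a else 0 := by
      intro a
      have := h4 k a.1 a.2 r
      by_cases hab : a = b
      · subst hab
        simp only [hr, if_true] at this ⊢
        rw [show α (φ k a.1) * (Φ.vec (φ k a.1) ⬝ᵥ toR a.1) = α (φ k a.1) * h k (φ k a.1) - 1 by linarith]
        ring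
      · have hn : ¬ r = φ k a.1 := by
          intro hh
          exact hab (Subtype.ext (h5 k _ a.2 _ b.2 hh.symm))
        rw [if_neg hn] at this
        rw [if_neg hab, show α r * (Φ.vec r ⬝ᵥ toR a.1) = α r * h k r by linarith]
        ring
    simp only [e4] at e3
    rw [Finset.sum_sub_distrib, ← Finset.sum_mul, e2] at e3
    simpa using e3
  have := hli.fintype_card_le_finrank
  simpa using this

end

lemma Irr.mono {N : ℕ} {A B : Fin N → Finset (Fin N → ℤ)} (H : Irr A) (hs : ∀ i, A i ⊆ B i) : Irr B := by
  refine ⟨H.hN, fun I h0 h1 => (H.rk I h0 h1).trans (Submodule.finrank_mono ?_)⟩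
  rw [spn_le_iff]
  intro i hi x hx
  obtain ⟨a, ha, b, hb, e⟩ := mem_DX.1 hx
  exact mem_spn hi (mem_DX.2 ⟨a, hs i ha, b, hs i hb, e⟩)

lemma MV_mono {N : ℕ} (hN : 0 < N) {A B : Fin N → Finset (Fin N → ℤ)} (hA : ∀ i, (A i).Nonempty)
    (hs : ∀ i, A i ⊆ B i) : MV A ≤ MV B := by
  classical
  obtain ⟨ι, _, _, Φ, C, h, X, hF⟩ := exists_ctx_ext hN B (fun i => (hA i).mono (hs i)) (Finset.univ.image A) (by
    intro K hK
    obtain ⟨i, _, rfl⟩ := Finset.mem_image.1 hK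
    exact hA i)
  have : ∀ i, ∃ g, Sp Φ (A i) g := fun i => hF _ (by simp)
  choose g hg using this
  rw [Esterov.MV_eq hN X.vol A g hg, Esterov.MV_eq hN X.vol B h X.sp]
  refine Psi_ofFn_mono ?_ (fun k => (hg k).Tb) X.Tb
  intro k u hu
  exact (hg k).le (X.sp k) (Set.image_mono (by exact_mod_cast hs k)) u hu

/-- a maximal tuple of mixed volume one -/
lemma max_case {N : ℕ} {A : Fin N → Finset (Fin N → ℤ)} (H : Irr A) (hV : MV A = 1)
    (hmax : ∀ l p, MV (Function.update A l (insert p (A l))) = 1 → p ∈ A l) (b : Fin N → Fin N) :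
    MV (fun s => A (b s)) ≤ 1 := by
  classical
  have hN : 0 < N := by have := H.hN; omega
  set U : Finset (Fin N → ℤ) := Finset.univ.biUnion A with hU
  have hUm : ∀ i, ∀ x ∈ A i, x ∈ U := fun i x hx => Finset.mem_biUnion.2 ⟨i, by simp, hx⟩
  obtain ⟨ι, _, _, Φ, C, h, X, hF⟩ := exists_ctx_ext hN A H.ne
    ((Finset.univ ×ˢ (U + U - U)).image fun x : Fin N × (Fin N → ℤ) => insert x.2 (A x.1)) (by
    intro K hK
    obtain ⟨i, _, rfl⟩ := Finset.mem_image.1 hK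
    exact Finset.insert_nonempty _ _)
  obtain ⟨α, φ, h1, h2, h3, h4, h5⟩ := X.struct H hV
  have trans : ∀ l k, ∀ c ∈ A l, ∀ a ∈ A k, φ l c = φ k a → ∀ x ∈ A k, c + x - a ∈ A l := by
    intro l k c hc a ha hca x hx
    apply hmax
    set p := c + x - a with hp
    obtain ⟨g, hg⟩ := hF (insert p (A l)) (by
      apply Finset.mem_image.2
      refine ⟨(l, p), ?_, rfl⟩
      rw [Finset.mem_product]
      exact ⟨by simp, Finset.sub_mem_sub (Finset.add_mem_add (hUm _ _ hc) (hUm _ _ hx)) (hUm _ _ ha)⟩)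
    rw [h3 l _ g hg, ← hV]
    have := h3 l _ _ (X.sp l)
    rw [Function.update_eq_self] at this
    rw [this]
    refine Finset.sum_congr rfl fun u _ => ?_
    by_cases hu : α u = 0
    · rw [hu]; simp
    congr 1
    have hf := h2 u hu
    apply le_antisymm
    · obtain ⟨y', hy', e⟩ := hg.exists_eq hf
      obtain ⟨y, hy, rfl⟩ := hy'
      rw [← e]
      rcases Finset.mem_insert.1 (Finset.mem_coe.1 hy) with rfl | hy
      · have hpos : 0 < α u := lt_of_le_of_ne (h1 u) (Ne.symm hu)
        have e1 := h4 l c hc u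
        have e2 := h4 k a ha u
        have e3 := h4 k x hx u
        rw [hca] at e1
        have e4 : (0:ℝ) ≤ if u = φ k x then 1 else 0 := by split_ifs <;> norm_num
        have e5 : α u * (Φ.vec u ⬝ᵥ toR p) ≤ α u * h l u := by
          rw [hp, toR_sub, toR_add, dotProduct_sub, dotProduct_add, mul_sub, mul_add]
          linarith
        exact le_of_mul_le_mul_left e5 hpos
      · exact (X.sp l).1 _ (Set.mem_image_of_mem _ hy) u
    · refine (X.sp l).le hg (Set.image_mono ?_) u hf
      simp
  set o : Fin N := ⟨0, hN⟩ with ho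
  by_cases hall : ∀ i, ∃ c ∈ A i, ∃ a ∈ A o, φ i c = φ o a
  · choose c hc a ha hca using hall
    have le1 : ∀ i u, Φ.Face {u} → h i u ≤ (h o + Φ.ell (toR (c i) - toR (a i))) u := by
      intro i u hu
      obtain ⟨y', hy', e⟩ := (X.sp i).exists_eq hu
      obtain ⟨y, hy, rfl⟩ := hy'
      have hy2 := trans o i (a i) (ha i) (c i) (hc i) (hca i).symm y hy
      have := (X.sp o).1 _ (Set.mem_image_of_mem _ hy2) u
      rw [toR_sub, toR_add, dotProduct_sub, dotProduct_add] at this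
      rw [← e, Pi.add_apply, Fan.ell, dotProduct_sub]
      linarith
    have le2 : ∀ i u, Φ.Face {u} → (h o + Φ.ell (toR (c i) - toR (a i))) u ≤ h i u := by
      intro i u hu
      obtain ⟨y', hy', e⟩ := (X.sp o).exists_eq hu
      obtain ⟨y, hy, rfl⟩ := hy'
      have hy2 := trans i o (c i) (hc i) (a i) (ha i) (hca i) y hy
      have := (X.sp i).1 _ (Set.mem_image_of_mem _ hy2) u
      rw [toR_sub, toR_add, dotProduct_sub, dotProduct_add] at this
      rw [Pi.add_apply, ← e, Fan.ell, dotProduct_sub]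
      linarith
    have hTb : ∀ i, h o + Φ.ell (toR (c i) - toR (a i)) ∈ Φ.Tb := fun i => Tb_add (X.Tb o) (ell_Tb _)
    have a1 := Psi_ofFn_mono (C := C) (f := fun s => h (b s)) (g := fun s => h o + Φ.ell (toR (c (b s)) - toR (a (b s))))
      (fun s => le1 (b s)) (fun s => X.Tb _) (fun s => hTb _)
    have a2 := Psi_ofFn_mono (C := C) (f := fun s => h o + Φ.ell (toR (c s) - toR (a s))) (g := h)
      le2 hTb X.Tb
    have s1 := seg_shift (C := C) (n := N) (fun s => h o) (fun s => toR (c (b s)) - toR (a (b s))) []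
    have s2 := seg_shift (C := C) (n := N) (fun s => h o) (fun s => toR (c s) - toR (a s)) []
    simp only [List.nil_append] at s1 s2
    rw [X.MV_eq, ← hV, Esterov.MV_eq hN X.vol A h X.sp]
    rw [s1] at a1
    rw [s2] at a2
    exact a1.trans a2
  · exfalso
    set I : Finset (Fin N) := Finset.univ.filter fun i => ∃ c ∈ A i, ∃ a ∈ A o, φ i c = φ o a with hI
    have hIm : ∀ i, i ∈ I ↔ ∃ c ∈ A i, ∃ a ∈ A o, φ i c = φ o a := fun i => by simp [hI]
    obtain ⟨a0, ha0⟩ := H.ne o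
    have hoI : o ∈ I := (hIm o).2 ⟨a0, ha0, a0, ha0, rfl⟩
    have hcI : I.card < N := by
      have : I.card < Fintype.card (Fin N) := by
        obtain ⟨i, hi⟩ := not_forall.1 hall
        exact Finset.card_lt_univ_of_notMem (x := i) (fun hh => hi ((hIm i).1 hh))
      simpa using this
    have hc0 : 0 < I.card := Finset.card_pos.2 ⟨o, hoI⟩
    have hcc : Iᶜ.card = N - I.card := by rw [Finset.card_compl]; simp
    have r1 := H.rk I hc0 hcI
    have r2 := H.rk Iᶜ (by omega) (by omega)
    have hsup := Submodule.finrank_sup_add_finrank_inf_eq (spn (DX A) I) (spn (DX A) Iᶜ)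
    have hle : Module.finrank ℝ ↥(spn (DX A) I ⊔ spn (DX A) Iᶜ) ≤ N := by
      refine (Submodule.finrank_le _).trans ?_
      simp
    have hpos : 0 < Module.finrank ℝ ↥(spn (DX A) I ⊓ spn (DX A) Iᶜ) := by
      unfold rkk at r1 r2
      omega
    rw [Module.finrank_pos_iff_exists_ne_zero] at hpos
    obtain ⟨⟨v, hv1, hv2⟩, hv0⟩ := hpos
    apply hv0
    have hv : v ∈ Submodule.span ℝ (Set.range fun a : A o => toR a.1 - toR a0) := by
      have : spn (DX A) I ≤ Submodule.span ℝ (Set.range fun a : A o => toR a.1 - toR a0) := by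
        rw [spn_le_iff]
        intro i hi x hx
        obtain ⟨p, hp, q, hq, rfl⟩ := mem_DX.1 hx
        obtain ⟨c, hc, a, ha, hca⟩ := (hIm i).1 hi
        have hp' := trans o i a ha c hc hca.symm p hp
        have hq' := trans o i a ha c hc hca.symm q hq
        have e : toR q - toR p = (toR (a + q - c) - toR a0) - (toR (a + p - c) - toR a0) := by
          simp only [toR_sub, toR_add]; abel
        rw [e]
        exact Submodule.sub_mem _ (Submodule.subset_span ⟨⟨_, hq'⟩, rfl⟩) (Submodule.subset_span ⟨⟨_, hp'⟩, rfl⟩)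
      exact this hv1
    have hz : ∀ d ∈ A o, α (φ o d) * (Φ.vec (φ o d) ⬝ᵥ v) = 0 := by
      intro d hd
      set r := φ o d with hr
      let W : Submodule ℝ (Fin N → ℝ) :=
        { carrier := {v | α r * (Φ.vec r ⬝ᵥ v) = 0}
          add_mem' := by
            intro x y hx hy
            simp only [Set.mem_setOf_eq] at hx hy ⊢
            rw [dotProduct_add, mul_add, hx, hy, add_zero]
          zero_mem' := by simp
          smul_mem' := by
            intro t x hx
            simp only [Set.mem_setOf_eq] at hx ⊢
            rw [dotProduct_smul, smul_eq_mul, mul_left_comm, hx, mul_zero] }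
      have : spn (DX A) Iᶜ ≤ W := by
        rw [spn_le_iff]
        intro i hi x hx
        obtain ⟨p, hp, q, hq, rfl⟩ := mem_DX.1 hx
        have hni : ¬ ∃ c ∈ A i, ∃ a ∈ A o, φ i c = φ o a := by
          rw [← hIm]; simpa using hi
        have n1 : ¬ r = φ i p := fun hh => hni ⟨p, hp, d, hd, hh.symm⟩
        have n2 : ¬ r = φ i q := fun hh => hni ⟨q, hq, d, hd, hh.symm⟩
        have e1 := h4 i p hp r
        have e2 := h4 i q hq r
        rw [if_neg n1] at e1
        rw [if_neg n2] at e2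
        show α r * (Φ.vec r ⬝ᵥ (toR q - toR p)) = 0
        rw [dotProduct_sub, mul_sub]; linarith
      exact this hv2
    rw [Submodule.mem_span_range_iff_exists_fun] at hv
    obtain ⟨g, rfl⟩ := hv
    have hg : ∀ d : A o, d.1 ≠ a0 → g d = 0 := by
      intro d hd
      have := hz d.1 d.2
      rw [dotProduct_sum, Finset.mul_sum, Finset.sum_eq_single d] at this
      · have e1 := h4 o d.1 d.2 (φ o d.1)
        have e2 := h4 o a0 ha0 (φ o d.1)
        rw [if_pos rfl] at e1
        rw [if_neg (fun hh => hd (h5 o _ d.2 _ ha0 hh))] at e2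
        rw [dotProduct_smul, smul_eq_mul, dotProduct_sub, mul_left_comm, mul_sub] at this
        rw [show α (φ o d.1) * (Φ.vec (φ o d.1) ⬝ᵥ toR d.1) - α (φ o d.1) * (Φ.vec (φ o d.1) ⬝ᵥ toR a0) = -1 by linarith] at this
        linarith
      · intro e _ hed
        have e1 := h4 o e.1 e.2 (φ o d.1)
        have e2 := h4 o a0 ha0 (φ o d.1)
        rw [if_neg (fun hh => hed (Subtype.ext (h5 o _ d.2 _ e.2 hh)).symm)] at e1
        rw [if_neg (fun hh => hd (h5 o _ d.2 _ ha0 hh))] at e2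
        rw [dotProduct_smul, smul_eq_mul, dotProduct_sub, mul_left_comm, mul_sub]
        rw [show α (φ o d.1) * (Φ.vec (φ o d.1) ⬝ᵥ toR e.1) - α (φ o d.1) * (Φ.vec (φ o d.1) ⬝ᵥ toR a0) = 0 by linarith]
        ring
      · simp
    apply Subtype.ext
    show ∑ a : A o, g a • (toR a.1 - toR a0) = 0
    apply Finset.sum_eq_zero
    intro d _
    by_cases hd : d.1 = a0
    · rw [hd, sub_self, smul_zero]
    · rw [hg d hd, zero_smul]

lemma one_case {N : ℕ} (m : ℕ) : ∀ {A : Fin N → Finset (Fin N → ℤ)}, Irr A → MV A = 1 →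
    N * (N + 1) ≤ m + ∑ i, (A i).card → ∀ b : Fin N → Fin N, MV (fun s => A (b s)) ≤ 1 := by
  classical
  induction m with
  | zero =>
    intro A H hV hm b
    apply max_case H hV
    intro l p hp
    by_contra hpl
    have hN : 0 < N := by have := H.hN; omega
    set A' := Function.update A l (insert p (A l)) with hA'
    have hs : ∀ i, A i ⊆ A' i := by
      intro i
      by_cases hi : i = l
      · subst hi; simp [hA']
      · simp [hA', Function.update_of_ne hi]
    have H' := H.mono hs
    obtain ⟨ι, _, _, Φ, C, h, X⟩ := exists_ctx hN A' H'.ne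
    have hc : ∑ i, (A' i).card ≤ ∑ i : Fin N, (N + 1) := Finset.sum_le_sum fun i _ => X.card_le H' hp i
    have hlt : ∑ i, (A i).card < ∑ i, (A' i).card := by
      apply Finset.sum_lt_sum (fun i _ => Finset.card_le_card (hs i))
      exact ⟨l, by simp, by simp [hA', hpl]⟩
    simp at hc
    omega
  | succ m ih =>
    intro A H hV hm b
    by_cases hmax : ∀ l p, MV (Function.update A l (insert p (A l))) = 1 → p ∈ A l
    · exact max_case H hV hmax b
    · push Not at hmax
      obtain ⟨l, p, hp, hpl⟩ := hmax
      have hN : 0 < N := by have := H.hN; omega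
      set A' := Function.update A l (insert p (A l)) with hA'
      have hs : ∀ i, A i ⊆ A' i := by
        intro i
        by_cases hi : i = l
        · subst hi; simp [hA']
        · simp [hA', Function.update_of_ne hi]
      have H' := H.mono hs
      have hlt : ∑ i, (A i).card < ∑ i, (A' i).card := by
        apply Finset.sum_lt_sum (fun i _ => Finset.card_le_card (hs i))
        exact ⟨l, by simp, by simp [hA', hpl]⟩
      exact (MV_mono hN (fun s => H.ne _) (fun s => hs (b s))).trans (ih H' hp (by omega) b)

lemma MV_empty_one (A : Fin 1 → Finset (Fin 1 → ℤ)) (h : A 0 = ∅) : MV A = 0 := by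
  unfold MV
  apply Finset.sum_eq_zero
  intro S hS
  have : ∑ i ∈ S, toR '' (A i : Set (Fin 1 → ℤ)) = ∅ := by
    have hS' : S = {0} := by
      ext x
      have hx : x = 0 := Subsingleton.elim _ _
      subst hx
      simp only [Finset.mem_filter] at hS
      obtain ⟨y, hy⟩ := hS.2
      have hy0 : y = 0 := Subsingleton.elim _ _
      subst hy0
      simp [hy]
    rw [hS']
    simp [h]
  rw [this]
  simp

theorem mixed_volume_subtuple_bound (N : ℕ) (A B : Fin N → Finset (Fin N → ℤ))
    (hA : IsIrreducibleTuple A) (hB : ∀ i, ∃ j, B i = A j) :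
    MV B ≤ (MV A) ^ (2 ^ N) := by
  choose b hb using hB
  have hBe : B = fun s => A (b s) := funext hb
  subst hBe
  rcases Nat.lt_or_ge N 2 with hN | hN
  · have hbid : (fun s => A (b s)) = A := by
      funext s
      have : Subsingleton (Fin N) := by
        interval_cases N <;> infer_instance
      rw [Subsingleton.elim (b s) s]
    rw [hbid]
    interval_cases N
    · have : MV A = 0 := by
        unfold MV
        apply Finset.sum_eq_zero
        intro S hS
        simp only [Finset.mem_filter] at hS
        obtain ⟨y, _⟩ := hS.2
        exact y.elim0
      rw [this]; simp
    · by_cases h0 : A 0 = ∅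
      · rw [MV_empty_one A h0]; simp
      · obtain ⟨ι, _, _, Φ, C, h, X⟩ := exists_ctx one_pos A (fun i => by
          rw [Subsingleton.elim i 0]; exact Finset.nonempty_iff_ne_empty.2 h0)
        obtain ⟨m, hm⟩ := X.nat id
        simp only [id] at hm
        rw [show MV A = MV (fun s => A s) from rfl, hm]
        norm_cast
        exact Nat.le_self_pow (by norm_num) m
  · have H : Irr A := ⟨hN, fun I h0 h1 => irr_rk hA I h0 h1⟩
    obtain ⟨ι, _, _, Φ, C, h, X⟩ := exists_ctx (by omega) A H.ne
    have hge := H.MV_ge X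
    obtain ⟨m, hm⟩ := X.nat id
    have hm' : MV A = m := hm
    by_cases h1 : m ≤ 1
    · have hV : MV A = 1 := by
        rw [hm'] at hge ⊢
        have : 1 ≤ m := by exact_mod_cast hge
        have : m = 1 := by omega
        rw [this]; norm_num
      rw [hV, one_pow]
      exact one_case (N * (N + 1)) H hV (by omega) b
    · apply X.bound_two H
      rw [hm']
      exact_mod_cast (by omega : 2 ≤ m)
end Esterov
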